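/- Under assumptions (A1) and (A2), suppose for each (x,μ) that π(·;x,μ) is an invariant probability measure of L_{x,μ}, and let B : ℝ^d×ℝ^d×P₂(ℝ^d) → ℝ^k be jointly continuous, satisfy the centering condition ∫ B(x,y,μ) π(dy;x,μ) = 0 for all (x,μ), grow at most polynomially in y uniformly in (x,μ), and be locally Hölder continuous in y uniformly in (x,μ). Then there exists u : ℝ^d×ℝ^d×P₂(ℝ^d) → ℝ^k such that: for every (x,μ) the map y ↦ u(x,y,μ) is twice continuously differentiable and L_{x,μ}u_l(x,y,μ) = B_l(x,y,μ) for all y ∈ ℝ^d and l = 1,…,k; ∫ u(x,y,μ) π(dy;x,μ) = 0; and u, ∇_y u and ∇²_y u grow at most polynomially in y uniformly in (x,μ) and are locally Hölder continuous in y uniformly in (x,μ). Moreover u is unique: any other function with all of these properties equals u. -/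

import Mathlib

open MeasureTheory

noncomputable section

/-- First partial derivative of `φ : ℝ^d → ℝ` in the `i`-th coordinate direction. -/
def pd1 {d : ℕ} (φ : (Fin d → ℝ) → ℝ) (y : Fin d → ℝ) (i : Fin d) : ℝ :=
  fderiv ℝ φ y (Pi.single i 1)

/-- Second partial derivative of `φ : ℝ^d → ℝ` in the coordinate directions `i, j`. -/
def pd2 {d : ℕ} (φ : (Fin d → ℝ) → ℝ) (y : Fin d → ℝ) (i j : Fin d) : ℝ :=
  fderiv ℝ (fun z => fderiv ℝ φ z (Pi.single j 1)) y (Pi.single i 1)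

/-- The frozen generator `L φ (y) = f(y)·∇φ(y) + a(y):∇²φ(y)`. -/
def genL {d : ℕ} (f : (Fin d → ℝ) → Fin d → ℝ) (a : (Fin d → ℝ) → Fin d → Fin d → ℝ)
    (φ : (Fin d → ℝ) → ℝ) (y : Fin d → ℝ) : ℝ :=
  (∑ i, f y i * pd1 φ y i) + ∑ i, ∑ j, a y i j * pd2 φ y i j

/-- `C_b²` functions: twice continuously differentiable, bounded together with the
first and second derivatives. -/
def CbTwo {d : ℕ} (φ : (Fin d → ℝ) → ℝ) : Prop :=
  ContDiff ℝ 2 φ ∧ ∃ K : ℝ, ∀ y, |φ y| ≤ K ∧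
    ‖iteratedFDeriv ℝ 1 φ y‖ ≤ K ∧ ‖iteratedFDeriv ℝ 2 φ y‖ ≤ K

/-- An invariant probability measure of the frozen generator:
`∫ L φ dπ = 0` for every `φ ∈ C_b²`. -/
def IsInvariantMeasure {d : ℕ} (f : (Fin d → ℝ) → Fin d → ℝ)
    (a : (Fin d → ℝ) → Fin d → Fin d → ℝ) (π : Measure (Fin d → ℝ)) : Prop :=
  IsProbabilityMeasure π ∧
    ∀ φ : (Fin d → ℝ) → ℝ, CbTwo φ → ∫ y, genL f a φ y ∂π = 0

/-- `P₂(ℝ^d)`: Borel probability measures on `ℝ^d` with finite second moment.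
Its elements enter only as parameters. -/
def ProbMeas2 (d : ℕ) : Type :=
  {μ : Measure (Fin d → ℝ) // IsProbabilityMeasure μ ∧ Integrable (fun y => ‖y‖ ^ 2) μ}

/-- Assumption (A1): uniform ellipticity and boundedness of the symmetric diffusion
matrix `a`, two bounded `y`-derivatives, and uniform Hölder continuity in `y` of `a`
and these derivatives.  The parameter `p` ranges over the frozen data `(x, μ)`. -/
def AssumptionA1 {d : ℕ} {I : Type*} (a : I → (Fin d → ℝ) → Fin d → Fin d → ℝ) : Prop :=
  (∀ p y i j, a p y i j = a p y j i) ∧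
  (∃ lm lp : ℝ, 0 < lm ∧ lm ≤ lp ∧ ∀ p y (ξ : Fin d → ℝ),
      lm * ∑ i, ξ i ^ 2 ≤ 2 * ∑ i, ∑ j, ξ i * a p y i j * ξ j ∧
      2 * ∑ i, ∑ j, ξ i * a p y i j * ξ j ≤ lp * ∑ i, ξ i ^ 2) ∧
  (∃ K : ℝ, ∀ p y i j, |a p y i j| ≤ K) ∧
  (∀ p i j, ContDiff ℝ 2 (fun y => a p y i j)) ∧
  (∃ K : ℝ, ∀ p y i j,
      ‖iteratedFDeriv ℝ 1 (fun z => a p z i j) y‖ ≤ K ∧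
      ‖iteratedFDeriv ℝ 2 (fun z => a p z i j) y‖ ≤ K) ∧
  (∃ K θ : ℝ, 0 < θ ∧ θ ≤ 1 ∧ ∀ p y y' i j,
      |a p y i j - a p y' i j| ≤ K * ‖y - y'‖ ^ θ ∧
      ‖iteratedFDeriv ℝ 1 (fun z => a p z i j) y -
        iteratedFDeriv ℝ 1 (fun z => a p z i j) y'‖ ≤ K * ‖y - y'‖ ^ θ ∧
      ‖iteratedFDeriv ℝ 2 (fun z => a p z i j) y -
        iteratedFDeriv ℝ 2 (fun z => a p z i j) y'‖ ≤ K * ‖y - y'‖ ^ θ)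

/-- Assumption (A2): dissipativity and linear growth of the drift `f`, two bounded
`y`-derivatives, and uniform Hölder continuity in `y` of `f` and these derivatives.
The parameter `p` ranges over the frozen data `(x, μ)`. -/
def AssumptionA2 {d : ℕ} {I : Type*} (f : I → (Fin d → ℝ) → Fin d → ℝ) : Prop :=
  (∃ β C : ℝ, 0 < β ∧ 0 < C ∧ ∀ p y,
      (∑ i, f p y i * y i) ≤ -β * (∑ i, y i ^ 2) + C) ∧
  (∃ C : ℝ, ∀ p y, ‖f p y‖ ≤ C * (1 + ‖y‖)) ∧
  (∀ p i, ContDiff ℝ 2 (fun y => f p y i)) ∧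
  (∃ K : ℝ, ∀ p y i,
      ‖iteratedFDeriv ℝ 1 (fun z => f p z i) y‖ ≤ K ∧
      ‖iteratedFDeriv ℝ 2 (fun z => f p z i) y‖ ≤ K) ∧
  (∃ K θ : ℝ, 0 < θ ∧ θ ≤ 1 ∧ ∀ p y y' i,
      |f p y i - f p y' i| ≤ K * ‖y - y'‖ ^ θ ∧
      ‖iteratedFDeriv ℝ 1 (fun z => f p z i) y -
        iteratedFDeriv ℝ 1 (fun z => f p z i) y'‖ ≤ K * ‖y - y'‖ ^ θ ∧
      ‖iteratedFDeriv ℝ 2 (fun z => f p z i) y -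
        iteratedFDeriv ℝ 2 (fun z => f p z i) y'‖ ≤ K * ‖y - y'‖ ^ θ)

/-! ## Basic calculus for partial derivatives -/

section Basic

variable {d : ℕ}

lemma pd2_eq (φ : (Fin d → ℝ) → ℝ) (y : Fin d → ℝ) (i j : Fin d) :
    pd2 φ y i j = pd1 (fun z => pd1 φ z j) y i := rfl

lemma fderiv_eq_sum_pd1 (φ : (Fin d → ℝ) → ℝ) (y v : Fin d → ℝ) :
    fderiv ℝ φ y v = ∑ i, v i * pd1 φ y i := by
  conv_lhs => rw [pi_eq_sum_univ' v]
  simp [pd1, map_sum]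

lemma C2_diff {u : (Fin d → ℝ) → ℝ} (hu : ContDiff ℝ 2 u) : Differentiable ℝ u :=
  hu.differentiable (by norm_num)

lemma C1_pd1 {u : (Fin d → ℝ) → ℝ} {n : WithTop ℕ∞} (hu : ContDiff ℝ (n + 1) u) (i : Fin d) :
    ContDiff ℝ n (fun y => pd1 u y i) := by
  unfold pd1
  exact (hu.fderiv_right le_rfl).clm_apply contDiff_const

lemma C2_pd1 {u : (Fin d → ℝ) → ℝ} (hu : ContDiff ℝ 2 u) (i : Fin d) :
    ContDiff ℝ 1 (fun y => pd1 u y i) := C1_pd1 (n := 1) (by simpa [one_add_one_eq_two] using hu) i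

lemma C2_pd1_diff {u : (Fin d → ℝ) → ℝ} (hu : ContDiff ℝ 2 u) (i : Fin d) :
    Differentiable ℝ (fun y => pd1 u y i) := (C2_pd1 hu i).differentiable (by norm_num)

lemma C1_pd1_cont {u : (Fin d → ℝ) → ℝ} (hu : ContDiff ℝ 1 u) (i : Fin d) :
    Continuous (fun y => pd1 u y i) := by
  have := C1_pd1 (n := 0) (u := u) (by simpa using hu) i
  exact this.continuous

lemma C2_pd1_cont {u : (Fin d → ℝ) → ℝ} (hu : ContDiff ℝ 2 u) (i : Fin d) :
    Continuous (fun y => pd1 u y i) := (C2_pd1 hu i).continuous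

lemma C2_pd2_cont {u : (Fin d → ℝ) → ℝ} (hu : ContDiff ℝ 2 u) (i j : Fin d) :
    Continuous (fun y => pd2 u y i j) := C1_pd1_cont (C2_pd1 hu j) i

lemma norm_single_one_le (i : Fin d) : ‖(Pi.single i (1:ℝ) : Fin d → ℝ)‖ ≤ 1 := by
  rw [pi_norm_le_iff_of_nonneg zero_le_one]
  intro j
  by_cases h : j = i
  · subst h; simp
  · simp [h]

lemma abs_pd1_le (φ : (Fin d → ℝ) → ℝ) (y : Fin d → ℝ) (i : Fin d) :
    |pd1 φ y i| ≤ ‖fderiv ℝ φ y‖ := by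
  unfold pd1
  calc _ ≤ ‖fderiv ℝ φ y‖ * ‖(Pi.single i (1:ℝ) : Fin d → ℝ)‖ := (fderiv ℝ φ y).le_opNorm _
    _ ≤ ‖fderiv ℝ φ y‖ * 1 := by gcongr; exact norm_single_one_le i
    _ = _ := mul_one _

lemma norm_fderiv_le_of_pd1 (φ : (Fin d → ℝ) → ℝ) (y : Fin d → ℝ) {S : ℝ} (hS : 0 ≤ S)
    (h : ∀ i, |pd1 φ y i| ≤ S) : ‖fderiv ℝ φ y‖ ≤ d * S := by
  refine ContinuousLinearMap.opNorm_le_bound _ (by positivity) fun v => ?_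
  rw [fderiv_eq_sum_pd1]
  calc ‖∑ i, v i * pd1 φ y i‖ ≤ ∑ i : Fin d, ‖v‖ * S := by
        refine norm_sum_le_of_le _ fun i _ => ?_
        rw [norm_mul]
        exact mul_le_mul (norm_le_pi_norm v i) (h i) (norm_nonneg _) (norm_nonneg _)
    _ = _ := by simp; ring

/-- mean value inequality on a convex set -/
lemma mvt_pd1 {φ : (Fin d → ℝ) → ℝ} (hφ : Differentiable ℝ φ) {s : Set (Fin d → ℝ)}
    (hs : Convex ℝ s) {S : ℝ} (hS : 0 ≤ S) (h : ∀ z ∈ s, ∀ i, |pd1 φ z i| ≤ S)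
    {y y' : Fin d → ℝ} (hy : y ∈ s) (hy' : y' ∈ s) : |φ y - φ y'| ≤ d * S * ‖y - y'‖ :=
  hs.norm_image_sub_le_of_norm_fderiv_le (𝕜 := ℝ) (fun x _ => hφ x)
    (fun x hx => norm_fderiv_le_of_pd1 φ x hS (h x hx)) hy' hy

/-- first order Taylor bound -/
lemma taylor_pd1 {φ : (Fin d → ℝ) → ℝ} (hφ : Differentiable ℝ φ) {s : Set (Fin d → ℝ)}
    (hs : Convex ℝ s) {S : ℝ} (hS : 0 ≤ S) {y y' : Fin d → ℝ}
    (h : ∀ z ∈ s, ∀ i, |pd1 φ z i - pd1 φ y i| ≤ S)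
    (hy : y ∈ s) (hy' : y' ∈ s) :
    |φ y' - φ y - ∑ i, (y' - y) i * pd1 φ y i| ≤ d * S * ‖y' - y‖ := by
  let l : (Fin d → ℝ) →L[ℝ] ℝ := fderiv ℝ φ y
  have hl : ∀ z, pd1 (fun x => φ x - l x) z = fun i => pd1 φ z i - pd1 φ y i := by
    intro z; funext i
    unfold pd1
    rw [fderiv_fun_sub (hφ z) l.differentiableAt, l.fderiv]; rfl
  have := mvt_pd1 (φ := fun x => φ x - l x) (hφ.sub l.differentiable) hs hS
    (fun z hz i => by rw [hl]; exact h z hz i) hy' hy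
  rw [← fderiv_eq_sum_pd1]
  have e : φ y' - φ y - (fderiv ℝ φ y) (y' - y) = φ y' - l y' - (φ y - l y) := by
    rw [map_sub]; simp only [l]; ring
  rw [e]; exact this

lemma pd1_add {u v : (Fin d → ℝ) → ℝ} (hu : Differentiable ℝ u) (hv : Differentiable ℝ v)
    (y : Fin d → ℝ) (i : Fin d) : pd1 (fun z => u z + v z) y i = pd1 u y i + pd1 v y i := by
  unfold pd1; rw [fderiv_fun_add (hu y) (hv y)]; rfl

lemma pd1_sub {u v : (Fin d → ℝ) → ℝ} (hu : Differentiable ℝ u) (hv : Differentiable ℝ v)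
    (y : Fin d → ℝ) (i : Fin d) : pd1 (fun z => u z - v z) y i = pd1 u y i - pd1 v y i := by
  unfold pd1; rw [fderiv_fun_sub (hu y) (hv y)]; rfl

lemma pd1_mul {u v : (Fin d → ℝ) → ℝ} (hu : Differentiable ℝ u) (hv : Differentiable ℝ v)
    (y : Fin d → ℝ) (i : Fin d) :
    pd1 (fun z => u z * v z) y i = u y * pd1 v y i + v y * pd1 u y i := by
  unfold pd1; rw [fderiv_fun_mul (hu y) (hv y)]; rfl

lemma pd1_const (c : ℝ) (y : Fin d → ℝ) (i : Fin d) : pd1 (fun _ => c) y i = 0 := by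
  unfold pd1; simp

lemma pd1_cmul {u : (Fin d → ℝ) → ℝ} (hu : Differentiable ℝ u) (c : ℝ)
    (y : Fin d → ℝ) (i : Fin d) : pd1 (fun z => c * u z) y i = c * pd1 u y i := by
  rw [pd1_mul (differentiable_const c) hu, pd1_const]; ring

lemma pd2_add {u v : (Fin d → ℝ) → ℝ} (hu : ContDiff ℝ 2 u) (hv : ContDiff ℝ 2 v)
    (y : Fin d → ℝ) (i j : Fin d) :
    pd2 (fun z => u z + v z) y i j = pd2 u y i j + pd2 v y i j := by
  rw [pd2_eq]
  simp_rw [pd1_add (C2_diff hu) (C2_diff hv)]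
  rw [pd1_add (C2_pd1_diff hu j) (C2_pd1_diff hv j)]; rfl

lemma pd2_sub {u v : (Fin d → ℝ) → ℝ} (hu : ContDiff ℝ 2 u) (hv : ContDiff ℝ 2 v)
    (y : Fin d → ℝ) (i j : Fin d) :
    pd2 (fun z => u z - v z) y i j = pd2 u y i j - pd2 v y i j := by
  rw [pd2_eq]
  simp_rw [pd1_sub (C2_diff hu) (C2_diff hv)]
  rw [pd1_sub (C2_pd1_diff hu j) (C2_pd1_diff hv j)]; rfl

lemma pd2_cmul {u : (Fin d → ℝ) → ℝ} (hu : ContDiff ℝ 2 u) (c : ℝ)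
    (y : Fin d → ℝ) (i j : Fin d) : pd2 (fun z => c * u z) y i j = c * pd2 u y i j := by
  rw [pd2_eq]
  simp_rw [pd1_cmul (C2_diff hu)]
  rw [pd1_cmul (C2_pd1_diff hu j)]; rfl

lemma pd2_const (c : ℝ) (y : Fin d → ℝ) (i j : Fin d) : pd2 (fun _ => c) y i j = 0 := by
  rw [pd2_eq]; simp_rw [pd1_const]

lemma pd2_mul {u v : (Fin d → ℝ) → ℝ} (hu : ContDiff ℝ 2 u) (hv : ContDiff ℝ 2 v)
    (y : Fin d → ℝ) (i j : Fin d) :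
    pd2 (fun z => u z * v z) y i j = u y * pd2 v y i j + pd1 v y j * pd1 u y i
      + (v y * pd2 u y i j + pd1 u y j * pd1 v y i) := by
  rw [pd2_eq]
  simp_rw [pd1_mul (C2_diff hu) (C2_diff hv)]
  rw [pd1_add (u := fun z => u z * pd1 v z j) (v := fun z => v z * pd1 u z j)
      ((C2_diff hu).mul (C2_pd1_diff hv j)) ((C2_diff hv).mul (C2_pd1_diff hu j)),
    pd1_mul (C2_diff hu) (C2_pd1_diff hv j), pd1_mul (C2_diff hv) (C2_pd1_diff hu j)]
  rfl

/-- affine rescaling -/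
lemma pd1_scale {u : (Fin d → ℝ) → ℝ} (hu : Differentiable ℝ u) (y : Fin d → ℝ) (r : ℝ)
    (z : Fin d → ℝ) (i : Fin d) :
    pd1 (fun z => u (y + r • z)) z i = r * pd1 u (y + r • z) i := by
  unfold pd1
  have h1 : HasFDerivAt (fun z : Fin d → ℝ => y + r • z)
      (r • ContinuousLinearMap.id ℝ (Fin d → ℝ)) z :=
    ((hasFDerivAt_id z).const_smul r).const_add y
  have := ((hu (y + r • z)).hasFDerivAt.comp z h1).fderiv
  rw [show (fun z => u (y + r • z)) = u ∘ (fun z => y + r • z) from rfl, this]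
  simp

lemma contDiff_scale {n : WithTop ℕ∞} {u : (Fin d → ℝ) → ℝ} (hu : ContDiff ℝ n u)
    (y : Fin d → ℝ) (r : ℝ) : ContDiff ℝ n (fun z => u (y + r • z)) :=
  by
  refine hu.comp (?_ : ContDiff ℝ n (fun z : Fin d → ℝ => y + r • z))
  fun_prop

lemma pd2_scale {u : (Fin d → ℝ) → ℝ} (hu : ContDiff ℝ 2 u) (y : Fin d → ℝ) (r : ℝ)
    (z : Fin d → ℝ) (i j : Fin d) :
    pd2 (fun z => u (y + r • z)) z i j = r ^ 2 * pd2 u (y + r • z) i j := by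
  rw [pd2_eq]
  simp_rw [pd1_scale (C2_diff hu)]
  have := contDiff_scale (C2_pd1 hu j) y r
  rw [pd1_cmul (this.differentiable (by norm_num)), pd1_scale (C2_pd1_diff hu j)]
  rw [pd2_eq]; ring

/-- symmetry of second derivatives -/
lemma pd2_symm {u : (Fin d → ℝ) → ℝ} (hu : ContDiff ℝ 2 u) (y : Fin d → ℝ) (i j : Fin d) :
    pd2 u y i j = pd2 u y j i := by
  have h1 : ∀ i j, pd2 u y i j = fderiv ℝ (fderiv ℝ u) y (Pi.single i 1) (Pi.single j 1) := by
    intro i j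
    unfold pd2
    have hd : DifferentiableAt ℝ (fderiv ℝ u) y :=
      (hu.fderiv_right (m := 1) (by norm_num [one_add_one_eq_two])).differentiable (by norm_num) y
    rw [fderiv_clm_apply hd (differentiableAt_const _)]
    simp
  rw [h1, h1]
  exact (hu.contDiffAt.isSymmSndFDerivAt (by simp)) _ _

/-! linearity of `genL` -/

variable (f : (Fin d → ℝ) → Fin d → ℝ) (a : (Fin d → ℝ) → Fin d → Fin d → ℝ)

lemma genL_add {u v : (Fin d → ℝ) → ℝ} (hu : ContDiff ℝ 2 u) (hv : ContDiff ℝ 2 v)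
    (y : Fin d → ℝ) : genL f a (fun z => u z + v z) y = genL f a u y + genL f a v y := by
  unfold genL
  simp_rw [pd1_add (C2_diff hu) (C2_diff hv), pd2_add hu hv, mul_add, Finset.sum_add_distrib]
  ring

lemma genL_sub {u v : (Fin d → ℝ) → ℝ} (hu : ContDiff ℝ 2 u) (hv : ContDiff ℝ 2 v)
    (y : Fin d → ℝ) : genL f a (fun z => u z - v z) y = genL f a u y - genL f a v y := by
  unfold genL
  simp_rw [pd1_sub (C2_diff hu) (C2_diff hv), pd2_sub hu hv, mul_sub, Finset.sum_sub_distrib]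
  ring

lemma genL_cmul {u : (Fin d → ℝ) → ℝ} (hu : ContDiff ℝ 2 u) (c : ℝ)
    (y : Fin d → ℝ) : genL f a (fun z => c * u z) y = c * genL f a u y := by
  unfold genL
  simp_rw [pd1_cmul (C2_diff hu), pd2_cmul hu, mul_add, Finset.mul_sum]
  congr 1
  · exact Finset.sum_congr rfl fun i _ => by ring
  · exact Finset.sum_congr rfl fun i _ => Finset.sum_congr rfl fun j _ => by ring

lemma genL_const (c : ℝ) (y : Fin d → ℝ) : genL f a (fun _ => c) y = 0 := by
  unfold genL; simp [pd1_const, pd2_const]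

lemma genL_congr_pd {u v : (Fin d → ℝ) → ℝ} {y : Fin d → ℝ} (h1 : ∀ i, pd1 u y i = pd1 v y i)
    (h2 : ∀ i j, pd2 u y i j = pd2 v y i j) : genL f a u y = genL f a v y := by
  unfold genL; simp_rw [h1, h2]

/-- assembling `C²` functions from partial derivatives -/
lemma contDiff_two_of_partials {u : (Fin d → ℝ) → ℝ} {v : Fin d → (Fin d → ℝ) → ℝ}
    {w : Fin d → Fin d → (Fin d → ℝ) → ℝ}
    (hu : ∀ y, HasFDerivAt u (∑ i, v i y • (ContinuousLinearMap.proj i : (Fin d → ℝ) →L[ℝ] ℝ)) y)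
    (hv : ∀ j y, HasFDerivAt (v j)
      (∑ i, w i j y • (ContinuousLinearMap.proj i : (Fin d → ℝ) →L[ℝ] ℝ)) y)
    (hw : ∀ i j, Continuous (w i j)) :
    ContDiff ℝ 2 u ∧ (∀ y i, pd1 u y i = v i y) ∧ (∀ y i j, pd2 u y i j = w i j y) := by
  have h1 : ∀ y i, pd1 u y i = v i y := by
    intro y i; unfold pd1; rw [(hu y).fderiv]
    simp [Pi.single_apply]
  have h2 : ∀ y i j, pd2 u y i j = w i j y := by
    intro y i j; rw [pd2_eq]; simp_rw [h1]; unfold pd1; rw [(hv j y).fderiv]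
    simp [Pi.single_apply]
  refine ⟨?_, h1, h2⟩
  have hv1 : ∀ j, ContDiff ℝ 1 (v j) := by
    intro j
    rw [contDiff_one_iff_fderiv]
    refine ⟨fun y => (hv j y).differentiableAt, ?_⟩
    have : fderiv ℝ (v j) = fun y =>
        ∑ i, w i j y • (ContinuousLinearMap.proj i : (Fin d → ℝ) →L[ℝ] ℝ) := by
      funext y; exact (hv j y).fderiv
    rw [this]
    exact continuous_finsetSum _ fun i _ => (hw i j).smul continuous_const
  have := (contDiff_succ_iff_fderiv (𝕜 := ℝ) (n := 1) (f := u)).2 ⟨fun y => (hu y).differentiableAt,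
    by simp, by
      have : fderiv ℝ u = fun y =>
          ∑ i, v i y • (ContinuousLinearMap.proj i : (Fin d → ℝ) →L[ℝ] ℝ) := by
        funext y; exact (hu y).fderiv
      rw [this]
      exact ContDiff.sum fun i _ => (hv1 i).smul contDiff_const⟩
  simpa [one_add_one_eq_two] using this

end Basic

/-! ## Gaussian weights -/

section Gauss

variable {d : ℕ}

/-- unnormalized Gaussian weight -/
def gs (z : Fin d → ℝ) : ℝ := Real.exp (-(∑ i, z i ^ 2) / 2)

lemma gs_pos (z : Fin d → ℝ) : 0 < gs z := Real.exp_pos _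

lemma gs_contDiff {n : WithTop ℕ∞} : ContDiff ℝ n (gs (d := d)) := by
  unfold gs
  fun_prop

lemma gs_cont : Continuous (gs (d := d)) := (gs_contDiff (n := 0)).continuous

lemma pd1_gs (z : Fin d → ℝ) (i : Fin d) : pd1 gs z i = -(z i * gs z) := by
  have h1 : ∀ j, HasFDerivAt (fun z : Fin d → ℝ => z j ^ 2)
      ((2 * z j) • (ContinuousLinearMap.proj j : (Fin d → ℝ) →L[ℝ] ℝ)) z := by
    intro j
    have := ((ContinuousLinearMap.proj j : (Fin d → ℝ) →L[ℝ] ℝ).hasFDerivAt (x := z)).pow 2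
    simpa using this
  have h2 : HasFDerivAt (fun z : Fin d → ℝ => -(∑ j, z j ^ 2) / 2)
      (-((2:ℝ)⁻¹ • ∑ j, (2 * z j) • (ContinuousLinearMap.proj j : (Fin d → ℝ) →L[ℝ] ℝ))) z := by
    have := ((HasFDerivAt.fun_sum (u := Finset.univ) fun j _ => h1 j).const_mul (2:ℝ)⁻¹).neg
    have e : (fun z : Fin d → ℝ => -(∑ j, z j ^ 2) / 2) = -fun y => 2⁻¹ * ∑ i, y i ^ 2 := by
      funext z; simp only [Pi.neg_apply]; ring
    rw [e]; exact this
  have h3 := h2.exp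
  unfold pd1
  rw [show gs (d := d) = fun z => Real.exp (-(∑ i, z i ^ 2) / 2) from rfl, h3.fderiv]
  simp [Pi.single_apply]
  ring

lemma norm_sq_le_sum (z : Fin d → ℝ) : ‖z‖ ^ 2 ≤ ∑ i, z i ^ 2 := by
  have h : ‖z‖ ≤ √(∑ i, z i ^ 2) := by
    rw [pi_norm_le_iff_of_nonneg (Real.sqrt_nonneg _)]
    intro i
    apply Real.le_sqrt_of_sq_le
    rw [Real.norm_eq_abs, sq_abs]
    exact Finset.single_le_sum (f := fun i => z i ^ 2) (fun i _ => sq_nonneg _) (Finset.mem_univ i)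
  calc ‖z‖ ^ 2 ≤ √(∑ i, z i ^ 2) ^ 2 := by gcongr
    _ = _ := Real.sq_sqrt (Finset.sum_nonneg fun i _ => sq_nonneg _)

lemma gs_poly_int (k : ℕ) : Integrable (fun z : Fin d → ℝ => (1 + ‖z‖) ^ k * gs z) := by
  have h1 : Integrable (fun z : Fin d → ℝ => ∏ i, Real.exp (-(1/4) * z i ^ 2)) :=
    Integrable.fintype_prod (f := fun _ : Fin d => fun x : ℝ => Real.exp (-(1/4) * x ^ 2))
      (fun i => integrable_exp_neg_mul_sq (by norm_num))
  refine (h1.const_mul (k.factorial * Real.exp 2)).mono'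
    ((by fun_prop : Continuous fun z : Fin d → ℝ => (1 + ‖z‖) ^ k).mul gs_cont).aestronglyMeasurable ?_
  refine Filter.Eventually.of_forall fun z => ?_
  have hz : 0 ≤ ‖z‖ := norm_nonneg z
  rw [Real.norm_of_nonneg (mul_nonneg (by positivity) (gs_pos z).le), ← Real.exp_sum]
  have h2 : (1 + ‖z‖) ^ k ≤ k.factorial * Real.exp (1 + ‖z‖) := by
    have := Real.pow_div_factorial_le_exp (1 + ‖z‖) (by positivity) k
    rwa [div_le_iff₀' (by positivity)] at this
  unfold gs
  calc _ ≤ k.factorial * Real.exp (1 + ‖z‖) * Real.exp (-(∑ i, z i ^ 2) / 2) := by gcongr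
    _ = k.factorial * Real.exp (1 + ‖z‖ -(∑ i, z i ^ 2) / 2) := by
        rw [mul_assoc, ← Real.exp_add]; ring_nf
    _ ≤ k.factorial * Real.exp (2 + ∑ i, -(1/4) * z i ^ 2) := by
        gcongr
        rw [← Finset.mul_sum]
        nlinarith [norm_sq_le_sum z, sq_nonneg (‖z‖ - 2)]
    _ = _ := by rw [Real.exp_add]; ring

lemma gint {φ : (Fin d → ℝ) → ℝ} (hc : Continuous φ) {C : ℝ} {k : ℕ}
    (hb : ∀ z, |φ z| ≤ C * (1 + ‖z‖) ^ k) : Integrable (fun z => φ z * gs z) := by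
  refine ((gs_poly_int k).const_mul C).mono' (hc.mul gs_cont).aestronglyMeasurable ?_
  refine Filter.Eventually.of_forall fun z => ?_
  rw [norm_mul, Real.norm_of_nonneg (gs_pos z).le, ← mul_assoc]
  exact mul_le_mul_of_nonneg_right (hb z) (gs_pos z).le

/-- moments of the weight -/
def gI (d k : ℕ) : ℝ := ∫ z : Fin d → ℝ, (1 + ‖z‖) ^ k * gs z

lemma gI_nonneg (k : ℕ) : 0 ≤ gI d k :=
  integral_nonneg fun z => mul_nonneg (by positivity) (gs_pos z).le

lemma gint_le {φ : (Fin d → ℝ) → ℝ} {C : ℝ} {k : ℕ}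
    (hb : ∀ z, |φ z| ≤ C * (1 + ‖z‖) ^ k) : |∫ z, φ z * gs z| ≤ C * gI d k := by
  unfold gI
  rw [← integral_const_mul]
  refine norm_integral_le_of_norm_le (f := fun z => φ z * gs z) ((gs_poly_int k).const_mul C)
    (Filter.Eventually.of_forall fun z => ?_)
  rw [norm_mul, Real.norm_of_nonneg (gs_pos z).le, ← mul_assoc]
  exact mul_le_mul_of_nonneg_right (hb z) (gs_pos z).le

lemma gI_zero_pos : 0 < ∫ z : Fin d → ℝ, gs z := by
  have hi : Integrable (gs (d := d)) := by simpa using gs_poly_int (d := d) 0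
  exact (integral_pos_iff_support_of_nonneg (fun z => (gs_pos z).le) hi).2 (by
    have : Function.support (gs (d := d)) = Set.univ := by
      ext z; simpa using (gs_pos z).ne'
    rw [this]; exact NeZero.pos _)

/-- Gaussian integration by parts -/
lemma gibp {φ : (Fin d → ℝ) → ℝ} (hφ : ContDiff ℝ 1 φ) (i : Fin d) {C : ℝ} {k : ℕ}
    (hb : ∀ z, |φ z| ≤ C * (1 + ‖z‖) ^ k) (hb1 : ∀ z, |pd1 φ z i| ≤ C * (1 + ‖z‖) ^ k) :
    ∫ z, pd1 φ z i * gs z = ∫ z, φ z * z i * gs z := by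
  have i1 : Integrable (fun z => pd1 φ z i * gs z) := gint (C1_pd1_cont hφ i) hb1
  have i2 : Integrable (fun z => φ z * gs z) := gint hφ.continuous hb
  have i3 : Integrable (fun z => φ z * z i * gs z) := by
    refine gint (hφ.continuous.mul (continuous_apply i)) (C := C) (k := k + 1) fun z => ?_
    rw [abs_mul, pow_succ, ← mul_assoc]
    refine mul_le_mul (hb z) ?_ (abs_nonneg _) ((abs_nonneg _).trans (hb z))
    have := norm_le_pi_norm z i
    rw [Real.norm_eq_abs] at this; linarith
  have e : ∀ z, φ z * fderiv ℝ gs z (Pi.single i 1) = -(φ z * z i * gs z) := by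
    intro z
    have := pd1_gs z i
    unfold pd1 at this; rw [this]; ring
  have := integral_mul_fderiv_eq_neg_fderiv_mul_of_integrable (μ := volume) (f := φ)
    (g := gs (d := d)) (v := Pi.single i 1) i1 (by simp_rw [e]; exact i3.neg) i2
    (fun x _ => hφ.differentiable (by norm_num) x)
    (fun x _ => (gs_contDiff (n := 1)).differentiable (by norm_num) x)
  simp_rw [e] at this
  rw [integral_neg, neg_inj] at this
  exact this.symm

lemma abs_coord_le (z : Fin d → ℝ) (i : Fin d) : |z i| ≤ 1 + ‖z‖ := by
  have := norm_le_pi_norm z i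
  rw [Real.norm_eq_abs] at this; linarith

lemma pd1_coord (z : Fin d → ℝ) (i l : Fin d) :
    pd1 (fun z : Fin d → ℝ => z i) z l = if i = l then 1 else 0 := by
  unfold pd1
  rw [show (fun z : Fin d → ℝ => z i) = (ContinuousLinearMap.proj i : (Fin d → ℝ) →L[ℝ] ℝ) from rfl,
    ContinuousLinearMap.fderiv]
  simp [Pi.single_apply]

end Gauss

section Gauss2

variable {d : ℕ}

/-- differentiation of averaged translates -/
lemma TI {Ω : Type*} [MeasurableSpace Ω] {ν : Measure Ω} {ρ : Ω → ℝ} (hρ : Integrable ρ ν)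
    {X : Ω → (Fin d → ℝ)} (hX : Measurable X) {φ : (Fin d → ℝ) → ℝ} (hφ : ContDiff ℝ 1 φ) {b : ℝ}
    (h0 : ∀ z, |φ z| ≤ b) (h1 : ∀ z i, |pd1 φ z i| ≤ b) :
    (∀ y, HasFDerivAt (fun y => ∫ ω, φ (y + X ω) * ρ ω ∂ν)
      (∑ i, (∫ ω, pd1 φ (y + X ω) i * ρ ω ∂ν) •
        (ContinuousLinearMap.proj i : (Fin d → ℝ) →L[ℝ] ℝ)) y) ∧
    Differentiable ℝ (fun y => ∫ ω, φ (y + X ω) * ρ ω ∂ν) ∧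
    ∀ y i, pd1 (fun y => ∫ ω, φ (y + X ω) * ρ ω ∂ν) y i = ∫ ω, pd1 φ (y + X ω) i * ρ ω ∂ν := by
  have hb : 0 ≤ b := (abs_nonneg _).trans (h0 0)
  have meas : ∀ (ψ : (Fin d → ℝ) → ℝ), Continuous ψ → ∀ y, AEStronglyMeasurable
      (fun ω => ψ (y + X ω) * ρ ω) ν := fun ψ hψ y =>
    ((hψ.measurable.comp (measurable_const.add hX)).aestronglyMeasurable).mul hρ.1
  have intg : ∀ (ψ : (Fin d → ℝ) → ℝ), Continuous ψ → (∀ z, |ψ z| ≤ b) → ∀ y, Integrable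
      (fun ω => ψ (y + X ω) * ρ ω) ν := fun ψ hψ hψb y => by
    refine (hρ.norm.const_mul b).mono' (meas ψ hψ y) (Filter.Eventually.of_forall fun ω => ?_)
    rw [norm_mul]
    exact mul_le_mul_of_nonneg_right (hψb _) (norm_nonneg _)
  have key : ∀ y, HasFDerivAt (fun y => ∫ ω, φ (y + X ω) * ρ ω ∂ν)
      (∑ i, (∫ ω, pd1 φ (y + X ω) i * ρ ω ∂ν) •
        (ContinuousLinearMap.proj i : (Fin d → ℝ) →L[ℝ] ℝ)) y := by
    intro y
    have hi : ∀ i, Integrable (fun ω => (pd1 φ (y + X ω) i * ρ ω) •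
        (ContinuousLinearMap.proj i : (Fin d → ℝ) →L[ℝ] ℝ)) ν := fun i =>
      (intg _ (C1_pd1_cont hφ i) (fun z => h1 z i) y).smul_const _
    have := hasFDerivAt_integral_of_dominated_of_fderiv_le (μ := ν) (𝕜 := ℝ)
      (F := fun y ω => φ (y + X ω) * ρ ω)
      (F' := fun y ω => ∑ i, (pd1 φ (y + X ω) i * ρ ω) •
        (ContinuousLinearMap.proj i : (Fin d → ℝ) →L[ℝ] ℝ)) (x₀ := y)
      (bound := fun ω => d * b * ‖ρ ω‖) (s := Set.univ) Filter.univ_mem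
      (Filter.Eventually.of_forall fun y => meas φ hφ.continuous y)
      (intg φ hφ.continuous h0 y)
      (Finset.aestronglyMeasurable_fun_sum _ fun i _ => (hi i).1)
      (Filter.Eventually.of_forall fun ω x _ => by
        refine ContinuousLinearMap.opNorm_le_bound _ (by positivity) fun v => ?_
        simp only [ContinuousLinearMap.coe_sum', Finset.sum_apply, smul_apply,
          ContinuousLinearMap.proj_apply, smul_eq_mul, sum_apply]
        calc ‖∑ i, pd1 φ (x + X ω) i * ρ ω * v i‖ ≤ ∑ i : Fin d, b * ‖ρ ω‖ * ‖v‖ := by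
              refine norm_sum_le_of_le _ fun i _ => ?_
              rw [norm_mul, norm_mul]
              gcongr
              · exact h1 _ _
              · exact norm_le_pi_norm v i
          _ = _ := by simp; ring)
      (hρ.norm.const_mul _)
      (Filter.Eventually.of_forall fun ω x _ => by
        have h := (hφ.differentiable (by norm_num) (x + X ω)).hasFDerivAt.comp x
          ((hasFDerivAt_id x).add_const (X ω))
        have h' := h.mul_const (ρ ω)
        refine h'.congr_fderiv ?_
        ext v
        simp [fderiv_eq_sum_pd1, Finset.mul_sum]
        exact Finset.sum_congr rfl fun i _ => by ring)
    rw [integral_finsetSum _ fun i _ => hi i] at this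
    simp_rw [integral_smul_const] at this
    exact this
  refine ⟨key, fun y => (key y).differentiableAt, fun y i => ?_⟩
  unfold pd1
  rw [(key y).fderiv]
  simp [Pi.single_apply, pd1]

lemma gU_deriv {φ : (Fin d → ℝ) → ℝ} (hφ : ContDiff ℝ 2 φ) {b : ℝ}
    (h0 : ∀ z, |φ z| ≤ b) (h1 : ∀ z i, |pd1 φ z i| ≤ b) (h2 : ∀ z i j, |pd2 φ z i j| ≤ b)
    (y : Fin d → ℝ) (s : ℝ) :
    HasDerivAt (fun s => ∫ z, φ (y + s • z) * gs z)
      (s * ∫ z, (∑ k, pd2 φ (y + s • z) k k) * gs z) s := by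
  have hb : 0 ≤ b := (abs_nonneg _).trans (h0 0)
  have hd := C2_diff hφ
  have cint : ∀ (ψ : (Fin d → ℝ) → ℝ), Continuous ψ → (∀ z, |ψ z| ≤ b) → ∀ s : ℝ, Integrable
      (fun z => ψ (y + s • z) * gs z) := fun ψ hψ hψb s =>
    gint (φ := fun z => ψ (y + s • z)) (hψ.comp (by fun_prop)) (C := b) (k := 0)
      (fun z => by simpa using hψb _)
  have key : HasDerivAt (fun s => ∫ z, φ (y + s • z) * gs z)
      (∫ z, (∑ i, z i * pd1 φ (y + s • z) i) * gs z) s := by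
    have hc : ∀ x : ℝ, Continuous fun z : Fin d → ℝ => ∑ i, z i * pd1 φ (y + x • z) i := fun x =>
      continuous_finsetSum _ fun i _ =>
        (continuous_apply i).mul ((C2_pd1_cont hφ i).comp (by fun_prop))
    have hbd : ∀ (x : ℝ) z, |∑ i, z i * pd1 φ (y + x • z) i| ≤ d * b * (1 + ‖z‖) ^ 1 := by
      intro x z
      calc ‖∑ i, z i * pd1 φ (y + x • z) i‖ ≤ ∑ i : Fin d, (1 + ‖z‖) * b := by
            refine norm_sum_le_of_le _ fun i _ => ?_
            rw [norm_mul]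
            exact mul_le_mul (abs_coord_le z i) (h1 _ _) (norm_nonneg _) (by positivity)
        _ = _ := by simp; ring
    refine (hasDerivAt_integral_of_dominated_loc_of_deriv_le (μ := volume) (𝕜 := ℝ)
      (F := fun s z => φ (y + s • z) * gs z)
      (F' := fun s z => (∑ i, z i * pd1 φ (y + s • z) i) * gs z) (x₀ := s)
      (bound := fun z => d * b * ((1 + ‖z‖) ^ 1 * gs z)) (s := Set.univ) Filter.univ_mem
      (Filter.Eventually.of_forall fun x => (cint φ hφ.continuous h0 x).1)
      (cint φ hφ.continuous h0 s) (gint (hc s) (hbd s)).1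
      (Filter.Eventually.of_forall fun z x _ => ?_)
      ((gs_poly_int 1).const_mul _)
      (Filter.Eventually.of_forall fun z x _ => ?_)).2
    · rw [norm_mul, Real.norm_of_nonneg (gs_pos z).le, ← mul_assoc]
      exact mul_le_mul_of_nonneg_right (hbd x z) (gs_pos z).le
    · have e1 : HasDerivAt (fun x : ℝ => y + x • z) z x := by
        simpa using ((hasDerivAt_id x).smul_const z).const_add y
      have := ((hd (y + x • z)).hasFDerivAt.comp_hasDerivAt x e1).mul_const (gs z)
      rw [fderiv_eq_sum_pd1] at this
      exact this
  convert key using 1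
  simp_rw [Finset.sum_mul]
  rw [integral_finsetSum _ fun k _ => cint _ (C2_pd2_cont hφ k k) (fun z => h2 z k k) s,
    integral_finsetSum, Finset.mul_sum]
  · refine Finset.sum_congr rfl fun i _ => ?_
    have hk := contDiff_scale (C2_pd1 hφ i) y s
    have := gibp hk i (C := max b (|s| * b)) (k := 0)
      (fun z => by simpa using Or.inl (h1 _ _)) (fun z => by
        rw [pd1_scale (C2_pd1_diff hφ i), abs_mul, pow_zero, mul_one]
        exact le_max_of_le_right (mul_le_mul_of_nonneg_left (h2 _ i i) (abs_nonneg _)))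
    simp_rw [pd1_scale (C2_pd1_diff hφ i), mul_assoc] at this
    rw [integral_const_mul] at this
    rw [show (fun z : Fin d → ℝ => z i * pd1 φ (y + s • z) i * gs z) = fun z =>
      pd1 φ (y + s • z) i * (z i * gs z) from by funext z; ring, ← this]
    rfl
  · intro i _
    refine gint ((continuous_apply i).mul ((C2_pd1_cont hφ i).comp
      (by fun_prop : Continuous fun z : Fin d → ℝ => y + s • z))) (C := b) (k := 1) fun z => ?_
    have := mul_le_mul (abs_coord_le z i) (h1 (y + s • z) i) (abs_nonneg _) (by positivity)
    rw [← abs_mul] at this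
    rw [pow_one, mul_comm b]; exact this

end Gauss2

section Liou

variable {d : ℕ}

/-- bounded harmonic functions have vanishing gradient -/
lemma bh {φ : (Fin d → ℝ) → ℝ} (hφ : ContDiff ℝ 2 φ) {b : ℝ}
    (h0 : ∀ z, |φ z| ≤ b) (h1 : ∀ z i, |pd1 φ z i| ≤ b) (h2 : ∀ z i j, |pd2 φ z i j| ≤ b)
    (hh : ∀ z, ∑ k, pd2 φ z k k = 0) (y : Fin d → ℝ) (i : Fin d) : pd1 φ y i = 0 := by
  have hb : 0 ≤ b := (abs_nonneg _).trans (h0 0)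
  set c0 : ℝ := ∫ z : Fin d → ℝ, gs z with hc0
  have hc0p : 0 < c0 := gI_zero_pos
  have hU : ∀ (s : ℝ) y, ∫ z, φ (y + s • z) * gs z = φ y * c0 := by
    intro s y
    have hd : ∀ t, HasDerivAt (fun s : ℝ => ∫ z, φ (y + s • z) * gs z) 0 t := by
      intro t
      have := gU_deriv hφ h0 h1 h2 y t
      simpa [hh] using this
    have := is_const_of_deriv_eq_zero (fun t => (hd t).differentiableAt) (fun t => (hd t).deriv) s 0
    simp only [zero_smul, add_zero] at this
    rw [this, integral_const_mul]
  have hg : Integrable (gs (d := d)) := by simpa using gs_poly_int (d := d) 0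
  have key : ∀ s : ℝ, |s * (c0 * pd1 φ y i)| ≤ b * gI d 1 := by
    intro s
    have e1 := (TI hg (X := fun z : Fin d → ℝ => s • z) (by fun_prop) (hφ.of_le (by norm_num))
      h0 h1).2.2 y i
    simp_rw [hU s] at e1
    rw [show (fun y => φ y * c0) = fun y => c0 * φ y from by funext y; ring,
      pd1_cmul (C2_diff hφ)] at e1
    have e2 := gibp (contDiff_scale (hφ.of_le (by norm_num) : ContDiff ℝ 1 φ) y s) i
      (C := max b (|s| * b)) (k := 0)
      (fun z => by simpa using Or.inl (h0 _)) (fun z => by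
        rw [pd1_scale (C2_diff hφ), abs_mul, pow_zero, mul_one]
        exact le_max_of_le_right (mul_le_mul_of_nonneg_left (h1 _ i) (abs_nonneg _)))
    simp_rw [pd1_scale (C2_diff hφ), mul_assoc s] at e2
    rw [integral_const_mul, ← e1] at e2
    rw [e2]
    refine gint_le (φ := fun z => φ (y + s • z) * z i) fun z => ?_
    rw [abs_mul, pow_one]
    exact mul_le_mul (h0 _) (abs_coord_le z i) (abs_nonneg _) hb
  by_contra hne
  have hp : 0 < |c0 * pd1 φ y i| := abs_pos.2 (mul_ne_zero hc0p.ne' hne)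
  have := key ((b * gI d 1 + 1) / |c0 * pd1 φ y i|)
  rw [abs_mul, abs_div, abs_abs, div_mul_cancel₀ _ hp.ne'] at this
  linarith [le_abs_self (b * gI d 1 + 1)]

open scoped MatrixOrder Matrix.Norms.L2Operator in
lemma psd_factor {A : Matrix (Fin d) (Fin d) ℝ} (hA : A.PosSemidef) :
    ∃ B : Matrix (Fin d) (Fin d) ℝ, A = B.conjTranspose * B := by
  obtain ⟨B, hB⟩ := CStarAlgebra.nonneg_iff_eq_star_mul_self.mp hA.nonneg
  exact ⟨B, hB⟩

/-- linear change of variables -/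
lemma pd1_lin {v : (Fin d → ℝ) → ℝ} (hv : Differentiable ℝ v) (S : Matrix (Fin d) (Fin d) ℝ)
    (z : Fin d → ℝ) (k : Fin d) :
    pd1 (fun z => v (S.mulVec z)) z k = ∑ i, S i k * pd1 v (S.mulVec z) i := by
  unfold pd1
  have h : HasFDerivAt (fun z : Fin d → ℝ => S.mulVec z) (Matrix.mulVecLin S).toContinuousLinearMap z :=
    (Matrix.mulVecLin S).toContinuousLinearMap.hasFDerivAt
  have := ((hv (S.mulVec z)).hasFDerivAt.comp z h).fderiv
  rw [show (fun z => v (S.mulVec z)) = v ∘ fun z => S.mulVec z from rfl, this]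
  simp only [ContinuousLinearMap.comp_apply]
  rw [fderiv_eq_sum_pd1]
  refine Finset.sum_congr rfl fun i _ => ?_
  simp [pd1]

lemma contDiff_lin {n : WithTop ℕ∞} {v : (Fin d → ℝ) → ℝ} (hv : ContDiff ℝ n v)
    (S : Matrix (Fin d) (Fin d) ℝ) : ContDiff ℝ n (fun z => v (S.mulVec z)) :=
  hv.comp (Matrix.mulVecLin S).toContinuousLinearMap.contDiff

lemma pd1_sum {ι : Type*} (s : Finset ι) {F : ι → (Fin d → ℝ) → ℝ} (hF : ∀ i, Differentiable ℝ (F i))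
    (y : Fin d → ℝ) (k : Fin d) :
    pd1 (fun z => ∑ i ∈ s, F i z) y k = ∑ i ∈ s, pd1 (F i) y k := by
  unfold pd1
  rw [fderiv_fun_sum fun i _ => hF i y]
  simp

lemma pd2_lin {v : (Fin d → ℝ) → ℝ} (hv : ContDiff ℝ 2 v) (S : Matrix (Fin d) (Fin d) ℝ)
    (z : Fin d → ℝ) (k l : Fin d) :
    pd2 (fun z => v (S.mulVec z)) z k l =
      ∑ j, S j l * ∑ i, S i k * pd2 v (S.mulVec z) i j := by
  rw [pd2_eq]
  simp_rw [pd1_lin (C2_diff hv)]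
  rw [pd1_sum]
  · refine Finset.sum_congr rfl fun j _ => ?_
    have hd := C2_pd1_diff hv j
    have hd' : Differentiable ℝ (fun z => pd1 v (S.mulVec z) j) :=
      hd.comp (Matrix.mulVecLin S).toContinuousLinearMap.differentiable
    rw [pd1_cmul hd', pd1_lin hd]
    rfl
  · intro j
    exact (differentiable_const _).mul ((C2_pd1_diff hv j).comp
      (Matrix.mulVecLin S).toContinuousLinearMap.differentiable)

lemma const_of_pd1 {φ : (Fin d → ℝ) → ℝ} (hφ : Differentiable ℝ φ) (h : ∀ y i, pd1 φ y i = 0)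
    (y y' : Fin d → ℝ) : φ y = φ y' := by
  have := mvt_pd1 hφ convex_univ (le_refl (0:ℝ)) (fun z _ i => by rw [h]; simp)
    (Set.mem_univ y) (Set.mem_univ y')
  simp only [mul_zero, zero_mul] at this
  exact sub_eq_zero.1 (abs_nonpos_iff.1 this)

lemma bhA {A : Matrix (Fin d) (Fin d) ℝ} (hA : A.PosDef)
    {φ : (Fin d → ℝ) → ℝ} (hφ : ContDiff ℝ 2 φ) {b : ℝ}
    (h0 : ∀ z, |φ z| ≤ b) (h1 : ∀ z i, |pd1 φ z i| ≤ b) (h2 : ∀ z i j, |pd2 φ z i j| ≤ b)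
    (hh : ∀ z, ∑ i, ∑ j, A i j * pd2 φ z i j = 0) (y : Fin d → ℝ) (i : Fin d) : pd1 φ y i = 0 := by
  have hb : 0 ≤ b := (abs_nonneg _).trans (h0 0)
  obtain ⟨B, hB⟩ := psd_factor hA.posSemidef
  have hBA : ∀ i j, A i j = ∑ k, B k i * B k j := by
    intro i j; rw [hB]; simp [Matrix.mul_apply]
  set S : Matrix (Fin d) (Fin d) ℝ := B.transpose with hS
  have hdet : IsUnit S := by
    rw [Matrix.isUnit_iff_isUnit_det]
    have h1 := hA.det_pos.ne'
    rw [hB, Matrix.det_mul] at h1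
    rw [hS, Matrix.det_transpose]
    exact (right_ne_zero_of_mul h1).isUnit
  have hsurj : Function.Surjective S.mulVec := Matrix.mulVec_surjective_iff_isUnit.2 hdet
  set m : ℝ := ∑ i, ∑ k, |S i k| with hm
  have hmk : ∀ k, ∑ i, |S i k| ≤ m := by
    intro k
    refine Finset.sum_le_sum fun i _ => ?_
    exact Finset.single_le_sum (f := fun k => |S i k|) (fun _ _ => abs_nonneg _) (Finset.mem_univ k)
  have hm0 : 0 ≤ m := Finset.sum_nonneg fun _ _ => Finset.sum_nonneg fun _ _ => abs_nonneg _
  have hl : ∀ (k : Fin d) (G : Fin d → ℝ) (c : ℝ), (∀ i, |G i| ≤ c) → |∑ i, S i k * G i| ≤ m * c := by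
    intro k G c hG
    have hc : 0 ≤ c := (abs_nonneg _).trans (hG k)
    calc |∑ i, S i k * G i| ≤ ∑ i, |S i k * G i| := Finset.abs_sum_le_sum_abs _ _
      _ ≤ ∑ i, |S i k| * c := Finset.sum_le_sum fun i _ => by
          rw [abs_mul]; exact mul_le_mul_of_nonneg_left (hG i) (abs_nonneg _)
      _ = (∑ i, |S i k|) * c := by rw [Finset.sum_mul]
      _ ≤ m * c := mul_le_mul_of_nonneg_right (hmk k) hc
  have hψ := contDiff_lin hφ S
  have hz := bh hψ (b := max b (max (m * b) (m * (m * b))))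
    (fun z => le_max_of_le_left (h0 _))
    (fun z k => le_max_of_le_right (le_max_of_le_left (by
      rw [pd1_lin (C2_diff hφ)]; exact hl k _ b fun i => h1 _ i)))
    (fun z k l => le_max_of_le_right (le_max_of_le_right (by
      rw [pd2_lin hφ]
      exact hl l _ (m * b) fun j => hl k _ b fun i => h2 _ i j)))
    (fun z => by
      simp_rw [pd2_lin hφ]
      rw [← hh (S.mulVec z)]
      simp_rw [hBA, Finset.mul_sum, Finset.sum_mul]
      calc _ = ∑ j, ∑ k, ∑ i, S j k * (S i k * pd2 φ (S.mulVec z) i j) := Finset.sum_comm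
        _ = ∑ j, ∑ i, ∑ k, S j k * (S i k * pd2 φ (S.mulVec z) i j) :=
          Finset.sum_congr rfl fun j _ => Finset.sum_comm
        _ = ∑ i, ∑ j, ∑ k, S j k * (S i k * pd2 φ (S.mulVec z) i j) := Finset.sum_comm
        _ = _ := by
          refine Finset.sum_congr rfl fun i _ => Finset.sum_congr rfl fun j _ =>
            Finset.sum_congr rfl fun k _ => ?_
          simp only [hS, Matrix.transpose_apply]; ring)
  have hc : ∀ x x', φ x = φ x' := by
    intro x x'
    obtain ⟨z, rfl⟩ := hsurj x
    obtain ⟨z', rfl⟩ := hsurj x'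
    exact const_of_pd1 (C2_diff hψ) hz z z'
  rw [show φ = fun _ => φ 0 from funext fun x => hc x 0]
  exact pd1_const _ _ _

/-- difference operator -/
def Dl (h : Fin d → ℝ) (F : (Fin d → ℝ) → ℝ) : (Fin d → ℝ) → ℝ := fun x => F (x + h) - F x

lemma contDiff_Dl {n : WithTop ℕ∞} {h : Fin d → ℝ} {F : (Fin d → ℝ) → ℝ} (hF : ContDiff ℝ n F) :
    ContDiff ℝ n (Dl h F) := (hF.comp (contDiff_id.add contDiff_const)).sub hF

lemma diff_Dl {h : Fin d → ℝ} {F : (Fin d → ℝ) → ℝ} (hF : Differentiable ℝ F) :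
    Differentiable ℝ (Dl h F) := (hF.comp (differentiable_id.add (differentiable_const _))).sub hF

lemma pd1_Dl {h : Fin d → ℝ} {F : (Fin d → ℝ) → ℝ} (hF : Differentiable ℝ F) (j : Fin d) :
    (fun x => pd1 (Dl h F) x j) = Dl h (fun x => pd1 F x j) := by
  funext x
  have hF' : Differentiable ℝ (fun x => F (x + h)) := by fun_prop
  unfold Dl
  rw [pd1_sub hF' hF]
  unfold pd1
  rw [fderiv_comp_add_right]

lemma pd2_Dl {h : Fin d → ℝ} {F : (Fin d → ℝ) → ℝ} (hF : ContDiff ℝ 2 F) (i j : Fin d) :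
    (fun x => pd2 (Dl h F) x i j) = Dl h (fun x => pd2 F x i j) := by
  have h1 := pd1_Dl (h := h) (C2_diff hF) j
  have h2 := pd1_Dl (h := h) (C2_pd1_diff hF j) i
  rw [← h1] at h2
  exact h2

lemma Dl_mvt {h : Fin d → ℝ} {F : (Fin d → ℝ) → ℝ} (hF : Differentiable ℝ F) {S : ℝ} (hS : 0 ≤ S)
    (hb : ∀ z i, |pd1 F z i| ≤ S) (x : Fin d → ℝ) : |Dl h F x| ≤ d * S * ‖h‖ := by
  have := mvt_pd1 hF convex_univ hS (fun z _ i => hb z i) (Set.mem_univ (x + h)) (Set.mem_univ x)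
  simpa [Dl] using this

lemma Dl_two {h : Fin d → ℝ} {F : (Fin d → ℝ) → ℝ} {S : ℝ}
    (hb : ∀ z, |F z| ≤ S) (x : Fin d → ℝ) : |Dl h F x| ≤ 2 * S := by
  have := abs_sub (F (x + h)) (F x)
  unfold Dl
  linarith [hb (x + h), hb x]

lemma seq_const {p : ℕ → ℝ} {K α : ℝ} (hα1 : α < 1)
    (h3 : ∀ n, p (n + 3) - 3 * p (n + 2) + 3 * p (n + 1) - p n = 0)
    (hb : ∀ n, |p (n + 1) - p n| ≤ K) (hg : ∀ n : ℕ, |p n - p 0| ≤ K * (n : ℝ) ^ α) : p 1 = p 0 := by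
  have hK : 0 ≤ K := (abs_nonneg _).trans (hb 0)
  have h2 : ∀ n, p (n + 2) - 2 * p (n + 1) + p n = p 2 - 2 * p 1 + p 0 := by
    intro n
    induction n with
    | zero => rfl
    | succ n ih => rw [← ih]; have := h3 n; ring_nf at this ⊢; linarith
  set q := p 2 - 2 * p 1 + p 0 with hq
  have h1 : ∀ n : ℕ, p (n + 1) - p n = p 1 - p 0 + n * q := by
    intro n
    induction n with
    | zero => simp
    | succ n ih => push_cast; have := h2 n; ring_nf at this ih ⊢; linarith
  have hq0 : q = 0 := by
    by_contra hne
    have hp : 0 < |q| := abs_pos.2 hne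
    obtain ⟨n, hn⟩ := exists_nat_gt (2 * K / |q|)
    rw [div_lt_iff₀ hp] at hn
    have e : (n : ℝ) * q = (p (n + 1) - p n) - (p (0 + 1) - p 0) := by rw [h1 n]; simp
    have : |(n : ℝ) * q| ≤ K + K := by
      rw [e]; exact (abs_sub _ _).trans (add_le_add (hb n) (hb 0))
    rw [abs_mul, Nat.abs_cast] at this
    linarith
  have h0 : ∀ n : ℕ, p n - p 0 = n * (p 1 - p 0) := by
    intro n
    induction n with
    | zero => simp
    | succ n ih => have := h1 n; rw [hq0] at this; push_cast; linarith
  by_contra hne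
  have hp : 0 < |p 1 - p 0| := abs_pos.2 (sub_ne_zero.2 hne)
  have ht : Filter.Tendsto (fun n : ℕ => K * (n : ℝ) ^ (α - 1)) Filter.atTop (nhds (K * 0)) := by
    have := (tendsto_rpow_neg_atTop (y := 1 - α) (by linarith)).comp tendsto_natCast_atTop_atTop
    rw [show -(1 - α) = α - 1 by ring] at this
    exact this.const_mul K
  rw [mul_zero] at ht
  obtain ⟨n, hn, hn1⟩ := ((ht.eventually_lt_const hp).and (Filter.eventually_ge_atTop 1)).exists
  have hnp : (0:ℝ) < n := by exact_mod_cast hn1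
  have := hg n
  rw [h0, abs_mul, Nat.abs_cast] at this
  rw [Real.rpow_sub_one hnp.ne', ← mul_div_assoc, div_lt_iff₀ hnp] at hn
  linarith

/-- Liouville theorem for constant coefficient equations with Hölder second derivatives -/
lemma liouvilleA {A : Matrix (Fin d) (Fin d) ℝ} (hA : A.PosDef) {α : ℝ} (hα0 : 0 ≤ α) (hα1 : α < 1)
    {v : (Fin d → ℝ) → ℝ} (hv : ContDiff ℝ 2 v) {K : ℝ}
    (hH : ∀ x x' i j, |pd2 v x i j - pd2 v x' i j| ≤ K * ‖x - x'‖ ^ α)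
    (hh : ∀ z, ∑ i, ∑ j, A i j * pd2 v z i j = 0) (x : Fin d → ℝ) (i j : Fin d) :
    pd2 v x i j = pd2 v 0 i j := by
  have third : ∀ h : Fin d → ℝ, ∀ x, Dl h (Dl h (Dl h fun x => pd2 v x i j)) x = 0 := by
    intro h x
    set S0 := K * ‖h‖ ^ α with hS0
    have hA0 : ∀ z i j, |Dl h (fun x => pd2 v x i j) z| ≤ S0 := by
      intro z i j
      have := hH (z + h) z i j
      simpa [Dl] using this
    have hS : 0 ≤ S0 := (abs_nonneg _).trans (hA0 0 i i)
    have c1 := contDiff_Dl (h := h) hv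
    have c2 := contDiff_Dl (h := h) c1
    have c3 := contDiff_Dl (h := h) c2
    have p2 : ∀ i j, (fun x => pd2 (Dl h (Dl h (Dl h v))) x i j) =
        Dl h (Dl h (Dl h fun x => pd2 v x i j)) := by
      intro i j; rw [pd2_Dl c2, pd2_Dl c1, pd2_Dl hv]
    have p1 : ∀ j, (fun x => pd1 (Dl h (Dl h (Dl h v))) x j) =
        Dl h (Dl h (Dl h fun x => pd1 v x j)) := by
      intro j; rw [pd1_Dl (C2_diff c2), pd1_Dl (C2_diff c1), pd1_Dl (C2_diff hv)]
    have hB : ∀ z j, |Dl h (Dl h fun x => pd1 v x j) z| ≤ d * S0 * ‖h‖ := by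
      intro z j
      refine Dl_mvt (diff_Dl (C2_pd1_diff hv j)) hS (fun z i => ?_) z
      have := congrFun (pd1_Dl (h := h) (C2_pd1_diff hv j) i) z
      rw [this]; exact hA0 z i j
    have hC : ∀ z, |Dl h (Dl h (Dl h v)) z| ≤ d * (d * S0 * ‖h‖) * ‖h‖ := by
      intro z
      refine Dl_mvt (C2_diff c2) (by positivity) (fun z j => ?_) z
      have : (fun x => pd1 (Dl h (Dl h v)) x j) = Dl h (Dl h fun x => pd1 v x j) := by
        rw [pd1_Dl (C2_diff c1), pd1_Dl (C2_diff hv)]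
      have := congrFun this z
      rw [this]; exact hB z j
    have hz : ∀ y j, pd1 (Dl h (Dl h (Dl h v))) y j = 0 := by
      intro y j
      refine bhA hA c3 (b := max (d * (d * S0 * ‖h‖) * ‖h‖) (max (2 * (d * S0 * ‖h‖)) (2 * (2 * S0))))
        (fun z => le_max_of_le_left (hC z)) (fun z j => le_max_of_le_right (le_max_of_le_left ?_))
        (fun z i j => le_max_of_le_right (le_max_of_le_right ?_)) (fun z => ?_) y j
      · have := congrFun (p1 j) z
        rw [this]; exact Dl_two (fun z => hB z j) z
      · have := congrFun (p2 i j) z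
        rw [this]; exact Dl_two (fun z => Dl_two (fun z => hA0 z i j) z) z
      · have : ∀ i j, pd2 (Dl h (Dl h (Dl h v))) z i j = _ := fun i j => congrFun (p2 i j) z
        simp_rw [this]
        simp only [Dl, mul_sub, Finset.sum_sub_distrib, hh]
        simp
    have := congrFun (p2 i j) x
    rw [← this, pd2_eq, show (fun z => pd1 (Dl h (Dl h (Dl h v))) z j) = fun _ => 0 from
      funext fun z => hz z j, pd1_const]
  have := seq_const (p := fun n : ℕ => pd2 v ((n : ℝ) • x) i j) (K := K * ‖x‖ ^ α) hα1
    (fun n => by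
      have := third x ((n : ℝ) • x)
      simp only [Dl] at this
      have e1 : ((n : ℝ) • x + x) = ((n + 1 : ℕ) : ℝ) • x := by push_cast; module
      have e2 : ((n : ℝ) • x + x + x) = ((n + 2 : ℕ) : ℝ) • x := by push_cast; module
      have e3 : ((n : ℝ) • x + x + x + x) = ((n + 3 : ℕ) : ℝ) • x := by push_cast; module
      rw [e3, e2, e1] at this
      linarith)
    (fun n => by
      have := hH (((n + 1 : ℕ) : ℝ) • x) ((n : ℝ) • x) i j
      rwa [show ((n + 1 : ℕ) : ℝ) • x - (n : ℝ) • x = x by push_cast; module] at this)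
    (fun n => by
      have := hH ((n : ℝ) • x) (((0 : ℕ) : ℝ) • x) i j
      rw [show (n : ℝ) • x - ((0 : ℕ) : ℝ) • x = (n : ℝ) • x by simp, norm_smul, Real.norm_natCast,
        Real.mul_rpow (by positivity) (norm_nonneg _)] at this
      calc _ ≤ _ := this
        _ = _ := by ring)
  simpa using this

end Liou

section Comp

variable {d : ℕ}

lemma line_mvt {F : (Fin d → ℝ) → ℝ} (hF : Differentiable ℝ F) (p : Fin d → ℝ) (i : Fin d) {η : ℝ}
    (hη : 0 < η) : ∃ ξ, 0 < ξ ∧ ξ < η ∧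
      F (p + η • Pi.single i 1) - F p = η * pd1 F (p + ξ • Pi.single i 1) i := by
  have hd : ∀ t : ℝ, HasDerivAt (fun t : ℝ => F (p + t • Pi.single i 1))
      (pd1 F (p + t • Pi.single i 1) i) t := by
    intro t
    have e1 : HasDerivAt (fun x : ℝ => p + x • (Pi.single i 1 : Fin d → ℝ)) (Pi.single i 1) t := by
      simpa using ((hasDerivAt_id t).smul_const (Pi.single i (1:ℝ) : Fin d → ℝ)).const_add p
    exact (hF _).hasFDerivAt.comp_hasDerivAt t e1
  obtain ⟨ξ, hξ, h⟩ := exists_hasDerivAt_eq_slope (fun t : ℝ => F (p + t • Pi.single i 1))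
    (fun t => pd1 F (p + t • Pi.single i 1) i) hη
    (fun t _ => (hd t).continuousAt.continuousWithinAt) (fun t _ => hd t)
  refine ⟨ξ, hξ.1, hξ.2, ?_⟩
  rw [h]
  simp
  field_simp

lemma norm_smul_single_le {t : ℝ} (ht : 0 ≤ t) (i : Fin d) :
    ‖t • (Pi.single i 1 : Fin d → ℝ)‖ ≤ t := by
  rw [norm_smul, Real.norm_of_nonneg ht]
  exact mul_le_of_le_one_right ht (norm_single_one_le i)

lemma interp {u : (Fin d → ℝ) → ℝ} (hu : ContDiff ℝ 2 u) {p : Fin d → ℝ} {η ω M : ℝ} (hη : 0 < η)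
    (hM : ∀ z, ‖z - p‖ ≤ 2 * η → |u z| ≤ M)
    (hω : ∀ z, ‖z - p‖ ≤ 2 * η → ∀ i j, |pd2 u z i j - pd2 u p i j| ≤ ω) (i j : Fin d) :
    |pd2 u p i j| ≤ ω + 4 * M / η ^ 2 ∧ |pd1 u p i| ≤ 6 * M / η + 2 * η * ω := by
  have main : ∀ i j, |pd2 u p i j| ≤ ω + 4 * M / η ^ 2 := by
    intro i j
    set h : Fin d → ℝ := η • Pi.single j 1 with hh
    have hhn : ‖h‖ ≤ η := norm_smul_single_le hη.le j
    obtain ⟨ξ, hξ0, hξ1, e1⟩ := line_mvt (diff_Dl (h := h) (C2_diff hu)) p i hη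
    have e2 := congrFun (pd1_Dl (h := h) (C2_diff hu) i) (p + ξ • Pi.single i 1)
    rw [e2] at e1
    obtain ⟨ξ', hξ0', hξ1', e3⟩ := line_mvt (C2_pd1_diff hu i) (p + ξ • Pi.single i 1) j hη
    have e4 : Dl h (fun x => pd1 u x i) (p + ξ • Pi.single i 1) =
      η * pd2 u (p + ξ • Pi.single i 1 + ξ' • Pi.single j 1) j i := e3
    set q := p + ξ • Pi.single i 1 + ξ' • Pi.single j 1 with hq
    have n1 : ‖ξ • (Pi.single i 1 : Fin d → ℝ)‖ ≤ ξ := norm_smul_single_le hξ0.le i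
    have n2 : ‖ξ' • (Pi.single j 1 : Fin d → ℝ)‖ ≤ ξ' := norm_smul_single_le hξ0'.le j
    have n3 : ‖η • (Pi.single i 1 : Fin d → ℝ)‖ ≤ η := norm_smul_single_le hη.le i
    have hqp : ‖q - p‖ ≤ 2 * η := by
      have : q - p = ξ • Pi.single i 1 + ξ' • Pi.single j 1 := by rw [hq]; abel
      rw [this]
      exact (norm_add_le _ _).trans (by linarith)
    have b1 : |u (p + η • Pi.single i 1 + h)| ≤ M := hM _ (by
      rw [show p + η • Pi.single i 1 + h - p = η • Pi.single i 1 + h by abel]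
      exact (norm_add_le _ _).trans (by linarith))
    have b2 : |u (p + η • Pi.single i 1)| ≤ M := hM _ (by
      rw [show p + η • Pi.single i 1 - p = η • Pi.single i 1 by abel]; linarith)
    have b3 : |u (p + h)| ≤ M := hM _ (by
      rw [show p + h - p = h by abel]; linarith)
    have b4 : |u p| ≤ M := hM _ (by simp; positivity)
    have e5 : η ^ 2 * pd2 u q j i = (u (p + η • Pi.single i 1 + h) - u (p + η • Pi.single i 1)) -
        (u (p + h) - u p) := by
      have : Dl h u (p + η • Pi.single i 1) - Dl h u p = η * (η * pd2 u q j i) := by rw [e1, e4]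
      simp only [Dl] at this
      rw [this]; ring
    have e6 : η ^ 2 * |pd2 u q j i| ≤ 4 * M := by
      rw [← abs_of_pos (by positivity : 0 < η ^ 2), ← abs_mul, e5]
      rw [abs_le] at *
      constructor <;> linarith
    have e7 : |pd2 u q j i| ≤ 4 * M / η ^ 2 := by
      rw [le_div_iff₀ (by positivity)]; linarith
    have e8 := hω q hqp i j
    rw [pd2_symm hu q] at e8
    have := abs_sub_abs_le_abs_sub (pd2 u p i j) (pd2 u q j i)
    rw [abs_sub_comm] at this
    linarith
  refine ⟨main i j, ?_⟩
  obtain ⟨ξ, hξ0, hξ1, e1⟩ := line_mvt (C2_diff hu) p i hη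
  obtain ⟨ξ', hξ0', hξ1', e2⟩ := line_mvt (C2_pd1_diff hu i) p i hξ0
  have n2 : ‖ξ' • (Pi.single i 1 : Fin d → ℝ)‖ ≤ ξ' := norm_smul_single_le hξ0'.le i
  have n3 : ‖η • (Pi.single i 1 : Fin d → ℝ)‖ ≤ η := norm_smul_single_le hη.le i
  have b2 : |u (p + η • Pi.single i 1)| ≤ M := hM _ (by
    rw [show p + η • Pi.single i 1 - p = η • Pi.single i 1 by abel]; linarith)
  have b4 : |u p| ≤ M := hM _ (by simp; positivity)
  have e3 : |pd1 u (p + ξ • Pi.single i 1) i| ≤ 2 * M / η := by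
    rw [le_div_iff₀ hη, mul_comm, ← abs_of_pos hη, ← abs_mul, ← e1]
    rw [abs_le] at *
    constructor <;> linarith
  have e4 := hω (p + ξ' • Pi.single i 1) (by
    rw [show p + ξ' • Pi.single i 1 - p = ξ' • Pi.single i 1 by abel]; linarith) i i
  have e5 : |pd2 u (p + ξ' • Pi.single i 1) i i| ≤ 2 * ω + 4 * M / η ^ 2 := by
    have := abs_sub_abs_le_abs_sub (pd2 u (p + ξ' • Pi.single i 1) i i) (pd2 u p i i)
    linarith [main i i]
  have e6 : |pd1 u (p + ξ • Pi.single i 1) i - pd1 u p i| ≤ η * (2 * ω + 4 * M / η ^ 2) := by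
    rw [e2, abs_mul, abs_of_pos hξ0]
    exact mul_le_mul hξ1.le e5 (abs_nonneg _) hη.le
  have := abs_sub_abs_le_abs_sub (pd1 u p i) (pd1 u (p + ξ • Pi.single i 1) i)
  rw [abs_sub_comm] at this
  have e7 : η * (2 * ω + 4 * M / η ^ 2) = 2 * η * ω + 4 * M / η := by field_simp
  have e8 : 6 * M / η = 2 * M / η + 4 * M / η := by ring
  linarith

lemma hasFDeriv_of_bound {F : (Fin d → ℝ) → ℝ} {G : Fin d → ℝ} {y : Fin d → ℝ} {C α : ℝ} (hα : 0 < α)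
    (h : ∀ y', ‖y' - y‖ ≤ 1 → |F y' - F y - ∑ i, (y' - y) i * G i| ≤ C * ‖y' - y‖ ^ α * ‖y' - y‖) :
    HasFDerivAt F (∑ i, G i • (ContinuousLinearMap.proj i : (Fin d → ℝ) →L[ℝ] ℝ)) y := by
  rw [hasFDerivAt_iff_isLittleO]
  rw [Asymptotics.isLittleO_iff]
  intro c hc
  have ht : Filter.Tendsto (fun y' : Fin d → ℝ => C * ‖y' - y‖ ^ α) (nhds y) (nhds 0) := by
    have h1 : Filter.Tendsto (fun y' : Fin d → ℝ => ‖y' - y‖) (nhds y) (nhds 0) := by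
      have : Continuous fun y' : Fin d → ℝ => ‖y' - y‖ := by fun_prop
      simpa using this.tendsto y
    have h2 := (h1.rpow_const (p := α) (Or.inr hα.le)).const_mul C
    simpa [Real.zero_rpow hα.ne'] using h2
  have hb : ∀ᶠ y' in nhds y, ‖y' - y‖ ≤ 1 := by
    filter_upwards [Metric.closedBall_mem_nhds y one_pos] with y' hy'
    simpa [dist_eq_norm] using hy'
  filter_upwards [ht.eventually_lt_const hc, hb] with y' h1 h2
  have h3 := h y' h2
  have e : (∑ i, G i • (ContinuousLinearMap.proj i : (Fin d → ℝ) →L[ℝ] ℝ)) (y' - y) =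
      ∑ i, (y' - y) i * G i := by
    simp [mul_comm]
  rw [e, Real.norm_eq_abs]
  exact h3.trans (mul_le_mul_of_nonneg_right h1.le (norm_nonneg _))

lemma ultra_lim {ι : Type*} (U : Ultrafilter ι) {x : ι → ℝ} {b : ℝ} (h : ∀ᶠ n in U, |x n| ≤ b) :
    ∃ L, Filter.Tendsto x U (nhds L) := by
  obtain ⟨L, -, hL⟩ := (isCompact_Icc (a := -b) (b := b)).ultrafilter_le_nhds (U.map x)
    (by
      rw [Filter.le_principal_iff, Ultrafilter.coe_map, Filter.mem_map]
      filter_upwards [h] with n hn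
      exact abs_le.1 hn)
  exact ⟨L, hL⟩

/-- local `C^{2,α}` bounds -/
def LB (α R b : ℝ) (u : (Fin d → ℝ) → ℝ) : Prop :=
  ∀ x, ‖x‖ ≤ R → |u x| ≤ b ∧ (∀ i, |pd1 u x i| ≤ b) ∧ (∀ i j, |pd2 u x i j| ≤ b) ∧
    ∀ x', ‖x'‖ ≤ R → ∀ i j, |pd2 u x i j - pd2 u x' i j| ≤ b * ‖x - x'‖ ^ α

/-- compactness -/
lemma compC {ι : Type*} (U : Ultrafilter ι) {α : ℝ} (hα : 0 < α) {u : ι → (Fin d → ℝ) → ℝ}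
    (hu : ∀ n, ContDiff ℝ 2 (u n)) (hb : ∀ R, ∃ b, ∀ᶠ n in U, LB α R b (u n)) :
    ∃ w : (Fin d → ℝ) → ℝ, ContDiff ℝ 2 w ∧
      (∀ x, Filter.Tendsto (fun n => u n x) U (nhds (w x))) ∧
      (∀ x i, Filter.Tendsto (fun n => pd1 (u n) x i) U (nhds (pd1 w x i))) ∧
      (∀ x i j, Filter.Tendsto (fun n => pd2 (u n) x i j) U (nhds (pd2 w x i j))) ∧
      (∀ R b, (∀ᶠ n in U, LB α R b (u n)) → LB α R b w) := by
  have l0 : ∀ x, ∃ L, Filter.Tendsto (fun n => u n x) U (nhds L) := fun x => by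
    obtain ⟨b, h⟩ := hb ‖x‖
    exact ultra_lim U (b := b) (h.mono fun n hn => (hn x le_rfl).1)
  have l1 : ∀ i x, ∃ L, Filter.Tendsto (fun n => pd1 (u n) x i) U (nhds L) := fun i x => by
    obtain ⟨b, h⟩ := hb ‖x‖
    exact ultra_lim U (b := b) (h.mono fun n hn => (hn x le_rfl).2.1 i)
  have l2 : ∀ i j x, ∃ L, Filter.Tendsto (fun n => pd2 (u n) x i j) U (nhds L) := fun i j x => by
    obtain ⟨b, h⟩ := hb ‖x‖
    exact ultra_lim U (b := b) (h.mono fun n hn => (hn x le_rfl).2.2.1 i j)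
  choose w0 hw0 using l0
  choose w1 hw1 using l1
  choose w2 hw2 using l2
  have hb1 : ∀ y : Fin d → ℝ, ∃ b, 0 ≤ b ∧ ∀ᶠ n in U, LB α (‖y‖ + 1) b (u n) := by
    intro y
    obtain ⟨b, h⟩ := hb (‖y‖ + 1)
    refine ⟨b, ?_, h⟩
    obtain ⟨n, hn⟩ := h.exists
    exact (abs_nonneg _).trans (hn y (by linarith)).1
  have inball : ∀ y y' : Fin d → ℝ, ‖y' - y‖ ≤ 1 → ∀ z ∈ Metric.closedBall y ‖y' - y‖,
      ‖z‖ ≤ ‖y‖ + 1 ∧ ‖z - y‖ ≤ ‖y' - y‖ := by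
    intro y y' hy z hz
    rw [Metric.mem_closedBall, dist_eq_norm] at hz
    refine ⟨?_, hz⟩
    have := norm_le_norm_add_norm_sub' z y
    linarith
  have d1 : ∀ y, HasFDerivAt w0
      (∑ i, w1 i y • (ContinuousLinearMap.proj i : (Fin d → ℝ) →L[ℝ] ℝ)) y := by
    intro y
    obtain ⟨b, hb0, h⟩ := hb1 y
    refine hasFDeriv_of_bound (C := d * (d * b)) one_pos fun y' hy' => ?_
    refine le_of_tendsto (x := (U : Filter ι)) (f := fun n => |u n y' - u n y - ∑ i, (y' - y) i * pd1 (u n) y i|) ?_ ?_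
    · exact (((hw0 y').sub (hw0 y)).sub
        (tendsto_finsetSum _ fun i _ => (hw1 i y).const_mul _)).abs
    · filter_upwards [h] with n hn
      have := taylor_pd1 (C2_diff (hu n)) (convex_closedBall y ‖y' - y‖) (S := d * b * ‖y' - y‖)
        (by positivity) (y := y) (y' := y') (fun z hz i => ?_) (by simp) (by simp [dist_eq_norm])
      · rw [Real.rpow_one]
        calc _ ≤ _ := this
          _ = _ := by ring
      · have hz' := inball y y' hy' z hz
        have := mvt_pd1 (C2_pd1_diff (hu n) i) (convex_closedBall y ‖y' - y‖) hb0
          (fun x hx k => (hn x (inball y y' hy' x hx).1).2.2.1 k i) hz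
          (Metric.mem_closedBall_self (norm_nonneg _))
        refine this.trans ?_
        gcongr
        exact hz'.2
  have d2 : ∀ j y, HasFDerivAt (w1 j)
      (∑ i, w2 i j y • (ContinuousLinearMap.proj i : (Fin d → ℝ) →L[ℝ] ℝ)) y := by
    intro j y
    obtain ⟨b, hb0, h⟩ := hb1 y
    refine hasFDeriv_of_bound (C := d * b) hα fun y' hy' => ?_
    refine le_of_tendsto (x := (U : Filter ι)) (f := fun n => |pd1 (u n) y' j - pd1 (u n) y j - ∑ i, (y' - y) i * pd2 (u n) y i j|) ?_ ?_
    · exact (((hw1 j y').sub (hw1 j y)).sub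
        (tendsto_finsetSum _ fun i _ => (hw2 i j y).const_mul _)).abs
    · filter_upwards [h] with n hn
      have := taylor_pd1 (C2_pd1_diff (hu n) j) (convex_closedBall y ‖y' - y‖) (S := b * ‖y' - y‖ ^ α)
        (by positivity) (y := y) (y' := y') (fun z hz i => ?_) (by simp) (by simp [dist_eq_norm])
      · calc _ ≤ _ := this
          _ = _ := by ring
      · have hz' := inball y y' hy' z hz
        have := (hn z hz'.1).2.2.2 y (by linarith) i j
        refine this.trans ?_
        gcongr
        exact hz'.2
  have hlim : ∀ i j R b, (∀ᶠ n in U, LB α R b (u n)) → ∀ x x', ‖x‖ ≤ R → ‖x'‖ ≤ R →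
      |w2 i j x - w2 i j x'| ≤ b * ‖x - x'‖ ^ α := by
    intro i j R b h x x' hx hx'
    refine le_of_tendsto (((hw2 i j x).sub (hw2 i j x')).abs) ?_
    filter_upwards [h] with n hn
    exact (hn x hx).2.2.2 x' hx' i j
  have cw : ∀ i j, Continuous (w2 i j) := by
    intro i j
    rw [continuous_iff_continuousAt]
    intro y
    obtain ⟨b, hb0, h⟩ := hb1 y
    have ht : Filter.Tendsto (fun y' : Fin d → ℝ => b * ‖y' - y‖ ^ α) (nhds y) (nhds 0) := by
      have h1 : Filter.Tendsto (fun y' : Fin d → ℝ => ‖y' - y‖) (nhds y) (nhds 0) := by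
        have : Continuous fun y' : Fin d → ℝ => ‖y' - y‖ := by fun_prop
        simpa using this.tendsto y
      have h2 := (h1.rpow_const (p := α) (Or.inr hα.le)).const_mul b
      simpa [Real.zero_rpow hα.ne'] using h2
    rw [ContinuousAt, tendsto_iff_norm_sub_tendsto_zero]
    refine squeeze_zero' (Filter.Eventually.of_forall fun _ => norm_nonneg _) ?_ ht
    filter_upwards [Metric.closedBall_mem_nhds y one_pos] with y' hy'
    rw [Metric.mem_closedBall, dist_eq_norm] at hy'
    have := norm_le_norm_add_norm_sub' y' y
    exact hlim i j _ b h y' y (by linarith) (by linarith)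
  obtain ⟨c, e1, e2⟩ := contDiff_two_of_partials d1 d2 cw
  refine ⟨w0, c, hw0, fun x i => by rw [e1]; exact hw1 i x,
    fun x i j => by rw [e2]; exact hw2 i j x, fun R b h x hx => ⟨?_, fun i => ?_, fun i j => ?_,
      fun x' hx' i j => ?_⟩⟩
  · exact le_of_tendsto (hw0 x).abs (h.mono fun n hn => (hn x hx).1)
  · rw [e1]; exact le_of_tendsto (hw1 i x).abs (h.mono fun n hn => (hn x hx).2.1 i)
  · rw [e2]; exact le_of_tendsto (hw2 i j x).abs (h.mono fun n hn => (hn x hx).2.2.1 i j)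
  · rw [e2, e2]; exact hlim i j R b h x x' hx hx'

end Comp

section Blow

variable {d : ℕ}

lemma pd1_proj (z : Fin d → ℝ) (i l : Fin d) :
    pd1 (fun z : Fin d → ℝ => z i) z l = if i = l then 1 else 0 := pd1_coord z i l

/-- quadratic polynomials -/
def quad (c : ℝ) (b : Fin d → ℝ) (q : Fin d → Fin d → ℝ) (x : Fin d → ℝ) : ℝ :=
  c + ∑ i, b i * x i + ∑ i, ∑ j, q i j * (x i * x j)

lemma quad_contDiff {n : WithTop ℕ∞} (c : ℝ) (b : Fin d → ℝ) (q : Fin d → Fin d → ℝ) :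
    ContDiff ℝ n (quad c b q) := by
  unfold quad; fun_prop

lemma pd1_quad (c : ℝ) (b : Fin d → ℝ) (q : Fin d → Fin d → ℝ) (x : Fin d → ℝ) (k : Fin d) :
    pd1 (quad c b q) x k = b k + ∑ j, (q k j + q j k) * x j := by
  have e : quad c b q = fun x => (c + ∑ i, b i * x i) + ∑ i, ∑ j, q i j * (x i * x j) := rfl
  have hp : ∀ i : Fin d, Differentiable ℝ (fun x : Fin d → ℝ => x i) := fun i => by fun_prop
  rw [e, pd1_add (by fun_prop) (by fun_prop),
    pd1_add (u := fun _ => c) (by fun_prop) (by fun_prop), pd1_const,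
    pd1_sum _ (fun i => by fun_prop), pd1_sum _ (fun i => by fun_prop)]
  have e3 : ∀ i, pd1 (fun x : Fin d → ℝ => ∑ j, q i j * (x i * x j)) x k =
      ∑ j, pd1 (fun x => q i j * (x i * x j)) x k := fun i => pd1_sum _ (fun j => by fun_prop) x k
  simp_rw [e3]
  have e1 : ∀ i, pd1 (fun x : Fin d → ℝ => b i * x i) x k = if i = k then b i else 0 := by
    intro i; rw [pd1_cmul (hp i), pd1_coord]; simp
  have e2 : ∀ i j, pd1 (fun x : Fin d → ℝ => q i j * (x i * x j)) x k =
      (if j = k then q i j * x i else 0) + (if i = k then q i j * x j else 0) := by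
    intro i j
    rw [pd1_cmul (u := fun x : Fin d → ℝ => x i * x j) (by fun_prop), pd1_mul (hp i) (hp j), pd1_coord, pd1_coord]
    split_ifs <;> ring
  simp_rw [e1, e2, Finset.sum_add_distrib]
  simp only [Finset.sum_ite_eq', Finset.mem_univ, if_true, zero_add]
  rw [Finset.sum_comm (f := fun i j => if i = k then q i j * x j else 0)]
  simp only [Finset.sum_ite_eq', Finset.mem_univ, if_true, add_mul, Finset.sum_add_distrib]
  ring

lemma pd2_quad (c : ℝ) (b : Fin d → ℝ) (q : Fin d → Fin d → ℝ) (x : Fin d → ℝ) (k l : Fin d) :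
    pd2 (quad c b q) x k l = q l k + q k l := by
  rw [pd2_eq]
  simp_rw [pd1_quad]
  have := pd1_quad (b l) (fun j => q l j + q j l) (fun _ _ => 0) x k
  have e : quad (b l) (fun j => q l j + q j l) (fun _ _ => 0) =
      fun z => b l + ∑ j, (q l j + q j l) * z j := by
    funext z; simp [quad]
  rw [e] at this
  rw [this]; simp

/-- data of a local problem -/
structure Dat (d : ℕ) where
  f : (Fin d → ℝ) → Fin d → ℝ
  a : (Fin d → ℝ) → Fin d → Fin d → ℝ
  lam : ℝ
  u : (Fin d → ℝ) → ℝ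
  g : (Fin d → ℝ) → ℝ
  H : ℝ
  N : ℝ

/-- coefficient conditions on the unit ball -/
def Cf (α lm Λ : ℝ) (f : (Fin d → ℝ) → Fin d → ℝ) (a : (Fin d → ℝ) → Fin d → Fin d → ℝ) : Prop :=
  ∀ z, ‖z‖ ≤ 1 → (∀ i j, a z i j = a z j i) ∧
    (∀ ξ : Fin d → ℝ, lm * ∑ i, ξ i ^ 2 ≤ 2 * ∑ i, ∑ j, ξ i * a z i j * ξ j) ∧
    (∀ i j, |a z i j| ≤ Λ) ∧ (∀ i, |f z i| ≤ Λ) ∧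
    ∀ z', ‖z'‖ ≤ 1 → (∀ i j, |a z i j - a z' i j| ≤ Λ * ‖z - z'‖ ^ α) ∧
      (∀ i, |f z i - f z' i| ≤ Λ * ‖z - z'‖ ^ α)

/-- solution conditions on the unit ball -/
structure Dat.ok (α lm Λ : ℝ) (D : Dat d) : Prop where
  cf : Cf α lm Λ D.f D.a
  lam : |D.lam| ≤ Λ
  c2 : ContDiff ℝ 2 D.u
  hol : ∀ z z', ‖z‖ ≤ 1 → ‖z'‖ ≤ 1 → ∀ i j,
    |pd2 D.u z i j - pd2 D.u z' i j| ≤ D.H * ‖z - z'‖ ^ α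
  bu : ∀ z, ‖z‖ ≤ 1 → |D.u z| ≤ D.N
  bg : ∀ z z', ‖z‖ ≤ 1 → ‖z'‖ ≤ 1 → |D.g z - D.g z'| ≤ D.N * ‖z - z'‖ ^ α
  eq : ∀ z, ‖z‖ ≤ 1 → genL D.f D.a D.u z - D.lam * D.u z = D.g z
  H0 : 0 ≤ D.H

lemma Dat.ok.N0 {α lm Λ : ℝ} {D : Dat d} (h : D.ok α lm Λ) : 0 ≤ D.N :=
  (abs_nonneg _).trans (h.bu 0 (by simp))

lemma S1a {α : ℝ} (hα : 0 < α) (lm Λ : ℝ) {κ : ℝ} (hκ : 0 < κ) : ∃ C, 0 ≤ C ∧ ∀ D : Dat d, D.ok α lm Λ →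
    ∀ p, ‖p‖ ≤ 1/2 → (∀ i j, |pd2 D.u p i j| ≤ κ * D.H + C * D.N) ∧
      ∀ i, |pd1 D.u p i| ≤ κ * D.H + C * D.N := by
  have : ∃ η : ℝ, 0 < η ∧ 2 * η ≤ 1/2 ∧ (2 * η) ^ α ≤ κ := by
    refine ⟨min (1/4) (κ ^ (1/α) / 2), by positivity, ?_, ?_⟩
    · linarith [min_le_left (1/4) (κ ^ (1/α) / 2)]
    · calc (2 * min (1/4) (κ ^ (1/α) / 2)) ^ α ≤ (κ ^ (1/α)) ^ α := by
            apply Real.rpow_le_rpow (by positivity) _ hα.le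
            linarith [min_le_right (1/4) (κ ^ (1/α) / 2)]
        _ = κ := by rw [← Real.rpow_mul hκ.le, one_div_mul_cancel hα.ne', Real.rpow_one]
  obtain ⟨η, hη, hη1, hη2⟩ := this
  refine ⟨4 / η ^ 2 + 6 / η, by positivity, fun D hD p hp => ?_⟩
  have hin : ∀ z, ‖z - p‖ ≤ 2 * η → ‖z‖ ≤ 1 := fun z hz => by
    have := norm_le_norm_add_norm_sub' z p
    linarith
  have hω : ∀ z, ‖z - p‖ ≤ 2 * η → ∀ i j, |pd2 D.u z i j - pd2 D.u p i j| ≤ D.H * κ := by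
    intro z hz i j
    refine (hD.hol z p (hin z hz) (by linarith) i j).trans ?_
    refine mul_le_mul_of_nonneg_left ?_ hD.H0
    exact (Real.rpow_le_rpow (norm_nonneg _) hz hα.le).trans hη2
  have h := fun i j => interp hD.c2 hη (fun z hz => hD.bu z (hin z hz)) hω i j
  have hN := hD.N0
  have hH := hD.H0
  have e1 : 4 * D.N / η ^ 2 = 4 / η ^ 2 * D.N := by ring
  have e2 : 6 * D.N / η = 6 / η * D.N := by ring
  have p1 : 0 ≤ 4 / η ^ 2 * D.N := by positivity
  have p2 : 0 ≤ 6 / η * D.N := by positivity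
  have p3 : 2 * η * (D.H * κ) ≤ 1 * (D.H * κ) := by gcongr; linarith
  refine ⟨fun i j => ?_, fun i => ?_⟩
  · have := (h i j).1
    rw [e1] at this; linarith
  · have := (h i i).2
    rw [e2] at this; linarith

/-- blow-up -/
def bl (α : ℝ) (D : Dat d) (t : ℝ) : (Fin d → ℝ) → ℝ := fun x =>
  (D.H * t ^ (2 + α))⁻¹ * (D.u (0 + t • x) -
    quad (D.u 0) (fun i => t * pd1 D.u 0 i) (fun i j => t ^ 2 / 2 * pd2 D.u 0 i j) x)

section
variable {α lm Λ : ℝ} {D : Dat d} {t : ℝ}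

lemma bl_c2 (hD : D.ok α lm Λ) : ContDiff ℝ 2 (bl α D t) :=
  contDiff_const.mul ((contDiff_scale hD.c2 0 t).sub (quad_contDiff _ _ _))

lemma bl_zero : bl α D t 0 = 0 := by simp [bl, quad]

lemma bl_pd1_zero (hD : D.ok α lm Λ) (i : Fin d) : pd1 (bl α D t) 0 i = 0 := by
  unfold bl
  rw [pd1_cmul (u := fun x => D.u (0 + t • x) - quad _ _ _ x)
      ((C2_diff (contDiff_scale hD.c2 0 t)).sub (C2_diff (quad_contDiff _ _ _))),
    pd1_sub (C2_diff (contDiff_scale hD.c2 0 t)) (C2_diff (quad_contDiff _ _ _)), pd1_quad,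
    pd1_scale (C2_diff hD.c2)]
  simp

lemma bl_pd2 (hD : D.ok α lm Λ) (ht : 0 < t) (x : Fin d → ℝ) (i j : Fin d) : pd2 (bl α D t) x i j =
    (D.H * t ^ α)⁻¹ * (pd2 D.u (t • x) i j - pd2 D.u 0 i j) := by
  unfold bl
  rw [pd2_cmul ((contDiff_scale hD.c2 0 t).sub (quad_contDiff _ _ _)),
    pd2_sub (contDiff_scale hD.c2 0 t) (quad_contDiff _ _ _), pd2_quad,
    pd2_scale hD.c2, pd2_symm hD.c2 0 j i, zero_add]
  have : t ^ (2 + α) = t ^ 2 * t ^ α := by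
    rw [Real.rpow_add ht]; norm_num
  rw [this]
  have h2 : t ^ 2 ≠ 0 := by positivity
  rw [show D.H * (t ^ 2 * t ^ α) = t ^ 2 * (D.H * t ^ α) by ring, mul_inv]
  field_simp
  ring

lemma bl_hol (hD : D.ok α lm Λ) (hH : 0 < D.H) (ht : 0 < t) {R : ℝ} (hR : R * t ≤ 1) {x x' : Fin d → ℝ}
    (hx : ‖x‖ ≤ R) (hx' : ‖x'‖ ≤ R) (i j : Fin d) :
    |pd2 (bl α D t) x i j - pd2 (bl α D t) x' i j| ≤ ‖x - x'‖ ^ α := by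
  rw [bl_pd2 hD ht, bl_pd2 hD ht, ← mul_sub, sub_sub_sub_cancel_right, abs_mul]
  have hta : 0 < D.H * t ^ α := by positivity
  rw [abs_of_pos (inv_pos.2 hta), inv_mul_le_iff₀ hta]
  have hn : ∀ x : Fin d → ℝ, ‖x‖ ≤ R → ‖t • x‖ ≤ 1 := fun x hx => by
    rw [norm_smul, Real.norm_of_nonneg ht.le]; nlinarith [norm_nonneg x]
  have := hD.hol _ _ (hn x hx) (hn x' hx') i j
  rw [← smul_sub, norm_smul, Real.norm_of_nonneg ht.le, Real.mul_rpow ht.le (norm_nonneg _)] at this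
  linarith

lemma bl_LB (hD : D.ok α lm Λ) (hα0 : 0 < α) (hα1 : α ≤ 1) (hH : 0 < D.H) (ht : 0 < t) {R : ℝ} (hR0 : 0 ≤ R) (hR : R * t ≤ 1) :
    LB α R ((1 + d) ^ 2 * (1 + R) ^ 3) (bl α D t) := by
  set v := bl α D t with hv
  have hc := bl_c2 hD (t := t)
  have hRα : R ^ α ≤ 1 + R := by
    calc R ^ α ≤ (1 + R) ^ α := Real.rpow_le_rpow hR0 (by linarith) hα0.le
      _ ≤ (1 + R) ^ (1:ℝ) := Real.rpow_le_rpow_of_exponent_le (by linarith) hα1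
      _ = _ := Real.rpow_one _
  have b2 : ∀ x, ‖x‖ ≤ R → ∀ i j, |pd2 v x i j| ≤ 1 + R := by
    intro x hx i j
    have h1 := bl_hol hD hH ht hR hx (x' := 0) (by simpa using hR0) i j
    have h0 : pd2 v 0 i j = 0 := by rw [hv, bl_pd2 hD ht]; simp
    rw [← hv, h0, sub_zero, sub_zero] at h1
    exact h1.trans ((Real.rpow_le_rpow (norm_nonneg _) hx hα0.le).trans hRα)
  have hb : ∀ x : Fin d → ℝ, ‖x‖ ≤ R → x ∈ Metric.closedBall (0 : Fin d → ℝ) R := fun x hx => by simpa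
  have b1 : ∀ x, ‖x‖ ≤ R → ∀ i, |pd1 v x i| ≤ d * (1 + R) * R := by
    intro x hx i
    have := mvt_pd1 (C2_pd1_diff hc i) (convex_closedBall 0 R) (S := 1 + R) (by positivity)
      (fun z hz k => b2 z (by simpa using hz) k i) (hb x hx) (hb 0 (by simpa using hR0))
    rw [bl_pd1_zero hD, sub_zero, sub_zero] at this
    refine this.trans ?_
    gcongr
  have b0 : ∀ x, ‖x‖ ≤ R → |v x| ≤ d * (d * (1 + R) * R) * R := by
    intro x hx
    have := mvt_pd1 (C2_diff hc) (convex_closedBall 0 R) (S := d * (1 + R) * R) (by positivity)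
      (fun z hz k => b1 z (by simpa using hz) k) (hb x hx) (hb 0 (by simpa using hR0))
    rw [bl_zero, sub_zero, sub_zero] at this
    refine this.trans ?_
    gcongr
  have hd0 : (0:ℝ) ≤ d := Nat.cast_nonneg d
  have k0 : (1:ℝ) ≤ (1 + d) ^ 2 := one_le_pow₀ (by linarith)
  have k1 : (1:ℝ) ≤ (1 + R) ^ 3 := one_le_pow₀ (by linarith)
  intro x hx
  refine ⟨(b0 x hx).trans ?_, fun i => (b1 x hx i).trans ?_, fun i j => (b2 x hx i j).trans ?_, ?_⟩
  · calc (d:ℝ) * (d * (1 + R) * R) * R = d ^ 2 * ((1 + R) * R ^ 2) := by ring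
      _ ≤ (1 + d) ^ 2 * ((1 + R) * (1 + R) ^ 2) := by gcongr <;> linarith
      _ = _ := by ring
  · calc (d:ℝ) * (1 + R) * R = d * ((1 + R) * R * 1) := by ring
      _ ≤ (1 + d) ^ 2 * ((1 + R) * (1 + R) * (1 + R)) := by
          gcongr
          · nlinarith
          · linarith
          · linarith
      _ = _ := by ring
  · calc 1 + R = 1 * ((1 + R) * 1 * 1) := by ring
      _ ≤ (1 + d) ^ 2 * ((1 + R) * (1 + R) * (1 + R)) := by gcongr <;> linarith
      _ = _ := by ring
  · intro x' hx' i j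
    refine (bl_hol hD hH ht hR hx hx' i j).trans ?_
    exact le_mul_of_one_le_left (Real.rpow_nonneg (norm_nonneg _) _) (by nlinarith)

lemma abs_sum_le_card {G : Fin d → ℝ} {c : ℝ} (h : ∀ i, |G i| ≤ c) : |∑ i, G i| ≤ d * c := by
  calc |∑ i, G i| ≤ ∑ i, |G i| := Finset.abs_sum_le_sum_abs _ _
    _ ≤ ∑ _i : Fin d, c := Finset.sum_le_sum fun i _ => h i
    _ = _ := by simp

lemma bl_eq (hD : D.ok α lm Λ) (hα0 : 0 < α) (hα1 : α ≤ 1) (hH : 0 < D.H) (ht : 0 < t) (hΛ : 0 ≤ Λ) {m : ℝ} (hm : 0 ≤ m)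
    (h2 : ∀ p, ‖p‖ ≤ 1/2 → ∀ i j, |pd2 D.u p i j| ≤ m * D.H)
    (h1 : ∀ p, ‖p‖ ≤ 1/2 → ∀ i, |pd1 D.u p i| ≤ m * D.H) (hN : D.N ≤ m * D.H)
    {x : Fin d → ℝ} (hx : ‖x‖ * t ≤ 1/2) :
    |∑ i, ∑ j, D.a 0 i j * pd2 (bl α D t) x i j| ≤
      (2 * d ^ 2 * Λ + 1 + 2 * d * Λ) * m * ‖x‖ ^ α := by
  have hta : 0 < D.H * t ^ α := by positivity
  have hd0 : (0:ℝ) ≤ d := Nat.cast_nonneg d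
  set y := t • x with hy
  have hyn : ‖y‖ = t * ‖x‖ := by rw [hy, norm_smul, Real.norm_of_nonneg ht.le]
  have hy2 : ‖y‖ ≤ 1/2 := by rw [hyn]; linarith
  have hya : ‖y‖ ≤ ‖y‖ ^ α := by
    calc ‖y‖ = ‖y‖ ^ (1:ℝ) := (Real.rpow_one _).symm
      _ ≤ _ := Real.rpow_le_rpow_of_exponent_ge' (norm_nonneg _) (by linarith) hα0.le hα1
  set T := ‖y‖ ^ α with hT
  have hT0 : 0 ≤ T := Real.rpow_nonneg (norm_nonneg _) _
  have e0 := hD.eq 0 (by simp)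
  have e1 := hD.eq y (by linarith)
  have hmH : 0 ≤ m * D.H := by positivity
  have id : ∑ i, ∑ j, D.a 0 i j * (pd2 D.u y i j - pd2 D.u 0 i j) =
      -(∑ i, ∑ j, (D.a y i j - D.a 0 i j) * pd2 D.u y i j) + (D.g y - D.g 0) +
        D.lam * (D.u y - D.u 0) -
        (∑ i, (D.f y i - D.f 0 i) * pd1 D.u y i + ∑ i, D.f 0 i * (pd1 D.u y i - pd1 D.u 0 i)) := by
    rw [← e1, ← e0]
    unfold genL
    simp only [sub_mul, mul_sub, Finset.sum_sub_distrib]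
    ring
  obtain ⟨-, -, -, hf0, hcf⟩ := hD.cf 0 (by simp)
  have hcy := (hD.cf y (by linarith)).2.2.2.2 0 (by simp)
  simp only [sub_zero] at hcy
  have hball : ∀ z : Fin d → ℝ, ‖z‖ ≤ 1/2 → z ∈ Metric.closedBall (0 : Fin d → ℝ) (1/2) :=
    fun z hz => by simpa using hz
  have t1 : |∑ i, ∑ j, (D.a y i j - D.a 0 i j) * pd2 D.u y i j| ≤ d * (d * (Λ * T * (m * D.H))) :=
    abs_sum_le_card fun i => abs_sum_le_card fun j => by
      rw [abs_mul]
      exact mul_le_mul (hcy.1 i j) (h2 y hy2 i j) (abs_nonneg _) (by positivity)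
  have t2 : |D.g y - D.g 0| ≤ m * D.H * T := by
    have := hD.bg y 0 (by linarith) (by simp)
    rw [sub_zero] at this
    exact this.trans (mul_le_mul_of_nonneg_right hN hT0)
  have t3 : |D.lam * (D.u y - D.u 0)| ≤ Λ * (d * (m * D.H) * T) := by
    have := mvt_pd1 (C2_diff hD.c2) (convex_closedBall (0 : Fin d → ℝ) (1/2)) hmH
      (fun z hz k => h1 z (by simpa using hz) k) (hball y hy2) (hball 0 (by simp))
    rw [sub_zero] at this
    rw [abs_mul]
    refine mul_le_mul hD.lam (this.trans ?_) (abs_nonneg _) hΛ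
    gcongr
  have t4 : |∑ i, (D.f y i - D.f 0 i) * pd1 D.u y i| ≤ d * (Λ * T * (m * D.H)) :=
    abs_sum_le_card fun i => by
      rw [abs_mul]
      exact mul_le_mul (hcy.2 i) (h1 y hy2 i) (abs_nonneg _) (by positivity)
  have t5 : |∑ i, D.f 0 i * (pd1 D.u y i - pd1 D.u 0 i)| ≤ d * (Λ * (d * (m * D.H) * T)) :=
    abs_sum_le_card fun i => by
      have := mvt_pd1 (C2_pd1_diff hD.c2 i) (convex_closedBall (0 : Fin d → ℝ) (1/2)) hmH
        (fun z hz k => h2 z (by simpa using hz) k i) (hball y hy2) (hball 0 (by simp))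
      rw [sub_zero] at this
      rw [abs_mul]
      refine mul_le_mul (hf0 i) (this.trans ?_) (abs_nonneg _) hΛ
      gcongr
  have tot : |∑ i, ∑ j, D.a 0 i j * (pd2 D.u y i j - pd2 D.u 0 i j)| ≤
      (2 * d ^ 2 * Λ + 1 + 2 * d * Λ) * m * D.H * T := by
    rw [id]
    rw [abs_le] at *
    constructor <;> linarith
  have e2 : ∑ i, ∑ j, D.a 0 i j * pd2 (bl α D t) x i j =
      (D.H * t ^ α)⁻¹ * ∑ i, ∑ j, D.a 0 i j * (pd2 D.u y i j - pd2 D.u 0 i j) := by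
    simp_rw [bl_pd2 hD ht, Finset.mul_sum]
    refine Finset.sum_congr rfl fun i _ => Finset.sum_congr rfl fun j _ => ?_
    ring
  rw [e2, abs_mul, abs_of_pos (inv_pos.2 hta), inv_mul_le_iff₀ hta]
  refine tot.trans (le_of_eq ?_)
  rw [hT, hyn, Real.mul_rpow ht.le (norm_nonneg _)]
  ring
end

lemma posDef_of_ell {A : Fin d → Fin d → ℝ} {lm : ℝ} (hlm : 0 < lm) (hs : ∀ i j, A i j = A j i)
    (he : ∀ ξ : Fin d → ℝ, lm * ∑ i, ξ i ^ 2 ≤ 2 * ∑ i, ∑ j, ξ i * A i j * ξ j) :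
    (Matrix.of A).PosDef := by
  refine Matrix.PosDef.of_dotProduct_mulVec_pos ?_ fun ξ hξ => ?_
  · ext i j; simp [hs]
  · have h1 := he ξ
    have h2 : 0 < ∑ i, ξ i ^ 2 := by
      obtain ⟨i, hi⟩ := Function.ne_iff.1 hξ
      exact Finset.sum_pos' (fun i _ => sq_nonneg _) ⟨i, Finset.mem_univ i, by
        have : ξ i ≠ 0 := hi
        positivity⟩
    have h3 : star ξ ⬝ᵥ (Matrix.of A).mulVec ξ = ∑ i, ∑ j, ξ i * A i j * ξ j := by
      simp [dotProduct, Matrix.mulVec, Finset.mul_sum, mul_assoc]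
    rw [h3]
    nlinarith [mul_pos hlm h2]

end Blow

section SchauderB
open Filter Topology

variable {d : ℕ}

lemma S1b {α : ℝ} (hα : 0 < α) (hα1 : α < 1) {lm Λ : ℝ} (hlm : 0 < lm) (hΛ : 0 ≤ Λ) {κ : ℝ} (hκ : 0 < κ) :
    ∃ C, 0 ≤ C ∧ ∀ D : Dat d, D.ok α lm Λ →
    ∀ x, ‖x‖ ≤ 1/2 → ∀ i j, |pd2 D.u x i j - pd2 D.u 0 i j| ≤ (κ * D.H + C * D.N) * ‖x‖ ^ α := by
  by_contra hcon
  push Not at hcon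
  choose D hD x hx i j hbad using fun n : ℕ => hcon n (Nat.cast_nonneg n)
  have hN0 : ∀ n, 0 ≤ (D n).N := fun n => (hD n).N0
  have hH0 : ∀ n, 0 ≤ (D n).H := fun n => (hD n).H0
  have hup : ∀ n, |pd2 (D n).u (x n) (i n) (j n) - pd2 (D n).u 0 (i n) (j n)| ≤ (D n).H * ‖x n‖ ^ α := fun n => by
    have := (hD n).hol (x n) 0 ((hx n).trans (by norm_num)) (by simp) (i n) (j n)
    rwa [sub_zero] at this
  have hlt : ∀ n, (κ * (D n).H + n * (D n).N) * ‖x n‖ ^ α < (D n).H * ‖x n‖ ^ α := fun n => (hbad n).trans_le (hup n)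
  have hxα : ∀ n, 0 < ‖x n‖ ^ α := fun n => by
    by_contra h0
    have : ‖x n‖ ^ α = 0 := le_antisymm (not_lt.1 h0) (Real.rpow_nonneg (norm_nonneg _) _)
    have := hlt n
    simp_all
  have hlt' : ∀ n, κ * (D n).H + n * (D n).N < (D n).H := fun n => lt_of_mul_lt_mul_right (hlt n) (hxα n).le
  have hH : ∀ n, 0 < (D n).H := fun n => by
    refine lt_of_le_of_lt ?_ (hlt' n)
    have := hN0 n; have := hH0 n
    positivity
  have hNH : ∀ n : ℕ, n * (D n).N ≤ (D n).H := fun n => by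
    have := mul_pos hκ (hH n)
    linarith [hlt' n]
  have ht : ∀ n, 0 < ‖x n‖ := fun n => by
    rcases (norm_nonneg (x n)).eq_or_lt with h | h
    · exfalso
      have := hxα n
      rw [← h, Real.zero_rpow hα.ne'] at this
      exact lt_irrefl _ this
    · exact h
  -- smallness
  have hNs : ∀ m : ℝ, 0 < m → ∀ᶠ n in atTop, (D n).N ≤ m * (D n).H := by
    intro m hm
    obtain ⟨k, hk⟩ := exists_nat_gt (1/m)
    filter_upwards [eventually_ge_atTop (max k 1)] with n hn
    have hk' : 1/m < n := hk.trans_le (by exact_mod_cast (le_max_left k 1).trans hn)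
    rw [div_lt_iff₀ hm] at hk'
    nlinarith [hNH n, hN0 n, hH n]
  have hsm : ∀ m : ℝ, 0 < m → ∀ᶠ n in atTop, ∀ p, ‖p‖ ≤ 1/2 →
      (∀ i j, |pd2 (D n).u p i j| ≤ m * (D n).H) ∧ ∀ i, |pd1 (D n).u p i| ≤ m * (D n).H := by
    intro m hm
    obtain ⟨C, hC, h⟩ := S1a (d := d) hα lm Λ (half_pos hm)
    filter_upwards [hNs (m / 2 / (C + 1)) (by positivity)] with n hn p hp
    have h3 : C * (D n).N ≤ m / 2 * (D n).H := by
      rw [div_mul_eq_mul_div, le_div_iff₀ (by positivity)] at hn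
      nlinarith [hN0 n]
    refine ⟨fun i j => ((h (D n) (hD n) p hp).1 i j).trans (by linarith), fun i => ((h (D n) (hD n) p hp).2 i).trans (by linarith)⟩
  have ht0 : Tendsto (fun n => ‖x n‖) atTop (𝓝 0) := by
    have h1 : Tendsto (fun n => ‖x n‖ ^ α) atTop (𝓝 0) := by
      rw [Metric.tendsto_nhds]
      intro ε hε
      filter_upwards [hsm (κ * ε / 2) (by positivity)] with n hn
      have a1 := (hn (x n) (hx n)).1 (i n) (j n)
      have a2 := (hn 0 (by simp)).1 (i n) (j n)
      have a3 := (hbad n).trans_le ((abs_sub _ _).trans (add_le_add a1 a2))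
      have a4 : 0 ≤ (n * (D n).N) * ‖x n‖ ^ α := by
        have := hN0 n; positivity
      have a5 : (κ * (D n).H) * ‖x n‖ ^ α < (κ * (D n).H) * ε := by nlinarith
      have := lt_of_mul_lt_mul_left a5 (by have := hH n; positivity)
      simpa [abs_of_pos (hxα n)] using this
    have h2 := h1.rpow_const (p := 1/α) (Or.inr (by positivity))
    rw [Real.zero_rpow (by positivity)] at h2
    refine h2.congr fun n => ?_
    rw [← Real.rpow_mul (norm_nonneg _), mul_one_div_cancel hα.ne', Real.rpow_one]
  have htR : ∀ R c : ℝ, 0 < c → ∀ᶠ n in atTop, R * ‖x n‖ ≤ c := by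
    intro R c hc
    have := ht0.const_mul R
    rw [mul_zero] at this
    exact this.eventually (ge_mem_nhds hc)
  set U : Ultrafilter ℕ := hyperfilter ℕ with hU
  have hUle : (U : Filter ℕ) ≤ atTop := by
    rw [← Nat.cofinite_eq_atTop]; exact hyperfilter_le_cofinite
  set v : ℕ → (Fin d → ℝ) → ℝ := fun n => bl α (D n) ‖x n‖ with hv
  have hLB : ∀ R, ∃ b, ∀ᶠ n in U, LB α R b (v n) := by
    intro R
    refine ⟨(1 + d) ^ 2 * (1 + |R|) ^ 3, Eventually.filter_mono hUle ?_⟩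
    filter_upwards [htR |R| 1 one_pos] with n hn
    have := bl_LB (hD n) hα hα1.le (hH n) (ht n) (abs_nonneg R) hn
    intro z hz
    obtain ⟨b0, b1, b2, b3⟩ := this z (hz.trans (le_abs_self R))
    exact ⟨b0, b1, b2, fun z' hz' => b3 z' (hz'.trans (le_abs_self R))⟩
  obtain ⟨w, hw, -, -, hw2, hwLB⟩ := compC U hα (fun n => bl_c2 (hD n)) hLB
  -- limit of coefficients
  have hAlim : ∀ i j, ∃ L, Tendsto (fun n => (D n).a 0 i j) U (𝓝 L) := fun i j =>
    ultra_lim U (b := Λ) (Eventually.of_forall fun n => ((hD n).cf 0 (by simp)).2.2.1 i j)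
  choose A hA using hAlim
  have hAs : ∀ i j, A i j = A j i := fun i j => tendsto_nhds_unique (hA i j)
    ((hA j i).congr fun n => ((hD n).cf 0 (by simp)).1 j i)
  have hAe : ∀ ξ : Fin d → ℝ, lm * ∑ i, ξ i ^ 2 ≤ 2 * ∑ i, ∑ j, ξ i * A i j * ξ j := by
    intro ξ
    have : Tendsto (fun n => 2 * ∑ i, ∑ j, ξ i * (D n).a 0 i j * ξ j) U (𝓝 (2 * ∑ i, ∑ j, ξ i * A i j * ξ j)) :=
      (tendsto_finsetSum _ fun i _ => tendsto_finsetSum _ fun j _ =>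
        ((hA i j).const_mul (ξ i)).mul_const (ξ j)).const_mul 2
    exact ge_of_tendsto this (Eventually.of_forall fun n => ((hD n).cf 0 (by simp)).2.1 ξ)
  have hpd := posDef_of_ell hlm hAs hAe
  have heq : ∀ z, ∑ i, ∑ j, (Matrix.of A) i j * pd2 w z i j = 0 := by
    intro z
    have h1 : Tendsto (fun n => ∑ i, ∑ j, (D n).a 0 i j * pd2 (v n) z i j) U
        (𝓝 (∑ i, ∑ j, A i j * pd2 w z i j)) :=
      tendsto_finsetSum _ fun i _ => tendsto_finsetSum _ fun j _ => (hA i j).mul (hw2 z i j)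
    have h2 : Tendsto (fun n => ∑ i, ∑ j, (D n).a 0 i j * pd2 (v n) z i j) U (𝓝 0) := by
      rw [Metric.tendsto_nhds]
      intro ε hε
      set q := (2 * d ^ 2 * Λ + 1 + 2 * d * Λ) * ‖z‖ ^ α with hq
      have hq0 : 0 ≤ q := by positivity
      refine Eventually.filter_mono hUle ?_
      have hm : 0 < ε / (q + 1) := by positivity
      filter_upwards [hNs _ hm, hsm _ hm, htR ‖z‖ (1/2) (by norm_num)] with n h1 h2 h3
      have := bl_eq (hD n) hα hα1.le (hH n) (ht n) hΛ hm.le (fun p hp => (h2 p hp).1)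
        (fun p hp => (h2 p hp).2) h1 h3
      rw [dist_zero_right, Real.norm_eq_abs]
      refine this.trans_lt ?_
      calc _ = q * (ε / (q + 1)) := by rw [hq]; ring
        _ < ε := by rw [mul_div_assoc', div_lt_iff₀ (by positivity)]; nlinarith
    exact tendsto_nhds_unique h1 h2
  have hKglob : ∀ z z' i j, |pd2 w z i j - pd2 w z' i j| ≤ 1 * ‖z - z'‖ ^ α := by
    intro z z' i j
    have hl := ((hw2 z i j).sub (hw2 z' i j)).abs
    refine le_of_tendsto hl (Eventually.filter_mono hUle ?_)
    filter_upwards [htR (max ‖z‖ ‖z'‖) 1 one_pos] with n hn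
    rw [one_mul]
    exact bl_hol (hD n) (hH n) (ht n) hn (le_max_left _ _) (le_max_right _ _) i j
  have hconst := liouvilleA hpd hα.le hα1 hw hKglob heq
  have hw0 : ∀ i j, pd2 w 0 i j = 0 := fun i j =>
    tendsto_nhds_unique (hw2 0 i j) (tendsto_const_nhds.congr fun n => by
      simp [bl_pd2 (hD n) (ht n)])
  -- limit point of directions
  set e : ℕ → Fin d → ℝ := fun n => ‖x n‖⁻¹ • x n with he
  have hen : ∀ n, ‖e n‖ = 1 := fun n => by
    rw [he]; simp only [norm_smul, norm_inv, norm_norm]; exact inv_mul_cancel₀ (ht n).ne'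
  obtain ⟨e0, he0, hel⟩ := (isCompact_closedBall (0 : Fin d → ℝ) 1).ultrafilter_le_nhds (U.map e)
    (by
      rw [Filter.le_principal_iff, Ultrafilter.coe_map, Filter.mem_map]
      exact Eventually.of_forall fun n => by simp [hen n])
  have hel' : Tendsto e U (𝓝 e0) := hel
  have hz : ∀ i j, Tendsto (fun n => pd2 (v n) e0 i j) U (𝓝 0) := fun i j => by
    have := hw2 e0 i j
    rwa [hconst e0 i j, hw0] at this
  have hev : ∀ᶠ n in U, (∀ i j, |pd2 (v n) e0 i j| ≤ κ / 2) ∧ ‖e n - e0‖ ^ α < κ / 2 ∧ 1 * ‖x n‖ ≤ 1 := by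
    refine Eventually.and ?_ (Eventually.and ?_ ((htR 1 1 one_pos).filter_mono hUle))
    · refine eventually_all.2 fun i => eventually_all.2 fun j => ?_
      have := (hz i j).abs
      rw [abs_zero] at this
      exact this.eventually (ge_mem_nhds (by positivity))
    · have h1 : Tendsto (fun n => ‖e n - e0‖ ^ α) U (𝓝 0) := by
        have := ((hel'.sub_const e0).norm).rpow_const (p := α) (Or.inr hα.le)
        rwa [sub_self, norm_zero, Real.zero_rpow hα.ne'] at this
      exact h1.eventually (gt_mem_nhds (by positivity))
  obtain ⟨n, h1, h2, h3⟩ := hev.exists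
  have h4 := bl_hol (hD n) (hH n) (ht n) h3 (hen n).le (by simpa using he0) (i n) (j n)
  have h5 : |pd2 (v n) (e n) (i n) (j n)| ≤ κ := by
    have e1 := abs_sub_abs_le_abs_sub (pd2 (v n) (e n) (i n) (j n)) (pd2 (v n) e0 (i n) (j n))
    have e2 := h1 (i n) (j n)
    have e3 : |pd2 (v n) (e n) (i n) (j n) - pd2 (v n) e0 (i n) (j n)| ≤ ‖e n - e0‖ ^ α := h4
    linarith
  have h6 : ‖x n‖ • e n = x n := by
    rw [he]; simp only; rw [smul_smul, mul_inv_cancel₀ (ht n).ne', one_smul]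
  simp only [hv] at h5
  rw [bl_pd2 (hD n) (ht n), h6, abs_mul] at h5
  have hta : 0 < (D n).H * ‖x n‖ ^ α := mul_pos (hH n) (hxα n)
  rw [abs_of_pos (inv_pos.2 hta), inv_mul_le_iff₀ hta] at h5
  have h7 := hbad n
  have : 0 ≤ (n * (D n).N) * ‖x n‖ ^ α := by
    have := hN0 n; positivity
  nlinarith

end SchauderB

section SchauderG
open Filter Topology

variable {d : ℕ}

lemma genL_scale {u : (Fin d → ℝ) → ℝ} (hu : ContDiff ℝ 2 u) (f : (Fin d → ℝ) → Fin d → ℝ)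
    (a : (Fin d → ℝ) → Fin d → Fin d → ℝ) (y : Fin d → ℝ) (r : ℝ) (z : Fin d → ℝ) :
    genL (fun z i => r * f (y + r • z) i) (fun z => a (y + r • z)) (fun z => u (y + r • z)) z =
      r ^ 2 * genL f a u (y + r • z) := by
  unfold genL
  simp_rw [pd1_scale (C2_diff hu), pd2_scale hu, mul_add, Finset.mul_sum]
  congr 1
  · exact Finset.sum_congr rfl fun i _ => by ring
  · exact Finset.sum_congr rfl fun i _ => Finset.sum_congr rfl fun j _ => by ring

/-- a problem at scale `r y` around each point, with weight `W` -/
structure Wh (α lm Λ c : ℝ) (f : (Fin d → ℝ) → Fin d → ℝ) (a : (Fin d → ℝ) → Fin d → Fin d → ℝ)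
    (lam : ℝ) (u g : (Fin d → ℝ) → ℝ) (r W : (Fin d → ℝ) → ℝ) : Prop where
  r0 : ∀ y, 0 < r y
  r1 : ∀ y, r y ≤ 1
  rr : ∀ y y', ‖y' - y‖ ≤ r y → r y ≤ 2 * r y'
  WW : ∀ y y', ‖y' - y‖ ≤ r y → W y' ≤ c * W y
  W0 : ∃ w, 0 < w ∧ ∀ y, w ≤ W y
  cf : ∀ y, Cf α lm Λ (fun z i => r y * f (y + r y • z) i) (fun z => a (y + r y • z))
  hlam : ∀ y, |r y ^ 2 * lam| ≤ Λ
  c2 : ContDiff ℝ 2 u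
  hol : ∃ K, ∀ z z' i j, |pd2 u z i j - pd2 u z' i j| ≤ K * ‖z - z'‖ ^ α
  bu : ∀ y z, ‖z‖ ≤ 1 → |u (y + r y • z)| ≤ W y
  bg : ∀ y z z', ‖z‖ ≤ 1 → ‖z'‖ ≤ 1 → |r y ^ 2 * g (y + r y • z) - r y ^ 2 * g (y + r y • z')| ≤ W y * ‖z - z'‖ ^ α
  eq : ∀ z, genL f a u z - lam * u z = g z

/-- weighted global Schauder estimate -/
lemma schauderW {α : ℝ} (hα : 0 < α) (hα1 : α < 1) {lm Λ c : ℝ} (hlm : 0 < lm) (hΛ : 0 ≤ Λ) (hc : 1 ≤ c) :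
    ∃ C, 0 ≤ C ∧ ∀ f a lam, ∀ u g r W : (Fin d → ℝ) → ℝ, Wh α lm Λ c f a lam u g r W →
      ∀ y, (∀ z z', ‖z‖ ≤ 1 → ‖z'‖ ≤ 1 → ∀ i j,
        r y ^ 2 * |pd2 u (y + r y • z) i j - pd2 u (y + r y • z') i j| ≤ C * W y * ‖z - z'‖ ^ α) ∧
        (∀ i j, r y ^ 2 * |pd2 u y i j| ≤ C * W y) ∧ (∀ i, r y * |pd1 u y i| ≤ C * W y) := by
  set κ : ℝ := 1 / (64 * c) with hκd
  have hκ : 0 < κ := by positivity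
  obtain ⟨C2, hC2, h2⟩ := S1a (d := d) hα lm Λ hκ
  obtain ⟨C1, hC1, h1⟩ := S1b (d := d) hα hα1 hlm hΛ hκ
  set Cm := 32 * c * (C1 + C2) with hCm
  have hCm0 : 0 ≤ Cm := by positivity
  refine ⟨2 * Cm + κ * (2 * Cm) + C2, by positivity, fun f a lam u g r W hw => ?_⟩
  obtain ⟨w0, hw0, hW0⟩ := hw.W0
  have hWp : ∀ y, 0 < W y := fun y => hw0.trans_le (hW0 y)
  have hr0 := hw.r0
  obtain ⟨K, hK⟩ := hw.hol
  let P : ℝ → Prop := fun H => ∀ y z z', ‖z‖ ≤ 1 → ‖z'‖ ≤ 1 → ∀ i j,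
        r y ^ 2 * |pd2 u (y + r y • z) i j - pd2 u (y + r y • z') i j| ≤ H * W y * ‖z - z'‖ ^ α
  let DD : (Fin d → ℝ) → ℝ → Dat d := fun y H =>
    ⟨fun z i => r y * f (y + r y • z) i, fun z => a (y + r y • z), r y ^ 2 * lam, fun z => u (y + r y • z),
      fun z => r y ^ 2 * g (y + r y • z), H * W y, W y⟩
  have hok : ∀ y H, 0 ≤ H → P H → (DD y H).ok α lm Λ := by
    intro y H hH hP
    refine ⟨hw.cf y, hw.hlam y, contDiff_scale hw.c2 y (r y), ?_, hw.bu y, hw.bg y, ?_, mul_nonneg hH (hWp y).le⟩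
    · intro z z' hz hz' i j
      simp only [DD]
      rw [pd2_scale hw.c2, pd2_scale hw.c2, ← mul_sub, abs_mul, abs_of_nonneg (sq_nonneg _)]
      exact hP y z z' hz hz' i j
    · intro z hz
      simp only [DD]
      rw [genL_scale hw.c2, ← hw.eq]
      ring
  have hpt : ∀ y H, 0 ≤ H → P H → (∀ i j, r y ^ 2 * |pd2 u y i j| ≤ (κ * H + C2) * W y) ∧
      (∀ i, r y * |pd1 u y i| ≤ (κ * H + C2) * W y) := by
    intro y H hH hP
    have := h2 (DD y H) (hok y H hH hP) 0 (by simp)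
    simp only [DD] at this
    refine ⟨fun i j => ?_, fun i => ?_⟩
    · have := this.1 i j
      rw [pd2_scale hw.c2, abs_mul, abs_of_nonneg (sq_nonneg _), smul_zero, add_zero] at this
      linarith
    · have := this.2 i
      rw [pd1_scale (C2_diff hw.c2), abs_mul, abs_of_pos (hr0 y), smul_zero, add_zero] at this
      linarith
  have hstep : ∀ H, 0 ≤ H → P H → P (H / 2 + Cm) := by
    intro H hH hP y z z' hz hz' i j
    have key : ∀ z : Fin d → ℝ, ‖z‖ ≤ 1 → r y ≤ 2 * r (y + r y • z) ∧ W (y + r y • z) ≤ c * W y := by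
      intro z hz
      have : ‖y + r y • z - y‖ ≤ r y := by
        rw [add_sub_cancel_left, norm_smul, Real.norm_of_nonneg (hr0 y).le]
        exact mul_le_of_le_one_right (hr0 y).le hz
      exact ⟨hw.rr _ _ this, hw.WW _ _ this⟩
    obtain ⟨k1, k2⟩ := key z hz
    obtain ⟨k1', k2'⟩ := key z' hz'
    set p := y + r y • z with hp
    set p' := y + r y • z' with hp'
    set ρ := r p with hρ
    have hρ0 : 0 < ρ := hr0 p
    have hy0 := hr0 y
    have hWy := hWp y
    have hq : 0 ≤ κ * H := by positivity
    have hcκ : 32 * c * κ = 1/2 := by rw [hκd]; field_simp; norm_num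
    have hfin : 32 * c * (κ * H + C1 + C2) = H / 2 + Cm := by
      rw [hCm]; linear_combination H * hcκ
    have hsq : ∀ q, 0 < r q → r y ≤ 2 * r q → r y ^ 2 ≤ 4 * r q ^ 2 := fun q hq0 hq => by nlinarith
    rcases le_or_gt (‖z' - z‖ * r y) (ρ / 2) with hcase | hcase
    · set x : Fin d → ℝ := (r y / ρ) • (z' - z) with hx
      have hxn : ‖x‖ = r y / ρ * ‖z' - z‖ := by
        rw [hx, norm_smul, Real.norm_of_nonneg (by positivity)]
      have hx2 : ‖x‖ ≤ 1/2 := by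
        rw [hxn, div_mul_eq_mul_div, div_le_iff₀ hρ0]; linarith
      have hpx : p + ρ • x = p' := by
        rw [hx, smul_smul, mul_div_cancel₀ _ hρ0.ne', hp, hp', smul_sub]; abel
      have := h1 (DD p H) (hok p H hH hP) x hx2 i j
      simp only [DD] at this
      rw [pd2_scale hw.c2, pd2_scale hw.c2, ← mul_sub, abs_mul, abs_of_nonneg (sq_nonneg _), ← hρ, hpx, smul_zero,
        add_zero, abs_sub_comm] at this
      have hxa : ‖x‖ ^ α ≤ 2 * ‖z - z'‖ ^ α := by
        rw [hxn, Real.mul_rpow (by positivity) (norm_nonneg _), norm_sub_rev]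
        refine mul_le_mul_of_nonneg_right ?_ (Real.rpow_nonneg (norm_nonneg _) _)
        calc (r y / ρ) ^ α ≤ 2 ^ α := by
              refine Real.rpow_le_rpow (by positivity) ?_ hα.le
              rw [div_le_iff₀ hρ0]; exact k1
          _ ≤ 2 ^ (1:ℝ) := Real.rpow_le_rpow_of_exponent_le (by norm_num) hα1.le
          _ = 2 := Real.rpow_one _
      have hT := Real.rpow_nonneg (norm_nonneg (z - z')) α
      calc r y ^ 2 * |pd2 u p i j - pd2 u p' i j| ≤ 4 * ρ ^ 2 * |pd2 u p i j - pd2 u p' i j| :=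
            mul_le_mul_of_nonneg_right (hsq p hρ0 k1) (abs_nonneg _)
        _ = 4 * (ρ ^ 2 * |pd2 u p i j - pd2 u p' i j|) := by ring
        _ ≤ 4 * ((κ * (H * W p) + C1 * W p) * ‖x‖ ^ α) := by linarith
        _ = 4 * ((κ * H + C1) * W p * ‖x‖ ^ α) := by ring
        _ ≤ 4 * ((κ * H + C1) * (c * W y) * (2 * ‖z - z'‖ ^ α)) := by gcongr
        _ = 8 * c * (κ * H + C1) * W y * ‖z - z'‖ ^ α := by ring
        _ ≤ (32 * c * (κ * H + C1 + C2)) * W y * ‖z - z'‖ ^ α := by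
            refine mul_le_mul_of_nonneg_right (mul_le_mul_of_nonneg_right ?_ hWy.le) hT
            have z1 : 0 ≤ c * (κ * H) := by positivity
            have z2 : 0 ≤ c * C1 := by positivity
            have z3 : 0 ≤ c * C2 := by positivity
            linarith
        _ = _ := by rw [hfin]
    · have hz4 : 1/4 < ‖z - z'‖ := by
        rw [norm_sub_rev]
        by_contra hh
        push Not at hh
        nlinarith
      have hza : 1/4 ≤ ‖z - z'‖ ^ α := by
        rcases le_or_gt 1 ‖z - z'‖ with h | h
        · linarith [Real.one_le_rpow h hα.le]
        · have := Real.rpow_le_rpow_of_exponent_ge (x := ‖z - z'‖) (by linarith) h.le hα1.le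
          rw [Real.rpow_one] at this; linarith
      have e : ∀ q, 0 < r q → r y ≤ 2 * r q → W q ≤ c * W y → r y ^ 2 * |pd2 u q i j| ≤ 4 * ((κ * H + C2) * (c * W y)) := by
        intro q hq0 hq1 hq2
        calc r y ^ 2 * |pd2 u q i j| ≤ 4 * r q ^ 2 * |pd2 u q i j| :=
              mul_le_mul_of_nonneg_right (hsq q hq0 hq1) (abs_nonneg _)
          _ = 4 * (r q ^ 2 * |pd2 u q i j|) := by ring
          _ ≤ 4 * ((κ * H + C2) * W q) := by linarith [(hpt q H hH hP).1 i j]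
          _ ≤ _ := by gcongr
      have e1 := e p hρ0 k1 k2
      have e2 := e p' (hr0 _) k1' k2'
      have e3 : r y ^ 2 * |pd2 u p i j - pd2 u p' i j| ≤ r y ^ 2 * (|pd2 u p i j| + |pd2 u p' i j|) :=
        mul_le_mul_of_nonneg_left (abs_sub _ _) (sq_nonneg _)
      calc r y ^ 2 * |pd2 u p i j - pd2 u p' i j| ≤ 8 * ((κ * H + C2) * (c * W y)) := by linarith
        _ = (32 * c * (κ * H + C2)) * W y * (1/4) := by ring
        _ ≤ (32 * c * (κ * H + C1 + C2)) * W y * ‖z - z'‖ ^ α := by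
            gcongr
            linarith
        _ = _ := by rw [hfin]
  have hP0 : ∃ H0, 0 ≤ H0 ∧ P H0 := by
    refine ⟨|K| / w0, by positivity, fun y z z' hz hz' i j => ?_⟩
    have e1 := hK (y + r y • z) (y + r y • z') i j
    rw [add_sub_add_left_eq_sub, ← smul_sub, norm_smul, Real.norm_of_nonneg (hr0 y).le,
      Real.mul_rpow (hr0 y).le (norm_nonneg _)] at e1
    have hT := Real.rpow_nonneg (norm_nonneg (z - z')) α
    have hra : r y ^ α ≤ 1 := Real.rpow_le_one (hr0 y).le (hw.r1 y) hα.le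
    have hr2 : r y ^ 2 ≤ 1 := by have := hr0 y; have := hw.r1 y; nlinarith
    calc r y ^ 2 * |pd2 u (y + r y • z) i j - pd2 u (y + r y • z') i j| ≤ 1 * (|K| * (1 * ‖z - z'‖ ^ α)) := by
          refine mul_le_mul hr2 (e1.trans ?_) (abs_nonneg _) zero_le_one
          refine mul_le_mul (le_abs_self K) (mul_le_mul_of_nonneg_right hra hT) ?_ (abs_nonneg _)
          have := Real.rpow_nonneg (hr0 y).le α
          positivity
      _ = |K| / w0 * w0 * ‖z - z'‖ ^ α := by field_simp
      _ ≤ _ := by gcongr; exact hW0 y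
  obtain ⟨H0, hH0, hPH0⟩ := hP0
  have hit : ∀ n : ℕ, P (H0 / 2 ^ n + 2 * Cm) := by
    intro n
    induction n with
    | zero =>
      intro y z z' hz hz' i j
      refine (hPH0 y z z' hz hz' i j).trans ?_
      have hT := Real.rpow_nonneg (norm_nonneg (z - z')) α
      have := hWp y
      gcongr
      simp; linarith
    | succ n ih =>
      have := hstep _ (by positivity) ih
      have e : (H0 / 2 ^ n + 2 * Cm) / 2 + Cm = H0 / 2 ^ (n + 1) + 2 * Cm := by
        rw [pow_succ]; field_simp; ring
      rwa [e] at this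
  have hPf : P (2 * Cm) := by
    intro y z z' hz hz' i j
    have hl : Tendsto (fun n : ℕ => (H0 / 2 ^ n + 2 * Cm) * W y * ‖z - z'‖ ^ α) atTop
        (𝓝 ((0 + 2 * Cm) * W y * ‖z - z'‖ ^ α)) := by
      refine ((Tendsto.add_const _ ?_).mul_const _).mul_const _
      exact tendsto_const_nhds.div_atTop (tendsto_pow_atTop_atTop_of_one_lt (by norm_num))
    rw [zero_add] at hl
    exact ge_of_tendsto' hl fun n => hit n y z z' hz hz' i j
  intro y
  have hWy := hWp y
  obtain ⟨q2, q1⟩ := hpt y _ (by positivity) hPf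
  refine ⟨fun z z' hz hz' i j => (hPf y z z' hz hz' i j).trans ?_, fun i j => (q2 i j).trans ?_, fun i => (q1 i).trans ?_⟩
  · have hT := Real.rpow_nonneg (norm_nonneg (z - z')) α
    have : 0 ≤ κ * (2 * Cm) := by positivity
    gcongr
    linarith
  all_goals
    gcongr
    linarith

end SchauderG

section MaxP
open Filter Topology

variable {d : ℕ}

/-- second derivative test along coordinates -/
lemma pd2_diag_nonpos {φ : (Fin d → ℝ) → ℝ} (hφ : ContDiff ℝ 2 φ) {y : Fin d → ℝ} (h : IsLocalMax φ y)
    (k : Fin d) : pd2 φ y k k ≤ 0 := by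
  have h1 : pd1 φ y k = 0 := by unfold pd1; rw [h.fderiv_eq_zero]; simp
  obtain ⟨δ, hδ, hδm⟩ := Metric.eventually_nhds_iff.1 h
  have hex : ∀ n : ℕ, ∃ ξ : ℝ, 0 < ξ ∧ ξ < δ / (n + 2) ∧ pd2 φ (y + ξ • Pi.single k 1) k k ≤ 0 := by
    intro n
    have hη : 0 < δ / (n + 2) := by positivity
    obtain ⟨ξ, hξ0, hξ1, hξ⟩ := line_mvt (C2_diff hφ) y k hη
    obtain ⟨ξ', hξ0', hξ1', hξ'⟩ := line_mvt (C2_pd1_diff hφ k) y k hξ0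
    refine ⟨ξ', hξ0', hξ1'.trans hξ1, ?_⟩
    have hm : φ (y + (δ / (n + 2)) • Pi.single k 1) ≤ φ y := by
      apply hδm
      rw [dist_self_add_left]
      refine (norm_smul_single_le hη.le k).trans_lt ?_
      rw [div_lt_iff₀ (by positivity)]
      nlinarith [(Nat.cast_nonneg n : (0:ℝ) ≤ n)]
    have s1 : pd1 φ (y + ξ • Pi.single k 1) k ≤ 0 := by
      by_contra hh
      push Not at hh
      nlinarith [mul_pos hη hh]
    rw [h1, sub_zero] at hξ'
    rw [pd2_eq]
    by_contra hh
    push Not at hh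
    nlinarith [mul_pos hξ0 hh]
  choose ξ hξ0 hξ1 hξ using hex
  have ht : Tendsto ξ atTop (𝓝 0) := by
    refine squeeze_zero (fun n => (hξ0 n).le) (fun n => (hξ1 n).le) ?_
    refine tendsto_const_nhds.div_atTop ?_
    exact tendsto_atTop_add_const_right _ _ tendsto_natCast_atTop_atTop
  have hc : Tendsto (fun n => pd2 φ (y + ξ n • Pi.single k 1) k k) atTop (𝓝 (pd2 φ y k k)) := by
    have h2 : Tendsto (fun n => y + ξ n • (Pi.single k 1 : Fin d → ℝ)) atTop (𝓝 y) := by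
      have := (ht.smul_const (Pi.single k 1 : Fin d → ℝ)).const_add y
      simpa using this
    exact ((C2_pd2_cont hφ k k).tendsto y).comp h2
  exact le_of_tendsto' hc hξ

/-- ellipticity at every point -/
def Ell (lm : ℝ) (a : (Fin d → ℝ) → Fin d → Fin d → ℝ) : Prop :=
  0 < lm ∧ (∀ y i j, a y i j = a y j i) ∧
    ∀ y (ξ : Fin d → ℝ), lm * ∑ i, ξ i ^ 2 ≤ 2 * ∑ i, ∑ j, ξ i * a y i j * ξ j

lemma genL_nonpos {φ : (Fin d → ℝ) → ℝ} (hφ : ContDiff ℝ 2 φ) {y : Fin d → ℝ} (h : IsLocalMax φ y)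
    {lm : ℝ} (f : (Fin d → ℝ) → Fin d → ℝ) {a : (Fin d → ℝ) → Fin d → Fin d → ℝ} (ha : Ell lm a) :
    genL f a φ y ≤ 0 := by
  have h1 : ∀ i, pd1 φ y i = 0 := fun i => by unfold pd1; rw [h.fderiv_eq_zero]; simp
  unfold genL
  simp only [h1, mul_zero, Finset.sum_const_zero, zero_add]
  obtain ⟨B, hB⟩ := psd_factor (posDef_of_ell ha.1 (ha.2.1 y) (ha.2.2 y)).posSemidef
  set v : (Fin d → ℝ) → ℝ := fun x => φ (y + (1:ℝ) • x) with hv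
  have hvc : ContDiff ℝ 2 v := contDiff_scale hφ y 1
  set S := B.conjTranspose with hS
  have hloc : IsLocalMax (fun z => v (S.mulVec z)) 0 := by
    have hc : Continuous (fun z : Fin d → ℝ => y + (1:ℝ) • S.mulVec z) := by
      have : Continuous fun z : Fin d → ℝ => S.mulVec z := Continuous.matrix_mulVec continuous_const continuous_id
      fun_prop
    have ht := hc.tendsto 0
    simp only [Matrix.mulVec_zero, smul_zero, add_zero] at ht
    filter_upwards [ht.eventually h] with z hz
    simpa [hv] using hz
  have hk : ∀ k, ∑ j, S j k * ∑ i, S i k * pd2 φ y i j ≤ 0 := by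
    intro k
    have := pd2_diag_nonpos (contDiff_lin hvc S) hloc k
    rw [pd2_lin hvc] at this
    simp only [hv, pd2_scale hφ, Matrix.mulVec_zero, smul_zero, add_zero, one_pow, one_mul] at this
    exact this
  have e : ∑ i, ∑ j, a y i j * pd2 φ y i j = ∑ k, ∑ j, S j k * ∑ i, S i k * pd2 φ y i j := by
    have e1 : ∀ i j, a y i j = ∑ k, S i k * S j k := by
      intro i j
      have := congrFun (congrFun hB i) j
      rw [Matrix.of_apply] at this
      rw [this, Matrix.mul_apply]
      refine Finset.sum_congr rfl fun k _ => ?_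
      simp [hS]
    simp_rw [e1, Finset.sum_mul, Finset.mul_sum]
    rw [Finset.sum_comm]
    rw [show (∑ j, ∑ i, ∑ k, S i k * S j k * pd2 φ y i j) = ∑ j, ∑ k, ∑ i, S i k * S j k * pd2 φ y i j from
      Finset.sum_congr rfl fun j _ => Finset.sum_comm]
    rw [Finset.sum_comm]
    refine Finset.sum_congr rfl fun k _ => Finset.sum_congr rfl fun j _ => Finset.sum_congr rfl fun i _ => by ring
  rw [e]
  exact Finset.sum_nonpos fun k _ => hk k

lemma MP {φ : (Fin d → ℝ) → ℝ} (hφ : ContDiff ℝ 2 φ)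
    {lm : ℝ} (f : (Fin d → ℝ) → Fin d → ℝ) {a : (Fin d → ℝ) → Fin d → Fin d → ℝ} (ha : Ell lm a)
    {R : ℝ} (hR : ∀ y, R < ‖y‖ → φ y ≤ 0) (h : ∀ y, 0 < φ y → 0 < genL f a φ y) (y : Fin d → ℝ) : φ y ≤ 0 := by
  by_contra hy
  push Not at hy
  obtain ⟨z, hz, hzm⟩ := (isCompact_closedBall (0 : Fin d → ℝ) R).exists_isMaxOn
    ⟨y, by by_contra hh; exact absurd (hR y (by simpa using hh)) (not_le.2 hy)⟩ hφ.continuous.continuousOn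
  have hyR : ‖y‖ ≤ R := by by_contra hh; exact absurd (hR y (by simpa using hh)) (not_le.2 hy)
  have hz0 : 0 < φ z := hy.trans_le (hzm (by simpa using hyR))
  have hmax : ∀ x, φ x ≤ φ z := fun x => by
    rcases le_or_gt ‖x‖ R with hx | hx
    · exact hzm (by simpa using hx)
    · exact (hR x hx).trans hz0.le
  exact absurd (h z hz0) (not_lt.2 (genL_nonpos hφ (Eventually.of_forall hmax) f ha))

/-- squared Euclidean distance -/
def esq (p y : Fin d → ℝ) : ℝ := ∑ i, (y i - p i) ^ 2

lemma esq_nonneg (p y : Fin d → ℝ) : 0 ≤ esq p y := Finset.sum_nonneg fun i _ => sq_nonneg _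

lemma esq_contDiff {n : WithTop ℕ∞} (p : Fin d → ℝ) : ContDiff ℝ n (esq p) := by
  unfold esq; fun_prop

lemma esq_ge (p y : Fin d → ℝ) : ‖y - p‖ ^ 2 ≤ esq p y := norm_sq_le_sum (y - p)

lemma esq_le (p y : Fin d → ℝ) : esq p y ≤ d * ‖y - p‖ ^ 2 := by
  unfold esq
  calc ∑ i, (y i - p i) ^ 2 ≤ ∑ _i : Fin d, ‖y - p‖ ^ 2 := by
        refine Finset.sum_le_sum fun i _ => ?_
        rw [← sq_abs]
        exact pow_le_pow_left₀ (abs_nonneg _) (norm_le_pi_norm (y - p) i) 2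
    _ = _ := by simp

lemma pd1_esq (p y : Fin d → ℝ) (k : Fin d) : pd1 (esq p) y k = 2 * (y k - p k) := by
  have e : esq p = fun y => ∑ i, (y i - p i) ^ 2 := rfl
  rw [e, pd1_sum _ (fun i => by fun_prop)]
  have : ∀ i, pd1 (fun y : Fin d → ℝ => (y i - p i) ^ 2) y k = if i = k then 2 * (y i - p i) else 0 := by
    intro i
    have e2 : (fun y : Fin d → ℝ => (y i - p i) ^ 2) = fun y => (y i - p i) * (y i - p i) := by
      funext y; ring
    rw [e2, pd1_mul (by fun_prop) (by fun_prop), pd1_sub (by fun_prop) (by fun_prop), pd1_coord, pd1_const]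
    split_ifs <;> ring
  simp_rw [this]
  simp

lemma pd1_comp {G : ℝ → ℝ} {G1 : ℝ} {s : (Fin d → ℝ) → ℝ} {y : Fin d → ℝ} (hs : DifferentiableAt ℝ s y)
    (hG : HasDerivAt G G1 (s y)) (k : Fin d) : pd1 (fun y => G (s y)) y k = G1 * pd1 s y k := by
  unfold pd1
  have := hG.comp_hasFDerivAt y hs.hasFDerivAt
  have e := this.fderiv
  simp only [Function.comp_def] at e
  rw [e]; simp

lemma pd1_rad {G G1 : ℝ → ℝ} (h1 : ∀ t, 0 ≤ t → HasDerivAt G (G1 t) t) (p y : Fin d → ℝ) (k : Fin d) :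
    pd1 (fun y => G (esq p y)) y k = G1 (esq p y) * (2 * (y k - p k)) := by
  rw [pd1_comp ((esq_contDiff (n := 1) p).differentiable (by norm_num) y) (h1 _ (esq_nonneg p y)), pd1_esq]

lemma pd2_rad {G G1 G2 : ℝ → ℝ} (h1 : ∀ t, 0 ≤ t → HasDerivAt G (G1 t) t) (h2 : ∀ t, 0 ≤ t → HasDerivAt G1 (G2 t) t)
    (p y : Fin d → ℝ) (k l : Fin d) :
    pd2 (fun y => G (esq p y)) y k l = 4 * G2 (esq p y) * ((y k - p k) * (y l - p l)) +
      if k = l then 2 * G1 (esq p y) else 0 := by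
  rw [pd2_eq]
  simp_rw [pd1_rad h1]
  have hd : Differentiable ℝ (fun y : Fin d → ℝ => G1 (esq p y)) := fun z =>
    ((h2 _ (esq_nonneg p z)).comp_hasFDerivAt z
      ((esq_contDiff (n := 1) p).differentiable (by norm_num) z).hasFDerivAt).differentiableAt
  rw [pd1_mul hd (by fun_prop), pd1_rad h2, pd1_cmul (u := fun y : Fin d → ℝ => y l - p l) (by fun_prop), pd1_sub (by fun_prop) (by fun_prop), pd1_coord, pd1_const]
  by_cases h : k = l
  · subst h; simp; ring
  · simp [h, Ne.symm h]; ring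

lemma genL_rad {G G1 G2 : ℝ → ℝ} (h1 : ∀ t, 0 ≤ t → HasDerivAt G (G1 t) t) (h2 : ∀ t, 0 ≤ t → HasDerivAt G1 (G2 t) t)
    (f : (Fin d → ℝ) → Fin d → ℝ) (a : (Fin d → ℝ) → Fin d → Fin d → ℝ) (p y : Fin d → ℝ) :
    genL f a (fun y => G (esq p y)) y = 2 * G1 (esq p y) * (∑ i, f y i * (y i - p i) + ∑ i, a y i i) +
      4 * G2 (esq p y) * ∑ i, ∑ j, (y i - p i) * a y i j * (y j - p j) := by
  unfold genL
  simp_rw [pd1_rad h1, pd2_rad h1 h2, mul_add, Finset.sum_add_distrib]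
  simp only [mul_ite, mul_zero, Finset.sum_ite_eq, Finset.mem_univ, if_true]
  rw [Finset.mul_sum, Finset.mul_sum, Finset.mul_sum]
  simp_rw [Finset.mul_sum]
  have e1 : ∀ i, f y i * (G1 (esq p y) * (2 * (y i - p i))) = 2 * G1 (esq p y) * (f y i * (y i - p i)) := fun i => by ring
  have e2 : ∀ i, a y i i * (2 * G1 (esq p y)) = 2 * G1 (esq p y) * a y i i := fun i => by ring
  have e3 : ∀ i j, a y i j * (4 * G2 (esq p y) * ((y i - p i) * (y j - p j))) =
    4 * G2 (esq p y) * ((y i - p i) * a y i j * (y j - p j)) := fun i j => by ring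
  simp_rw [e1, e2, e3]
  ring

end MaxP

section MaxQ
open Filter Topology

variable {d : ℕ}

/-- the Lyapunov function -/
def VV (y : Fin d → ℝ) : ℝ := 1 + esq 0 y

lemma VV_ge_one (y : Fin d → ℝ) : 1 ≤ VV y := by
  have := esq_nonneg 0 y; unfold VV; linarith

lemma VV_pos (y : Fin d → ℝ) : 0 < VV y := one_pos.trans_le (VV_ge_one y)

lemma VV_ge (y : Fin d → ℝ) : 1 + ‖y‖ ^ 2 ≤ VV y := by
  have := esq_ge 0 y; rw [sub_zero] at this; unfold VV; linarith

lemma VV_le (y : Fin d → ℝ) : VV y ≤ 1 + d * ‖y‖ ^ 2 := by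
  have := esq_le 0 y; rw [sub_zero] at this; unfold VV; linarith

lemma VV_contDiff {n : WithTop ℕ∞} (m : ℕ) : ContDiff ℝ n (fun y : Fin d → ℝ => VV y ^ m) := by
  have : ContDiff ℝ n (VV : (Fin d → ℝ) → ℝ) := contDiff_const.add (esq_contDiff 0)
  exact this.pow m

lemma quad_form_le {Λ : ℝ} {A : Fin d → Fin d → ℝ} (hA : ∀ i j, |A i j| ≤ Λ) (y : Fin d → ℝ) :
    |∑ i, ∑ j, y i * A i j * y j| ≤ d * (d * (Λ * ‖y‖ ^ 2)) :=
  abs_sum_le_card fun i => abs_sum_le_card fun j => by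
    have hΛ : 0 ≤ Λ := (abs_nonneg _).trans (hA i j)
    rw [abs_mul, abs_mul]
    have h1 := norm_le_pi_norm y i
    have h2 := norm_le_pi_norm y j
    rw [Real.norm_eq_abs] at h1 h2
    calc |y i| * |A i j| * |y j| ≤ ‖y‖ * Λ * ‖y‖ := by gcongr; exact hA i j
      _ = _ := by ring

lemma genL_VV {Λ : ℝ} {f : (Fin d → ℝ) → Fin d → ℝ} {a : (Fin d → ℝ) → Fin d → Fin d → ℝ} {y : Fin d → ℝ}
    (ha : ∀ i j, |a y i j| ≤ Λ) {F : ℝ} (hf : ∑ i, f y i * y i ≤ F) (hΛ : 0 ≤ Λ) (m : ℕ) :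
    genL f a (fun y => VV y ^ (m + 1)) y ≤ 2 * (m + 1) * VV y ^ m * (F + d * Λ + 2 * m * d ^ 2 * Λ) := by
  have h1 : ∀ t : ℝ, 0 ≤ t → HasDerivAt (fun t : ℝ => (1 + t) ^ (m + 1)) ((m + 1) * (1 + t) ^ m) t := fun t _ => by
    have := ((hasDerivAt_id t).const_add 1).fun_pow (m + 1)
    simpa using this
  have h2 : ∀ t : ℝ, 0 ≤ t → HasDerivAt (fun t : ℝ => (m + 1) * (1 + t) ^ m) ((m + 1) * (m * (1 + t) ^ (m - 1))) t := fun t _ => by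
    have := (((hasDerivAt_id t).const_add 1).pow m).const_mul ((m:ℝ) + 1)
    simpa using this
  have e := genL_rad h1 h2 f a 0 y
  have e0 : (fun y : Fin d → ℝ => VV y ^ (m + 1)) = fun y => (fun t : ℝ => (1 + t) ^ (m + 1)) (esq 0 y) := rfl
  rw [e0, e]
  simp only [Pi.zero_apply, sub_zero]
  have hV : (1 + esq 0 y) = VV y := rfl
  rw [hV]
  have htr : ∑ i, a y i i ≤ d * Λ := (le_abs_self _).trans (abs_sum_le_card fun i => ha i i)
  have hq : ∑ i, ∑ j, y i * a y i j * y j ≤ d * (d * (Λ * VV y)) := by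
    refine (le_abs_self _).trans ((quad_form_le ha y).trans ?_)
    have := VV_ge y
    gcongr; linarith
  have hVp := VV_pos y
  have hm : m * VV y ^ (m - 1) * VV y = m * VV y ^ m := by
    rcases Nat.eq_zero_or_pos m with h | h
    · subst h; simp
    · rw [mul_assoc, ← pow_succ, Nat.sub_add_cancel h]
  calc _ ≤ 2 * ((m + 1) * VV y ^ m) * (F + d * Λ) + 4 * ((m + 1) * (m * VV y ^ (m - 1))) * (d * (d * (Λ * VV y))) := by
        gcongr
    _ = 2 * ((m + 1) * VV y ^ m) * (F + d * Λ) + 4 * ((m + 1) * (m * VV y ^ (m - 1) * VV y)) * (d * (d * Λ)) := by ring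
    _ = _ := by rw [hm]; ring

/-- coefficient class -/
structure Cl (α lm Λ β : ℝ) (f : (Fin d → ℝ) → Fin d → ℝ) (a : (Fin d → ℝ) → Fin d → Fin d → ℝ) : Prop where
  ell : Ell lm a
  ab : ∀ y i j, |a y i j| ≤ Λ
  fb : ∀ y i, |f y i| ≤ Λ * (1 + ‖y‖)
  ah : ∀ y y', ‖y - y'‖ ≤ 1 → ∀ i j, |a y i j - a y' i j| ≤ Λ * ‖y - y'‖ ^ α
  fh : ∀ y y', ‖y - y'‖ ≤ 1 → ∀ i, |f y i - f y' i| ≤ Λ * (1 + ‖y‖) * ‖y - y'‖ ^ α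
  dis : ∀ y, ∑ i, f y i * y i ≤ Λ - β * ‖y‖

lemma lyap {Λ β : ℝ} (hΛ : 0 ≤ Λ) (hβ : 0 < β) (m : ℕ) : ∃ R C : ℝ, 0 ≤ R ∧ 0 ≤ C ∧ ∀ (α lm : ℝ)
    (f : (Fin d → ℝ) → Fin d → ℝ) (a : (Fin d → ℝ) → Fin d → Fin d → ℝ), Cl α lm Λ β f a →
    (∀ y, R ≤ ‖y‖ → genL f a (fun y => VV y ^ (m + 1)) y ≤ - VV y ^ m) ∧
    ∀ y, genL f a (fun y => VV y ^ (m + 1)) y ≤ - VV y ^ m + C := by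
  set Cn := Λ + d * Λ + 2 * m * d ^ 2 * Λ with hCn
  have hCn0 : 0 ≤ Cn := by positivity
  set R := (Cn + 1) / β with hR
  have hR0 : 0 ≤ R := by positivity
  refine ⟨R, (2 * (m + 1) * Cn + 1) * (1 + d * R ^ 2) ^ m, hR0, by positivity, fun α lm f a h => ?_⟩
  have hL : ∀ y, genL f a (fun y => VV y ^ (m + 1)) y ≤ 2 * (m + 1) * VV y ^ m * (Cn - β * ‖y‖) := fun y => by
    have := genL_VV (h.ab y) (h.dis y) hΛ m
    refine this.trans (le_of_eq ?_)
    rw [hCn]; ring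
  have hout : ∀ y, R ≤ ‖y‖ → genL f a (fun y => VV y ^ (m + 1)) y ≤ - VV y ^ m := by
    intro y hy
    refine (hL y).trans ?_
    have hb : Cn - β * ‖y‖ ≤ -1 := by
      rw [hR, div_le_iff₀ hβ] at hy; linarith
    have hv : 0 < VV y ^ m := pow_pos (VV_pos y) m
    have hm0 : (0:ℝ) ≤ m := Nat.cast_nonneg m
    have hmv : 0 ≤ m * VV y ^ m := by positivity
    calc 2 * (m + 1) * VV y ^ m * (Cn - β * ‖y‖) ≤ 2 * (m + 1) * VV y ^ m * (-1) := by gcongr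
      _ ≤ _ := by linarith
  refine ⟨hout, fun y => ?_⟩
  rcases le_or_gt R ‖y‖ with hy | hy
  · refine (hout y hy).trans ?_
    have : 0 ≤ (2 * (m + 1) * Cn + 1) * (1 + d * R ^ 2) ^ m := by positivity
    linarith
  · have h1 := hL y
    have hv : 0 < VV y ^ m := pow_pos (VV_pos y) m
    have h2 : 2 * (m + 1) * VV y ^ m * (Cn - β * ‖y‖) ≤ 2 * (m + 1) * VV y ^ m * Cn := by
      gcongr
      have : 0 ≤ β * ‖y‖ := by positivity
      linarith
    have h3 : VV y ^ m ≤ (1 + d * R ^ 2) ^ m := by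
      refine pow_le_pow_left₀ (VV_pos y).le ((VV_le y).trans ?_) m
      gcongr
    have h4 : (2 * (m + 1) * Cn + 1) * VV y ^ m ≤ (2 * (m + 1) * Cn + 1) * (1 + d * R ^ 2) ^ m := by gcongr
    linarith

lemma VV_pow_large (c K : ℝ) (hc : 0 < c) (m p : ℕ) :
    ∃ R : ℝ, ∀ y : Fin d → ℝ, R < ‖y‖ → K * VV y ^ m < c * VV y ^ (m + p + 1) := by
  refine ⟨max 1 (|K| / c), fun y hy => ?_⟩
  have h1 : 1 < ‖y‖ := (le_max_left _ _).trans_lt hy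
  have h2 : |K| / c < ‖y‖ := (le_max_right _ _).trans_lt hy
  have h3 : ‖y‖ < VV y := by nlinarith [VV_ge y]
  rw [div_lt_iff₀ hc] at h2
  have hv := VV_pos y
  have h4 : K < c * VV y ^ (p + 1) := by
    calc K ≤ |K| := le_abs_self K
      _ < ‖y‖ * c := h2
      _ ≤ c * VV y := by nlinarith
      _ ≤ c * VV y ^ (p + 1) := by
        gcongr
        exact le_self_pow₀ (VV_ge_one y) (by simp)
  calc K * VV y ^ m < c * VV y ^ (p + 1) * VV y ^ m := by
        have := pow_pos hv m
        gcongr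
    _ = _ := by ring

/-- strong maximum principle -/
lemma strongMP {lm Λ : ℝ} {f : (Fin d → ℝ) → Fin d → ℝ} {a : (Fin d → ℝ) → Fin d → Fin d → ℝ} (ha : Ell lm a)
    (hab : ∀ y i j, |a y i j| ≤ Λ) (hΛ : 0 ≤ Λ) (hf : ∀ y i, |f y i| ≤ Λ * (1 + ‖y‖)) {lam : ℝ} (hlam : 0 ≤ lam)
    {v : (Fin d → ℝ) → ℝ} (hv : ContDiff ℝ 2 v) (hv0 : ∀ y, 0 ≤ v y)
    (hL : ∀ y, genL f a v y ≤ lam * v y) {y0 : Fin d → ℝ} (hy0 : v y0 = 0) (y1 : Fin d → ℝ) : v y1 = 0 := by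
  by_contra hne
  have hv1 : 0 < v y1 := lt_of_le_of_ne (hv0 y1) (Ne.symm hne)
  have hcq : Continuous (esq y1) := (esq_contDiff (n := 0) y1).continuous
  -- nearest zero
  obtain ⟨y2, hy2, hmin⟩ : ∃ y2, v y2 = 0 ∧ ∀ y, v y = 0 → esq y1 y2 ≤ esq y1 y := by
    set Z : Set (Fin d → ℝ) := {y | v y = 0 ∧ esq y1 y ≤ esq y1 y0} with hZ
    have hZc : IsCompact Z := by
      refine Metric.isCompact_of_isClosed_isBounded ?_ ?_
      · exact (isClosed_eq hv.continuous continuous_const).inter (isClosed_le hcq continuous_const)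
      · refine (Metric.isBounded_closedBall (x := y1) (r := 1 + esq y1 y0)).subset fun y hy => ?_
        rw [Metric.mem_closedBall, dist_eq_norm]
        have := (esq_ge y1 y).trans hy.2
        nlinarith [norm_nonneg (y - y1)]
    obtain ⟨y2, h2, hm⟩ := hZc.exists_isMinOn ⟨y0, hy0, le_rfl⟩ hcq.continuousOn
    refine ⟨y2, h2.1, fun y hy => ?_⟩
    rcases le_or_gt (esq y1 y) (esq y1 y0) with h | h
    · exact hm ⟨hy, h⟩
    · exact h2.2.trans h.le
  set ρ := esq y1 y2 with hρ
  have hρ0 : 0 < ρ := by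
    refine lt_of_le_of_ne (esq_nonneg _ _) fun h => ?_
    have h3 := esq_ge y1 y2
    rw [← hρ, ← h] at h3
    have : ‖y2 - y1‖ = 0 := by nlinarith [norm_nonneg (y2 - y1), sq_nonneg ‖y2 - y1‖]
    rw [norm_eq_zero, sub_eq_zero] at this
    rw [this] at hy2; exact hne hy2
  have hpos : ∀ y, esq y1 y < ρ → 0 < v y := fun y hy =>
    lt_of_le_of_ne (hv0 y) fun h => absurd (hmin y h.symm) (not_le.2 hy)
  -- constants
  set r := 1 + ρ with hr
  have hnr : ∀ y, esq y1 y ≤ ρ → ‖y - y1‖ ≤ r := fun y hy => by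
    have := (esq_ge y1 y).trans hy
    nlinarith [norm_nonneg (y - y1)]
  set M := d * (Λ * (1 + (‖y1‖ + r)) * r) + d * Λ with hM
  have hr0 : 0 ≤ r := by positivity
  have hM0 : 0 ≤ M := by positivity
  have hMb : ∀ y, esq y1 y ≤ ρ → ∑ i, f y i * (y i - y1 i) + ∑ i, a y i i ≤ M := by
    intro y hy
    have h1 := hnr y hy
    have h2 : ‖y‖ ≤ ‖y1‖ + r := by
      have := norm_le_norm_add_norm_sub' y y1
      linarith
    refine add_le_add ((le_abs_self _).trans (abs_sum_le_card fun i => ?_)) ((le_abs_self _).trans (abs_sum_le_card fun i => hab y i i))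
    rw [abs_mul]
    have h3 : |y i - y1 i| ≤ r := (norm_le_pi_norm (y - y1) i).trans h1
    have h4 : |f y i| ≤ Λ * (1 + (‖y1‖ + r)) := (hf y i).trans (by gcongr)
    exact mul_le_mul h4 h3 (abs_nonneg _) (by positivity)
  have hlm := ha.1
  obtain ⟨γ, hγ0, hγ⟩ : ∃ γ : ℝ, 0 < γ ∧ lam + 2 * γ * M < 4 * γ ^ 2 * (lm / 2 * (ρ / 4)) := by
    set b := lm / 2 * (ρ / 4) with hb
    have hb0 : 0 < b := by positivity
    set γ := (lam + 2 * M) / b + 1 with hγd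
    have hγ1 : 1 ≤ γ := by
      have : 0 ≤ (lam + 2 * M) / b := by positivity
      linarith
    refine ⟨γ, by linarith, ?_⟩
    have e1 : γ * b = lam + 2 * M + b := by rw [hγd]; field_simp
    have e2 : 4 * γ ^ 2 * b = 4 * γ * (lam + 2 * M + b) := by rw [← e1]; ring
    rw [e2]
    have e3 : lam ≤ γ * lam := le_mul_of_one_le_left hlam hγ1
    have e4 : 0 ≤ γ * M := by positivity
    have e5 : 0 < γ * b := by positivity
    have e6 : 0 ≤ γ * lam := by positivity
    nlinarith
  set G : ℝ → ℝ := fun t => Real.exp (-γ * t) with hG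
  have hG1 : ∀ t : ℝ, 0 ≤ t → HasDerivAt G (-γ * Real.exp (-γ * t)) t := fun t _ => by
    have := ((hasDerivAt_id t).const_mul (-γ)).exp
    simp only [id, mul_one] at this
    exact this.congr_deriv (by ring)
  have hG2 : ∀ t : ℝ, 0 ≤ t → HasDerivAt (fun t => -γ * Real.exp (-γ * t)) (γ ^ 2 * Real.exp (-γ * t)) t := fun t ht => by
    have := (hG1 t ht).const_mul (-γ)
    exact this.congr_deriv (by ring)
  set h : (Fin d → ℝ) → ℝ := fun y => G (esq y1 y) - Real.exp (-γ * ρ) with hh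
  have hGc : ContDiff ℝ 2 (fun y => G (esq y1 y)) := by
    have := esq_contDiff (d := d) (n := 2) y1
    simp only [hG]; fun_prop
  have hhc : ContDiff ℝ 2 h := hGc.sub contDiff_const
  have hLh : ∀ y, ρ / 4 ≤ esq y1 y → esq y1 y ≤ ρ → lam * Real.exp (-γ * esq y1 y) < genL f a h y := by
    intro y hq1 hq2
    have e : genL f a h y = genL f a (fun y => G (esq y1 y)) y := by
      rw [hh, genL_sub f a hGc contDiff_const, genL_const, sub_zero]
    rw [e, genL_rad hG1 hG2]
    set E := Real.exp (-γ * esq y1 y)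
    have hE : 0 < E := Real.exp_pos _
    have hq : lm / 2 * (ρ / 4) ≤ ∑ i, ∑ j, (y i - y1 i) * a y i j * (y j - y1 j) := by
      have := ha.2.2 y (fun i => y i - y1 i)
      have h2 : ∑ i, (y i - y1 i) ^ 2 = esq y1 y := rfl
      rw [h2] at this
      nlinarith
    have hm := hMb y hq2
    calc lam * E < (4 * γ ^ 2 * (lm / 2 * (ρ / 4)) - 2 * γ * M) * E := by gcongr; linarith
      _ = 2 * (-γ * E) * M + 4 * (γ ^ 2 * E) * (lm / 2 * (ρ / 4)) := by ring
      _ ≤ _ := by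
        refine add_le_add ?_ (by gcongr)
        have : 0 < γ * E := by positivity
        nlinarith
  -- inner ball
  obtain ⟨m, hm0, hmin2⟩ : ∃ m, 0 < m ∧ ∀ y, esq y1 y ≤ ρ / 4 → m ≤ v y := by
    have hKc : IsCompact {y : Fin d → ℝ | esq y1 y ≤ ρ / 4} := by
      refine Metric.isCompact_of_isClosed_isBounded (isClosed_le hcq continuous_const) ?_
      refine (Metric.isBounded_closedBall (x := y1) (r := r)).subset fun y hy => ?_
      rw [Metric.mem_closedBall, dist_eq_norm]
      exact hnr y (le_trans hy (by linarith))
    obtain ⟨y3, h3, hm⟩ := hKc.exists_isMinOn ⟨y1, by simp [esq]; positivity⟩ hv.continuous.continuousOn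
    exact ⟨v y3, hpos y3 (lt_of_le_of_lt h3 (by linarith)), fun y hy => hm hy⟩
  have hh1 : ∀ y, h y ≤ 1 := fun y => by
    have : Real.exp (-γ * esq y1 y) ≤ 1 := Real.exp_le_one_iff.2 (by nlinarith [esq_nonneg y1 y])
    have := Real.exp_pos (-γ * ρ)
    simp only [hh, hG]; linarith
  have hhE : ∀ y, h y ≤ Real.exp (-γ * esq y1 y) := fun y => by
    have := Real.exp_pos (-γ * ρ)
    simp only [hh, hG]; linarith
  have hout : ∀ y, ρ ≤ esq y1 y → h y ≤ 0 := fun y hy => by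
    have : Real.exp (-γ * esq y1 y) ≤ Real.exp (-γ * ρ) := Real.exp_le_exp.2 (by nlinarith)
    simp only [hh, hG]; linarith
  set ψ : (Fin d → ℝ) → ℝ := fun y => m * h y - v y with hψ
  have hψc : ContDiff ℝ 2 ψ := (contDiff_const.mul hhc).sub hv
  have hLψ : ∀ y, genL f a ψ y = m * genL f a h y - genL f a v y := fun y => by
    rw [hψ, genL_sub f a (contDiff_const.mul hhc) hv, genL_cmul f a hhc]
  have hψ0 : ∀ y, ψ y ≤ 0 := by
    refine MP hψc f ha (R := ‖y1‖ + r) ?_ ?_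
    · intro y hy
      have : ρ ≤ esq y1 y := by
        by_contra hlt
        push Not at hlt
        have h1 := hnr y hlt.le
        have := norm_le_norm_add_norm_sub' y y1
        linarith
      have := hout y this
      simp only [hψ]; nlinarith [hv0 y]
    · intro y hy
      simp only [hψ] at hy
      have c1 : ρ / 4 ≤ esq y1 y := by
        by_contra hlt
        push Not at hlt
        have := hmin2 y hlt.le
        nlinarith [hh1 y]
      have c2 : esq y1 y ≤ ρ := by
        by_contra hlt
        push Not at hlt
        nlinarith [hout y hlt.le, hv0 y]
      rw [hLψ]
      have b1 := hLh y c1 c2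
      have b2 := hL y
      have b3 := hhE y
      have b4 : lam * v y ≤ lam * (m * h y) := by gcongr; linarith
      have b5 : m * (lam * h y) ≤ m * (lam * Real.exp (-γ * esq y1 y)) := by gcongr
      nlinarith
  have hz : ψ y2 = 0 := by simp [hψ, hh, hG, hy2, hρ]
  have hlm2 : IsLocalMax ψ y2 := Eventually.of_forall fun y => by rw [hz]; exact hψ0 y
  have := genL_nonpos hψc hlm2 f ha
  rw [hLψ] at this
  have b1 := hLh y2 (by rw [← hρ]; linarith) le_rfl
  have b2 := hL y2
  rw [hy2, mul_zero] at b2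
  have b3 : 0 ≤ lam * Real.exp (-γ * esq y1 y2) := by positivity
  nlinarith

/-- Liouville theorem -/
lemma liouvilleL {α lm Λ β : ℝ} (hΛ : 0 ≤ Λ) (hβ : 0 < β) {f : (Fin d → ℝ) → Fin d → ℝ}
    {a : (Fin d → ℝ) → Fin d → Fin d → ℝ} (h : Cl α lm Λ β f a) {lam : ℝ} (hlam : 0 ≤ lam)
    {w : (Fin d → ℝ) → ℝ} (hw : ContDiff ℝ 2 w) (hL : ∀ y, genL f a w y = lam * w y) {K : ℝ} {p : ℕ}
    (hK : ∀ y, |w y| ≤ K * VV y ^ p) (hw0 : w 0 = 0) (y : Fin d → ℝ) : w y = 0 := by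
  obtain ⟨R, C, hR, hC, hly⟩ := lyap (d := d) hΛ hβ p
  obtain ⟨hout, -⟩ := hly α lm f a h
  obtain ⟨y0, hy0, hmax⟩ := (isCompact_closedBall (0 : Fin d → ℝ) R).exists_isMaxOn
    ⟨0, by simpa using hR⟩ hw.continuous.continuousOn
  set M := w y0 with hM
  have hM0 : 0 ≤ M := by
    rw [← hw0]; exact hmax (by simpa using hR)
  have hle : ∀ ε : ℝ, 0 < ε → ∀ y, w y - M - ε * VV y ^ (p + 1) ≤ 0 := by
    intro ε hε
    obtain ⟨R1, hR1⟩ := VV_pow_large (d := d) ε K hε p 0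
    have c1 : ContDiff ℝ 2 (fun y : Fin d → ℝ => w y - M) := hw.sub contDiff_const
    have c2 : ContDiff ℝ 2 (fun y : Fin d → ℝ => ε * VV y ^ (p + 1)) := contDiff_const.mul (VV_contDiff _)
    refine MP (c1.sub c2) f h.ell (R := R1) (fun y hy => ?_) fun y hy => ?_
    · have := hR1 y hy
      have := hK y
      have := le_abs_self (w y)
      simp only [add_zero] at *
      linarith
    · rw [genL_sub f a c1 c2, genL_sub f a hw contDiff_const, genL_const, genL_cmul f a (VV_contDiff _), hL]
      have hv := pow_pos (VV_pos y) (p + 1)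
      have hv' := pow_pos (VV_pos y) p
      have hwM : M < w y := by nlinarith
      have hyR : R ≤ ‖y‖ := by
        by_contra hlt
        push Not at hlt
        have : w y ≤ M := hmax (by simpa using hlt.le)
        linarith
      have h1 := hout y hyR
      have h2 : 0 ≤ lam * w y := mul_nonneg hlam (hM0.trans hwM.le)
      nlinarith
  have hle' : ∀ y, w y ≤ M := by
    intro y
    have hl : Tendsto (fun ε : ℝ => M + ε * VV y ^ (p + 1)) (𝓝[>] 0) (𝓝 (M + 0 * VV y ^ (p + 1))) :=
      ((tendsto_id.mono_left nhdsWithin_le_nhds).mul_const _).const_add _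
    rw [zero_mul, add_zero] at hl
    refine ge_of_tendsto hl ?_
    filter_upwards [self_mem_nhdsWithin] with ε hε
    linarith [hle ε hε y]
  have key := strongMP h.ell h.ab hΛ h.fb hlam (v := fun y => M - w y) (contDiff_const.sub hw)
    (fun y => by linarith [hle' y]) (fun y => by
      rw [genL_sub f a contDiff_const hw, genL_const, hL]
      have := mul_nonneg hlam hM0
      linarith) (y0 := y0) (by simp [hM])
  have k0 := key 0
  have k1 := key y
  linarith

end MaxQ

section Lap
open Filter Topology
variable {d : ℕ}

/-- global bound -/
def GB (α b : ℝ) (u : (Fin d → ℝ) → ℝ) : Prop := ∀ R, LB α R b u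

def HN (α N : ℝ) (g : (Fin d → ℝ) → ℝ) : Prop :=
  (∀ y, |g y| ≤ N) ∧ ∀ y y', |g y - g y'| ≤ N * ‖y - y'‖ ^ α

/-- weight for the heat resolvent -/
def rho (μ : ℝ) (ω : ℝ × (Fin d → ℝ)) : ℝ := (ω.1 * Real.exp (-μ * ω.1 ^ 2)) * gs ω.2

def nuL (d : ℕ) : Measure (ℝ × (Fin d → ℝ)) := (volume.restrict (Set.Ioi (0 : ℝ))).prod volume

lemma rho_int {μ : ℝ} (hμ : 0 < μ) : Integrable (rho (d := d) μ) (nuL d) := by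
  unfold rho nuL
  refine Integrable.mul_prod (f := fun s : ℝ => s * Real.exp (-μ * s ^ 2)) (g := fun z => gs z) ?_ ?_
  · exact (integrable_mul_exp_neg_mul_sq hμ).restrict
  · simpa using gs_poly_int (d := d) 0

lemma XL_meas : Measurable (fun ω : ℝ × (Fin d → ℝ) => ω.1 • ω.2) := by fun_prop

def TL (μ : ℝ) (φ : (Fin d → ℝ) → ℝ) (y : Fin d → ℝ) : ℝ :=
  ∫ ω, φ (y + ω.1 • ω.2) * rho μ ω ∂(nuL d)

lemma TL_int {μ : ℝ} (hμ : 0 < μ) {φ : (Fin d → ℝ) → ℝ} (hφ : Continuous φ) {b : ℝ}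
    (h0 : ∀ z, |φ z| ≤ b) (y : Fin d → ℝ) :
    Integrable (fun ω => φ (y + ω.1 • ω.2) * rho μ ω) (nuL d) := by
  refine ((rho_int (d := d) hμ).norm.const_mul b).mono'
    (((hφ.measurable.comp (measurable_const.add XL_meas)).aestronglyMeasurable).mul
      (rho_int hμ).1) (Eventually.of_forall fun ω => ?_)
  rw [norm_mul]
  exact mul_le_mul_of_nonneg_right (h0 _) (norm_nonneg _)

lemma TL_bound {μ : ℝ} (hμ : 0 < μ) {φ : (Fin d → ℝ) → ℝ} {b : ℝ}
    (h0 : ∀ z, |φ z| ≤ b) (y : Fin d → ℝ) :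
    |TL μ φ y| ≤ b * ∫ ω, ‖rho (d := d) μ ω‖ ∂(nuL d) := by
  rw [← integral_const_mul, TL, ← Real.norm_eq_abs]
  refine norm_integral_le_of_norm_le ((rho_int hμ).norm.const_mul b) (Eventually.of_forall fun ω => ?_)
  rw [norm_mul]
  exact mul_le_mul_of_nonneg_right (h0 _) (norm_nonneg _)

lemma TL_eq {μ : ℝ} (hμ : 0 < μ) {φ : (Fin d → ℝ) → ℝ} (hφ : ContDiff ℝ 2 φ) {b : ℝ}
    (h0 : ∀ z, |φ z| ≤ b) (h1 : ∀ z i, |pd1 φ z i| ≤ b) (h2 : ∀ z i j, |pd2 φ z i j| ≤ b)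
    (y : Fin d → ℝ) :
    (∑ k, TL μ (fun z => pd2 φ z k k) y) - 2 * μ * TL μ φ y = - (∫ z : Fin d → ℝ, gs z) * φ y := by
  have hb : 0 ≤ b := (abs_nonneg _).trans (h0 0)
  set Δ : (Fin d → ℝ) → ℝ := fun z => ∑ k, pd2 φ z k k with hΔ
  have cΔ : Continuous Δ := continuous_finsetSum _ fun k _ => C2_pd2_cont hφ k k
  have bΔ : ∀ z, |Δ z| ≤ d * b := fun z => abs_sum_le_card fun k => h2 z k k
  have hsum : ∑ k, TL μ (fun z => pd2 φ z k k) y = TL μ Δ y := by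
    unfold TL
    rw [← integral_finsetSum _ fun k _ => TL_int hμ (C2_pd2_cont hφ k k) (fun z => h2 z k k) y]
    simp only [hΔ, Finset.sum_mul]
  have fub : ∀ (ψ : (Fin d → ℝ) → ℝ), Continuous ψ → ∀ B : ℝ, (∀ z, |ψ z| ≤ B) →
      IntegrableOn (fun s : ℝ => (s * Real.exp (-μ * s ^ 2)) * ∫ z, ψ (y + s • z) * gs z) (Set.Ioi 0) ∧
      TL μ ψ y = ∫ s in Set.Ioi (0:ℝ), (s * Real.exp (-μ * s ^ 2)) * ∫ z, ψ (y + s • z) * gs z := by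
    intro ψ hψ B hB
    have hi := TL_int hμ hψ hB y
    unfold nuL at hi
    have e : ∀ s : ℝ, (s * Real.exp (-μ * s ^ 2)) * ∫ z, ψ (y + s • z) * gs z
        = ∫ z, ψ (y + s • z) * rho μ (s, z) := by
      intro s
      rw [← integral_const_mul]
      refine integral_congr_ae (Eventually.of_forall fun z => ?_)
      simp only [rho]; ring
    constructor
    · have := hi.integral_prod_left
      refine this.congr (Eventually.of_forall fun s => ?_)
      exact (e s).symm
    · unfold TL nuL
      rw [integral_prod _ hi]
      exact integral_congr_ae (Eventually.of_forall fun s => (e s).symm)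
  obtain ⟨i1, e1⟩ := fub φ hφ.continuous b h0
  obtain ⟨i2, e2⟩ := fub Δ cΔ _ bΔ
  rw [hsum, e1, e2]
  set U : ℝ → ℝ := fun s => ∫ z, φ (y + s • z) * gs z with hU
  set W : ℝ → ℝ := fun s => ∫ z, Δ (y + s • z) * gs z with hW
  have hder : ∀ s : ℝ, HasDerivAt (fun s => Real.exp (-μ * s ^ 2) * U s)
      ((s * Real.exp (-μ * s ^ 2)) * W s - 2 * μ * ((s * Real.exp (-μ * s ^ 2)) * U s)) s := by
    intro s
    have a1 : HasDerivAt U (s * W s) s := gU_deriv hφ h0 h1 h2 y s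
    have a2 : HasDerivAt (fun s : ℝ => Real.exp (-μ * s ^ 2))
        (Real.exp (-μ * s ^ 2) * (-μ * (2 * s))) s := by
      have := ((hasDerivAt_id s).fun_pow 2).const_mul (-μ)
      simpa using this.exp
    have := a2.mul a1
    refine (this.congr_deriv ?_)
    ring
  have hIntg : IntegrableOn (fun s => (s * Real.exp (-μ * s ^ 2)) * W s -
      2 * μ * ((s * Real.exp (-μ * s ^ 2)) * U s)) (Set.Ioi 0) := i2.sub (i1.const_mul _)
  have hlim : Tendsto (fun s => Real.exp (-μ * s ^ 2) * U s) atTop (𝓝 0) := by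
    have hUb : ∀ s, |U s| ≤ b * ∫ z : Fin d → ℝ, gs z := by
      intro s
      rw [← integral_const_mul, hU, ← Real.norm_eq_abs]
      have gi : Integrable (fun z : Fin d → ℝ => gs z) := by simpa using gs_poly_int (d := d) 0
      refine norm_integral_le_of_norm_le (gi.const_mul b) (Eventually.of_forall fun z => ?_)
      rw [norm_mul, Real.norm_of_nonneg (gs_pos z).le]
      exact mul_le_mul_of_nonneg_right (h0 _) (gs_pos z).le
    have e0 : Tendsto (fun s : ℝ => Real.exp (-μ * s ^ 2)) atTop (𝓝 0) := by
      refine Real.tendsto_exp_atBot.comp ?_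
      exact (tendsto_pow_atTop (by norm_num)).const_mul_atTop_of_neg (by linarith)
    have := e0.mul_const (b * ∫ z : Fin d → ℝ, gs z)
    rw [zero_mul] at this
    refine squeeze_zero_norm (fun s => ?_) this
    rw [norm_mul, Real.norm_of_nonneg (Real.exp_pos _).le]
    exact mul_le_mul_of_nonneg_left (hUb s) (Real.exp_pos _).le
  have := integral_Ioi_of_hasDerivAt_of_tendsto' (fun s _ => hder s) hIntg hlim
  rw [integral_sub i2 (i1.const_mul _), integral_const_mul] at this
  rw [this]
  simp only [hU]
  simp [integral_const_mul, mul_comm]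

lemma holder_of_lip {α D K b : ℝ} (hα0 : 0 ≤ α) (hα : α ≤ 1) {t : ℝ} (ht : 0 ≤ t) (hK : 0 ≤ K) (hb : 0 ≤ b)
    (h1 : D ≤ K * t) (h2 : D ≤ b) : D ≤ (K + b) * t ^ α := by
  rcases le_total t 1 with h | h
  · have : t ≤ t ^ α := by
      rcases ht.eq_or_lt with rfl | h0
      · exact Real.rpow_nonneg le_rfl _
      · simpa using Real.rpow_le_rpow_of_exponent_ge h0 h hα
    have h3 := Real.rpow_nonneg ht α
    nlinarith
  · have : 1 ≤ t ^ α := Real.one_le_rpow h hα0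
    nlinarith

lemma TL_GB {μ : ℝ} (hμ : 0 < μ) {α : ℝ} (hα0 : 0 ≤ α) (hα : α ≤ 1) {φ : (Fin d → ℝ) → ℝ}
    (hφ : ContDiff ℝ 3 φ) {b : ℝ}
    (h0 : ∀ z, |φ z| ≤ b) (h1 : ∀ z i, |pd1 φ z i| ≤ b) (h2 : ∀ z i j, |pd2 φ z i j| ≤ b)
    (h3 : ∀ z i j k, |pd1 (fun z => pd2 φ z i j) z k| ≤ b) :
    ContDiff ℝ 2 (TL μ φ) ∧ (∃ B, GB α B (TL μ φ)) ∧
      ∀ y i j, pd2 (TL μ φ) y i j = TL μ (fun z => pd2 φ z i j) y := by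
  have hb : 0 ≤ b := (abs_nonneg _).trans (h0 0)
  have c2 : ContDiff ℝ 2 φ := hφ.of_le (by norm_num)
  have cp1 : ∀ i, ContDiff ℝ 2 (fun y => pd1 φ y i) := fun i =>
    C1_pd1 (n := 2) (by convert hφ using 1; norm_num) i
  have cp2 : ∀ i j, ContDiff ℝ 1 (fun y => pd2 φ y i j) := fun i j => C2_pd1 (cp1 j) i
  have t0 := TI (rho_int (d := d) hμ) XL_meas (c2.of_le (by norm_num)) h0 h1
  have t1 := fun j => TI (rho_int (d := d) hμ) XL_meas ((cp1 j).of_le (by norm_num)) (fun z => h1 z j)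
    (fun z i => h2 z i j)
  have t2 := fun i j => TI (rho_int (d := d) hμ) XL_meas (cp2 i j) (fun z => h2 z i j)
    (fun z k => h3 z i j k)
  obtain ⟨C, e1, e2⟩ := contDiff_two_of_partials (u := TL μ φ)
    (v := fun i => TL μ (fun z => pd1 φ z i)) (w := fun i j => TL μ (fun z => pd2 φ z i j))
    t0.1 (fun j => (t1 j).1) (fun i j => (t2 i j).2.1.continuous)
  refine ⟨C, ?_, e2⟩
  set M := ∫ ω, ‖rho (d := d) μ ω‖ ∂(nuL d)
  have hM : 0 ≤ M := integral_nonneg fun _ => norm_nonneg _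
  refine ⟨d * (b * M) + 2 * (b * M), fun R x _ => ?_⟩
  have hbM : 0 ≤ b * M := by positivity
  have hdM : 0 ≤ d * (b * M) := by positivity
  refine ⟨?_, fun i => ?_, fun i j => ?_, fun x' _ i j => ?_⟩
  · linarith [TL_bound hμ h0 x]
  · rw [e1]; linarith [TL_bound hμ (fun z => h1 z i) x]
  · rw [e2]; linarith [TL_bound hμ (fun z => h2 z i j) x]
  · rw [e2, e2]
    refine holder_of_lip hα0 hα (norm_nonneg _) hdM (by positivity) ?_ ?_
    · refine mvt_pd1 (φ := TL μ (fun z => pd2 φ z i j)) (s := Set.univ) (t2 i j).2.1 convex_univ hbM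
        (fun z _ k => ?_) (Set.mem_univ _) (Set.mem_univ _)
      have := (t2 i j).2.2 z k
      unfold TL
      rw [this]
      exact TL_bound hμ (fun z => h3 z i j k) z
    · refine (abs_sub _ _).trans ?_
      linarith [TL_bound hμ (fun z => h2 z i j) x, TL_bound hμ (fun z => h2 z i j) x']

lemma cs_bound {φ : (Fin d → ℝ) → ℝ} (hφ : ContDiff ℝ 3 φ) (hc : HasCompactSupport φ) :
    ∃ b, (∀ z, |φ z| ≤ b) ∧ (∀ z i, |pd1 φ z i| ≤ b) ∧ (∀ z i j, |pd2 φ z i j| ≤ b) ∧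
    (∀ z i j k, |pd1 (fun z => pd2 φ z i j) z k| ≤ b) := by
  have cs : ∀ (ψ : (Fin d → ℝ) → ℝ) i, HasCompactSupport ψ → HasCompactSupport (fun z => pd1 ψ z i) :=
    fun ψ i h => by
      have := h.fderiv ℝ
      exact this.comp_left (g := fun L : (Fin d → ℝ) →L[ℝ] ℝ => L (Pi.single i 1)) (by simp)
  have c2 : ContDiff ℝ 2 φ := hφ.of_le (by norm_num)
  have cp1 : ∀ i, ContDiff ℝ 2 (fun y => pd1 φ y i) := fun i =>
    C1_pd1 (n := 2) (by convert hφ using 1; norm_num) i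
  have cp2 : ∀ i j, ContDiff ℝ 1 (fun y => pd2 φ y i j) := fun i j => C2_pd1 (cp1 j) i
  obtain ⟨b0, h0⟩ := hc.exists_bound_of_continuous hφ.continuous
  choose b1 h1 using fun i => (cs φ i hc).exists_bound_of_continuous (cp1 i).continuous
  choose b2 h2 using fun i j => (cs _ i (cs φ j hc)).exists_bound_of_continuous (cp2 i j).continuous
  choose b3 h3 using fun i j k => (cs _ k (cs _ i (cs φ j hc))).exists_bound_of_continuous
    (C1_pd1_cont (cp2 i j) k)
  have p0 : 0 ≤ b0 := (norm_nonneg _).trans (h0 0)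
  have p1 : ∀ i, 0 ≤ b1 i := fun i => (norm_nonneg _).trans (h1 i 0)
  have p2 : ∀ i j, 0 ≤ b2 i j := fun i j => (norm_nonneg _).trans (h2 i j 0)
  have p3 : ∀ i j k, 0 ≤ b3 i j k := fun i j k => (norm_nonneg _).trans (h3 i j k 0)
  have q1 : 0 ≤ ∑ i, b1 i := Finset.sum_nonneg fun i _ => p1 i
  have q2 : 0 ≤ ∑ i, ∑ j, b2 i j := Finset.sum_nonneg fun i _ => Finset.sum_nonneg fun j _ => p2 i j
  have q3 : 0 ≤ ∑ i, ∑ j, ∑ k, b3 i j k :=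
    Finset.sum_nonneg fun i _ => Finset.sum_nonneg fun j _ => Finset.sum_nonneg fun k _ => p3 i j k
  refine ⟨b0 + ∑ i, b1 i + ∑ i, ∑ j, b2 i j + ∑ i, ∑ j, ∑ k, b3 i j k, fun z => ?_, fun z i => ?_,
    fun z i j => ?_, fun z i j k => ?_⟩
  · have := h0 z; rw [Real.norm_eq_abs] at this; linarith
  · have := h1 i z; rw [Real.norm_eq_abs] at this
    have := Finset.single_le_sum (f := b1) (fun i _ => p1 i) (Finset.mem_univ i)
    linarith
  · have := h2 i j z; rw [Real.norm_eq_abs] at this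
    have a1 := Finset.single_le_sum (f := b2 i) (fun j _ => p2 i j) (Finset.mem_univ j)
    have a2 := Finset.single_le_sum (f := fun i => ∑ j, b2 i j)
      (fun i _ => Finset.sum_nonneg fun j _ => p2 i j) (Finset.mem_univ i)
    simp only [pd2_eq] at this ⊢
    linarith
  · have := h3 i j k z; rw [Real.norm_eq_abs] at this
    have a1 := Finset.single_le_sum (f := b3 i j) (fun k _ => p3 i j k) (Finset.mem_univ k)
    have a2 := Finset.single_le_sum (f := fun j => ∑ k, b3 i j k)
      (fun j _ => Finset.sum_nonneg fun k _ => p3 i j k) (Finset.mem_univ j)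
    have a3 := Finset.single_le_sum (f := fun i => ∑ j, ∑ k, b3 i j k)
      (fun i _ => Finset.sum_nonneg fun j _ => Finset.sum_nonneg fun k _ => p3 i j k)
      (Finset.mem_univ i)
    simp only [pd2_eq] at this ⊢
    linarith

lemma genL_lap (c0 : ℝ) (u : (Fin d → ℝ) → ℝ) (y : Fin d → ℝ) :
    genL (fun _ _ => 0) (fun _ i j => if i = j then c0 else 0) u y = c0 * ∑ k, pd2 u y k k := by
  simp [genL, Finset.mul_sum]

/-- base case with nice data -/
lemma base_smooth {c0 lam : ℝ} (hc : 0 < c0) (hl : 0 < lam) {α : ℝ} (hα0 : 0 ≤ α) (hα : α ≤ 1)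
    {g : (Fin d → ℝ) → ℝ} (hg : ContDiff ℝ 3 g) (hs : HasCompactSupport g) :
    ∃ u, ContDiff ℝ 2 u ∧ (∃ b, GB α b u) ∧ ∀ y,
      genL (fun _ _ => 0) (fun _ i j => if i = j then c0 else 0) u y - lam * u y = g y := by
  obtain ⟨b, h0, h1, h2, h3⟩ := cs_bound hg hs
  have hμ : 0 < lam / (2 * c0) := by positivity
  set I0 := ∫ z : Fin d → ℝ, gs z with hI0
  have hI : 0 < I0 := gI_zero_pos
  set κ := - (1 / (c0 * I0)) with hκ
  obtain ⟨C, ⟨B, hB⟩, e2⟩ := TL_GB hμ hα0 hα (φ := fun z => κ * g z) (contDiff_const.mul hg)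
    (b := |κ| * b)
    (fun z => by rw [abs_mul]; exact mul_le_mul_of_nonneg_left (h0 z) (abs_nonneg _))
    (fun z i => by
      rw [pd1_cmul (hg.differentiable (by norm_num)), abs_mul]
      exact mul_le_mul_of_nonneg_left (h1 z i) (abs_nonneg _))
    (fun z i j => by
      rw [pd2_cmul (hg.of_le (by norm_num)), abs_mul]
      exact mul_le_mul_of_nonneg_left (h2 z i j) (abs_nonneg _))
    (fun z i j k => by
      have : (fun z => pd2 (fun z => κ * g z) z i j) = fun z => κ * pd2 g z i j := by
        funext z; rw [pd2_cmul (hg.of_le (by norm_num))]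
      have cp1 : ∀ i, ContDiff ℝ 2 (fun y => pd1 g y i) := fun i =>
        C1_pd1 (n := 2) (by convert hg using 1; norm_num) i
      rw [this, pd1_cmul (u := fun z => pd2 g z i j) (C2_pd1_diff (cp1 j) i), abs_mul]
      exact mul_le_mul_of_nonneg_left (h3 z i j k) (abs_nonneg _))
  refine ⟨_, C, ⟨B, hB⟩, fun y => ?_⟩
  rw [genL_lap]
  simp_rw [e2]
  have := TL_eq hμ (φ := fun z => κ * g z) (contDiff_const.mul (hg.of_le (by norm_num)))
    (b := |κ| * b)
    (fun z => by rw [abs_mul]; exact mul_le_mul_of_nonneg_left (h0 z) (abs_nonneg _))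
    (fun z i => by
      rw [pd1_cmul (hg.differentiable (by norm_num)), abs_mul]
      exact mul_le_mul_of_nonneg_left (h1 z i) (abs_nonneg _))
    (fun z i j => by
      rw [pd2_cmul (hg.of_le (by norm_num)), abs_mul]
      exact mul_le_mul_of_nonneg_left (h2 z i j) (abs_nonneg _)) y
  rw [← hI0] at this
  have h4 : c0 * (- I0 * (κ * g y)) = g y := by rw [hκ]; field_simp
  rw [← h4, ← this]
  field_simp

end Lap

section Apri
open Filter Topology
variable {d : ℕ}

lemma HN_nonneg {α N : ℝ} {g : (Fin d → ℝ) → ℝ} (h : HN α N g) : 0 ≤ N :=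
  (abs_nonneg _).trans (h.1 0)

lemma HN_cont {α N : ℝ} (hα : 0 < α) {g : (Fin d → ℝ) → ℝ} (h : HN α N g) : Continuous g := by
  rw [continuous_iff_continuousAt]
  intro x
  have h1 : Tendsto (fun y => N * ‖y - x‖ ^ α) (𝓝 x) (𝓝 0) := by
    have : Continuous (fun y : Fin d → ℝ => N * ‖y - x‖ ^ α) := by
      have := hα.le
      fun_prop (disch := assumption)
    have h2 := this.tendsto x
    simpa [Real.zero_rpow hα.ne'] using h2
  rw [ContinuousAt, tendsto_iff_dist_tendsto_zero]
  refine squeeze_zero (fun _ => dist_nonneg) (fun y => ?_) h1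
  rw [Real.dist_eq]
  exact h.2 y x

lemma lip_min {t α : ℝ} (ht : 0 ≤ t) (hα0 : 0 ≤ α) (hα : α ≤ 1) : min 1 t ≤ t ^ α := by
  have := holder_of_lip (D := min 1 t) (K := 1) (b := 0) hα0 hα ht (by norm_num) le_rfl
  rcases le_total t 1 with h | h
  · rw [min_eq_right h]
    rcases ht.eq_or_lt with rfl | h0
    · exact Real.rpow_nonneg le_rfl _
    · simpa using Real.rpow_le_rpow_of_exponent_ge h0 h hα
  · rw [min_eq_left h]
    exact Real.one_le_rpow h hα0

open scoped Convolution in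
lemma smooth_approx {α N : ℝ} (hα : 0 < α) (hα1 : α ≤ 1) {g : (Fin d → ℝ) → ℝ} (h : HN α N g) :
    ∃ gn : ℕ → (Fin d → ℝ) → ℝ, (∀ n, ContDiff ℝ 3 (gn n) ∧ HasCompactSupport (gn n) ∧
      HN α (2 * N) (gn n)) ∧ ∀ y, Tendsto (fun n => gn n y) atTop (𝓝 (g y)) := by
  have hN := HN_nonneg h
  have gc := HN_cont hα h
  -- cutoff
  set χ : ℕ → (Fin d → ℝ) → ℝ := fun n y => max 0 (1 - ‖y‖ / (n + 1)) with hχ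
  have χ0 : ∀ n y, 0 ≤ χ n y := fun n y => le_max_left _ _
  have χ1 : ∀ n y, χ n y ≤ 1 := fun n y => max_le zero_le_one (by
    have : 0 ≤ ‖y‖ / ((n:ℝ) + 1) := by positivity
    linarith)
  have χL : ∀ n y y', |χ n y - χ n y'| ≤ min 1 ‖y - y'‖ := by
    intro n y y'
    refine le_min ?_ ?_
    · rw [abs_le]; constructor <;> linarith [χ0 n y, χ1 n y, χ0 n y', χ1 n y']
    · have e : (1 - ‖y‖ / ((n:ℝ) + 1)) - (1 - ‖y'‖ / (n + 1)) = -((‖y‖ - ‖y'‖) / (n + 1)) := by ring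
      have h1 := abs_max_sub_max_le_abs (1 - ‖y‖ / ((n:ℝ) + 1)) (1 - ‖y'‖ / ((n:ℝ) + 1)) 0
      rw [e, abs_neg, abs_div, abs_of_pos (by positivity : (0:ℝ) < n + 1), max_comm, max_comm _ (0:ℝ)] at h1
      have h2 : |‖y‖ - ‖y'‖| / ((n:ℝ) + 1) ≤ |‖y‖ - ‖y'‖| :=
        div_le_self (abs_nonneg _) (by linarith [(Nat.cast_nonneg n : (0:ℝ) ≤ n)])
      exact (h1.trans h2).trans (abs_norm_sub_norm_le y y')
  set G : ℕ → (Fin d → ℝ) → ℝ := fun n y => χ n y * g y with hG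
  have GH : ∀ n, HN α (2 * N) (G n) := by
    intro n
    refine ⟨fun y => ?_, fun y y' => ?_⟩
    · simp only [hG]; rw [abs_mul, abs_of_nonneg (χ0 n y)]
      nlinarith [h.1 y, χ0 n y, χ1 n y, abs_nonneg (g y)]
    · have e : G n y - G n y' = χ n y * (g y - g y') + (χ n y - χ n y') * g y' := by simp only [hG]; ring
      rw [e]
      refine (abs_add_le _ _).trans ?_
      rw [abs_mul, abs_mul, abs_of_nonneg (χ0 n y)]
      have a1 := h.2 y y'
      have a2 := h.1 y'
      have a3 := (χL n y y').trans (lip_min (norm_nonneg _) hα.le hα1)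
      have a4 : χ n y * |g y - g y'| ≤ 1 * (N * ‖y - y'‖ ^ α) :=
        mul_le_mul (χ1 n y) a1 (abs_nonneg _) (by norm_num)
      have a5 : |χ n y - χ n y'| * |g y'| ≤ ‖y - y'‖ ^ α * N :=
        mul_le_mul a3 a2 (abs_nonneg _) (Real.rpow_nonneg (norm_nonneg _) _)
      linarith
  have Gc : ∀ n, Continuous (G n) := fun n => HN_cont hα (GH n)
  have Gs : ∀ n, HasCompactSupport (G n) := by
    intro n
    refine HasCompactSupport.intro (isCompact_closedBall (0 : Fin d → ℝ) (n + 1)) fun x hx => ?_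
    simp only [hG, hχ]
    have : (n:ℝ) + 1 < ‖x‖ := by simpa using hx
    rw [max_eq_left, zero_mul]
    rw [sub_nonpos, le_div_iff₀ (by positivity)]
    linarith
  set φ : ℕ → ContDiffBump (0 : Fin d → ℝ) := fun n =>
    ⟨1 / (n + 1) / 2, 1 / (n + 1), by positivity, by
      have : (0:ℝ) < 1 / (n + 1) := by positivity
      linarith⟩ with hφ
  refine ⟨fun n => (φ n).normed volume ⋆[ContinuousLinearMap.lsmul ℝ ℝ, volume] G n, fun n => ⟨?_, ?_, ?_, ?_⟩, fun y => ?_⟩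
  · exact (φ n).hasCompactSupport_normed.contDiff_convolution_left _ (φ n).contDiff_normed
      (Gc n).locallyIntegrable
  · exact (φ n).hasCompactSupport_normed.convolution _ (Gs n)
  · intro y
    beta_reduce
    rw [convolution_def]
    have : 2 * N = ∫ t, (φ n).normed volume t * (2 * N) := by
      rw [integral_mul_const, (φ n).integral_normed, one_mul]
    rw [this, ← Real.norm_eq_abs]
    refine norm_integral_le_of_norm_le ((φ n).integrable_normed.mul_const _) (Eventually.of_forall fun t => ?_)
    simp only [ContinuousLinearMap.lsmul_apply, smul_eq_mul, norm_mul]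
    rw [Real.norm_of_nonneg ((φ n).nonneg_normed _)]
    exact mul_le_mul_of_nonneg_left ((GH n).1 _) ((φ n).nonneg_normed _)
  · intro y y'
    beta_reduce
    rw [convolution_def, convolution_def]
    have hi : ∀ y, Integrable (fun t => ContinuousLinearMap.lsmul ℝ ℝ ((φ n).normed volume t) (G n (y - t))) := by
      intro y
      refine ((φ n).integrable_normed.mul_const (2 * N)).mono' ?_ (Eventually.of_forall fun t => ?_)
      · simp only [ContinuousLinearMap.lsmul_apply, smul_eq_mul]
        exact (((φ n).contDiff_normed (n := 0)).continuous.mul ((Gc n).comp (by fun_prop))).aestronglyMeasurable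
      · simp only [ContinuousLinearMap.lsmul_apply, smul_eq_mul, norm_mul]
        rw [Real.norm_of_nonneg ((φ n).nonneg_normed _)]
        exact mul_le_mul_of_nonneg_left ((GH n).1 _) ((φ n).nonneg_normed _)
    rw [← integral_sub (hi y) (hi y')]
    have : 2 * N * ‖y - y'‖ ^ α = ∫ t, (φ n).normed volume t * (2 * N * ‖y - y'‖ ^ α) := by
      rw [integral_mul_const, (φ n).integral_normed, one_mul]
    rw [this, ← Real.norm_eq_abs]
    refine norm_integral_le_of_norm_le ((φ n).integrable_normed.mul_const _) (Eventually.of_forall fun t => ?_)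
    simp only [ContinuousLinearMap.lsmul_apply, smul_eq_mul]
    rw [← mul_sub, norm_mul, Real.norm_of_nonneg ((φ n).nonneg_normed _)]
    refine mul_le_mul_of_nonneg_left ?_ ((φ n).nonneg_normed _)
    have := (GH n).2 (y - t) (y' - t)
    rwa [sub_sub_sub_cancel_right] at this
  · have b1 : ∀ n, |(((φ n).normed volume ⋆[ContinuousLinearMap.lsmul ℝ ℝ, volume] G n) : (Fin d → ℝ) → ℝ) y - G n y|
        ≤ 2 * N * (1 / ((n:ℝ) + 1)) ^ α := by
      intro n
      rw [← Real.dist_eq]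
      refine (φ n).dist_normed_convolution_le (Gc n).aestronglyMeasurable fun x hx => ?_
      rw [Real.dist_eq]
      refine ((GH n).2 x y).trans ?_
      have : ‖x - y‖ ≤ 1 / ((n:ℝ) + 1) := by
        have := (mem_ball_iff_norm.1 hx).le
        simpa [hφ] using this
      have := Real.rpow_le_rpow (norm_nonneg _) this hα.le
      have h2 : 0 ≤ 2 * N := by positivity
      exact mul_le_mul_of_nonneg_left this h2
    have l1 : Tendsto (fun n : ℕ => 2 * N * (1 / ((n:ℝ) + 1)) ^ α) atTop (𝓝 0) := by
      have := (tendsto_one_div_add_atTop_nhds_zero_nat (𝕜 := ℝ)).rpow_const (p := α) (Or.inr hα.le)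
      rw [Real.zero_rpow hα.ne'] at this
      simpa using this.const_mul (2 * N)
    have l2 : Tendsto (fun n => G n y) atTop (𝓝 (g y)) := by
      have l3 : Tendsto (fun n => χ n y) atTop (𝓝 1) := by
        have l4 : Tendsto (fun n : ℕ => 1 - ‖y‖ / ((n:ℝ) + 1)) atTop (𝓝 1) := by
          have := ((tendsto_one_div_add_atTop_nhds_zero_nat (𝕜 := ℝ)).const_mul ‖y‖).const_sub 1
          simpa [div_eq_mul_inv] using this
        simpa [hχ] using (tendsto_const_nhds (x := (0:ℝ))).max l4
      simpa using l3.mul_const (g y)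
    have l5 := squeeze_zero_norm (f := fun n => (((φ n).normed volume ⋆[ContinuousLinearMap.lsmul ℝ ℝ, volume] G n) : (Fin d → ℝ) → ℝ) y - G n y) b1 l1
    simpa using l5.add l2

/-- bounded coefficients -/
structure BC (α lm Λ : ℝ) (f : (Fin d → ℝ) → Fin d → ℝ) (a : (Fin d → ℝ) → Fin d → Fin d → ℝ) : Prop where
  ell : Ell lm a
  ab : ∀ y i j, |a y i j| ≤ Λ
  fb : ∀ y i, |f y i| ≤ Λ
  ah : ∀ y y' i j, |a y i j - a y' i j| ≤ Λ * ‖y - y'‖ ^ α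
  fh : ∀ y y' i, |f y i - f y' i| ≤ Λ * ‖y - y'‖ ^ α

lemma bmp {α lm Λ lam : ℝ} (hΛ : 0 ≤ Λ) (hl : 0 < lam) {f : (Fin d → ℝ) → Fin d → ℝ}
    {a : (Fin d → ℝ) → Fin d → Fin d → ℝ} (h : BC α lm Λ f a) {u : (Fin d → ℝ) → ℝ} (hu : ContDiff ℝ 2 u)
    {b N : ℝ} (hb : ∀ y, u y ≤ b) (hN : ∀ y, -N ≤ genL f a u y - lam * u y) (y : Fin d → ℝ) :
    u y ≤ N / lam := by
  set K := (d * Λ) ^ 2 / lam ^ 2 + 2 * d * Λ / lam with hK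
  have hLV : ∀ y, genL f a (fun y => VV y ^ 1) y ≤ lam * (VV y + K) := by
    intro y
    have h1 : ∑ i, f y i * y i ≤ d * (Λ * ‖y‖) := by
      refine (le_abs_self _).trans (abs_sum_le_card fun i => ?_)
      rw [abs_mul]
      exact mul_le_mul (h.fb y i) (norm_le_pi_norm y i) (abs_nonneg _) hΛ
    have h2 := genL_VV (h.ab y) h1 hΛ 0
    have h3 := VV_ge y
    simp only [zero_add, pow_zero, Nat.cast_zero] at h2
    refine h2.trans ?_
    have e : lam * K = (d * Λ) ^ 2 / lam + 2 * d * Λ := by rw [hK]; field_simp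
    have h4 : 2 * (d * Λ) * ‖y‖ ≤ lam * ‖y‖ ^ 2 + (d * Λ) ^ 2 / lam := by
      rw [← sub_nonneg]
      have : lam * ‖y‖ ^ 2 + (d * Λ) ^ 2 / lam - 2 * (d * Λ) * ‖y‖ = (lam * ‖y‖ - d * Λ) ^ 2 / lam := by
        field_simp; ring
      rw [this]; positivity
    have h5 := mul_le_mul_of_nonneg_left h3 hl.le
    rw [mul_add lam, e]
    nlinarith
  have key : ∀ ε > 0, u y ≤ N / lam + ε * (K + VV y) := by
    intro ε hε
    have hc : ContDiff ℝ 2 (fun y : Fin d → ℝ => ε * VV y ^ 1) := contDiff_const.mul (VV_contDiff 1)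
    have hc2 : ContDiff ℝ 2 (fun z => N / lam + ε * K + ε * VV z ^ 1) := contDiff_const.add hc
    have := MP (φ := fun z => u z - (N / lam + ε * K + ε * VV z ^ 1))
      (hu.sub hc2) f h.ell
      (R := 1 + |b - N / lam - ε * K| / ε) (fun z hz => ?_) (fun z hz => ?_) y
    · simp only [pow_one] at this; linarith
    · have h1 := VV_ge z
      have h0 : 0 ≤ |b - N / lam - ε * K| / ε := by positivity
      have h2 : |b - N / lam - ε * K| / ε ≤ ‖z‖ ^ 2 := by nlinarith
      rw [div_le_iff₀ hε] at h2
      have := le_abs_self (b - N / lam - ε * K)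
      have := hb z
      rw [pow_one]
      nlinarith
    · rw [genL_sub f a hu hc2, genL_add f a (u := fun _ => N / lam + ε * K) contDiff_const hc, genL_const,
        genL_cmul f a (VV_contDiff 1)]
      have h1 := hLV z
      have h2 := hN z
      rw [pow_one] at hz
      have h3 := mul_le_mul_of_nonneg_left h1 hε.le
      have h4 := mul_pos hl hz
      have e : lam * (u z - (N / lam + ε * K + ε * VV z)) = lam * u z - N - ε * (lam * (VV z + K)) := by
        field_simp; ring
      rw [e] at h4
      linarith
  refine le_of_forall_pos_le_add fun ε hε => ?_
  have hp : 0 < |K + VV y| + 1 := by positivity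
  refine (key (ε / (|K + VV y| + 1)) (by positivity)).trans ?_
  have : ε / (|K + VV y| + 1) * (K + VV y) ≤ ε := by
    rw [div_mul_eq_mul_div, div_le_iff₀ hp]
    have := le_abs_self (K + VV y)
    nlinarith
  linarith

lemma bmp_abs {α lm Λ lam : ℝ} (hΛ : 0 ≤ Λ) (hl : 0 < lam) {f : (Fin d → ℝ) → Fin d → ℝ}
    {a : (Fin d → ℝ) → Fin d → Fin d → ℝ} (h : BC α lm Λ f a) {u : (Fin d → ℝ) → ℝ} (hu : ContDiff ℝ 2 u)
    {b N : ℝ} (hb : ∀ y, |u y| ≤ b) (hN : ∀ y, |genL f a u y - lam * u y| ≤ N) (y : Fin d → ℝ) :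
    |u y| ≤ N / lam := by
  rw [abs_le]
  constructor
  · have := bmp hΛ hl h (u := fun z => -1 * u z) (contDiff_const.mul hu) (b := b) (N := N)
      (fun z => by have := (abs_le.1 (hb z)).1; linarith)
      (fun z => by rw [genL_cmul f a hu]; have := (abs_le.1 (hN z)).2; linarith) y
    linarith
  · exact bmp hΛ hl h hu (fun z => (abs_le.1 (hb z)).2) (fun z => (abs_le.1 (hN z)).1) y

lemma apriori {α : ℝ} (hα : 0 < α) (hα1 : α < 1) {lm Λ lam : ℝ} (hlm : 0 < lm) (hΛ : 0 ≤ Λ) (hl : 0 < lam) :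
    ∃ C, 0 ≤ C ∧ ∀ f a, ∀ u g : (Fin d → ℝ) → ℝ, ∀ N, 0 < N → BC α lm Λ f a → ContDiff ℝ 2 u →
      (∃ b, GB α b u) → (∀ y, genL f a u y - lam * u y = g y) → HN α N g → GB α (C * N) u := by
  obtain ⟨C, hC, hS⟩ := schauderW (d := d) hα hα1 (c := 1) (Λ := Λ + lam) hlm (by positivity) le_rfl
  refine ⟨(2 * C + 1) * (1 + 1 / lam), by positivity, fun f a u g N hN h hu ⟨b, hb⟩ heq hg => ?_⟩
  set W := N * (1 + 1 / lam) with hW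
  have hNW : N ≤ W := by rw [hW]; nlinarith [(by positivity : 0 < 1 / lam)]
  have hWp : 0 < W := hN.trans_le hNW
  have ub : ∀ y, |u y| ≤ W := by
    intro y
    have := bmp_abs hΛ hl h hu (b := b) (N := N) (fun z => (hb ‖z‖ z le_rfl).1)
      (fun z => by rw [heq]; exact hg.1 z) y
    refine this.trans ?_
    rw [hW, mul_add, mul_one_div]; linarith
  have hrp : ∀ z z' : Fin d → ℝ, 0 ≤ ‖z - z'‖ ^ α := fun z z' => Real.rpow_nonneg (norm_nonneg _) _
  have hw : Wh α lm (Λ + lam) 1 f a lam u g (fun _ => 1) (fun _ => W) :=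
    { r0 := fun _ => one_pos
      r1 := fun _ => le_rfl
      rr := fun _ _ _ => by norm_num
      WW := fun _ _ _ => by simp
      W0 := ⟨W, hWp, fun _ => le_rfl⟩
      cf := fun y z _ => by
        simp only [one_smul, one_mul]
        refine ⟨h.ell.2.1 _, h.ell.2.2 _, fun i j => ?_, fun i => ?_, fun z' _ => ⟨fun i j => ?_, fun i => ?_⟩⟩
        · linarith [h.ab (y + z) i j]
        · linarith [h.fb (y + z) i]
        · have := h.ah (y + z) (y + z') i j
          rw [add_sub_add_left_eq_sub] at this
          nlinarith [hrp z z']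
        · have := h.fh (y + z) (y + z') i
          rw [add_sub_add_left_eq_sub] at this
          nlinarith [hrp z z']
      hlam := fun _ => by rw [one_pow, one_mul, abs_of_pos hl]; linarith
      c2 := hu
      hol := ⟨b, fun z z' i j => (hb (max ‖z‖ ‖z'‖) z (le_max_left _ _)).2.2.2 z' (le_max_right _ _) i j⟩
      bu := fun y z _ => ub _
      bg := fun y z z' _ _ => by
        simp only [one_pow, one_mul, one_smul]
        have := hg.2 (y + z) (y + z')
        rw [add_sub_add_left_eq_sub] at this
        exact this.trans (mul_le_mul_of_nonneg_right hNW (hrp z z'))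
      eq := heq }
  have hS' := hS f a lam u g _ _ hw
  simp only [one_pow, one_mul, one_smul] at hS'
  have hCW : 0 ≤ C * W := by positivity
  have e : (2 * C + 1) * (1 + 1 / lam) * N = 2 * (C * W) + W := by rw [hW]; ring
  rw [e]
  intro R x _
  refine ⟨?_, fun i => ?_, fun i j => ?_, fun x' _ i j => ?_⟩
  · linarith [ub x]
  · linarith [(hS' x).2.2 i]
  · linarith [(hS' x).2.1 i j]
  · rcases le_total ‖x - x'‖ 1 with h1 | h1
    · have := (hS' x).1 0 (x' - x) (by simp) (by rwa [norm_sub_rev]) i j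
      rw [add_zero, add_sub_cancel, zero_sub, norm_neg, norm_sub_rev] at this
      nlinarith [hrp x x']
    · have h2 : 1 ≤ ‖x - x'‖ ^ α := Real.one_le_rpow h1 hα.le
      have := (abs_sub (pd2 u x i j) (pd2 u x' i j)).trans (add_le_add ((hS' x).2.1 i j) ((hS' x').2.1 i j))
      nlinarith

lemma genL_tendsto {ι : Type*} {l : Filter ι} {fn : ι → Fin d → ℝ}
    {an : ι → Fin d → Fin d → ℝ} {f : (Fin d → ℝ) → Fin d → ℝ} {a : (Fin d → ℝ) → Fin d → Fin d → ℝ}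
    {un : ι → (Fin d → ℝ) → ℝ} {u : (Fin d → ℝ) → ℝ} {y : Fin d → ℝ}
    (hf : ∀ i, Tendsto (fun n => fn n i) l (𝓝 (f y i)))
    (ha : ∀ i j, Tendsto (fun n => an n i j) l (𝓝 (a y i j)))
    (h1 : ∀ i, Tendsto (fun n => pd1 (un n) y i) l (𝓝 (pd1 u y i)))
    (h2 : ∀ i j, Tendsto (fun n => pd2 (un n) y i j) l (𝓝 (pd2 u y i j))) :
    Tendsto (fun n => (∑ i, fn n i * pd1 (un n) y i) + ∑ i, ∑ j, an n i j * pd2 (un n) y i j) l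
      (𝓝 (genL f a u y)) := by
  unfold genL
  exact (tendsto_finsetSum _ fun i _ => (hf i).mul (h1 i)).add
    (tendsto_finsetSum _ fun i _ => tendsto_finsetSum _ fun j _ => (ha i j).mul (h2 i j))

/-- solvability in the Hölder class -/
def Solv (α lam : ℝ) (f : (Fin d → ℝ) → Fin d → ℝ) (a : (Fin d → ℝ) → Fin d → Fin d → ℝ) : Prop :=
  ∀ g : (Fin d → ℝ) → ℝ, ∀ N, 0 < N → HN α N g → ∃ u, ContDiff ℝ 2 u ∧ (∃ b, GB α b u) ∧
    ∀ y, genL f a u y - lam * u y = g y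

/-- approximate solvability suffices -/
lemma solv_limit {α lam : ℝ} (hα : 0 < α) {f : (Fin d → ℝ) → Fin d → ℝ}
    {a : (Fin d → ℝ) → Fin d → Fin d → ℝ} {g : (Fin d → ℝ) → ℝ} {gn un : ℕ → (Fin d → ℝ) → ℝ} {b : ℝ}
    (hu : ∀ n, ContDiff ℝ 2 (un n)) (hb : ∀ n, GB α b (un n))
    (he : ∀ n y, genL f a (un n) y - lam * un n y = gn n y)
    (hg : ∀ y, Tendsto (fun n => gn n y) atTop (𝓝 (g y))) :
    ∃ u, ContDiff ℝ 2 u ∧ (∃ b, GB α b u) ∧ ∀ y, genL f a u y - lam * u y = g y := by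
  set U : Ultrafilter ℕ := hyperfilter ℕ
  have hUle : (U:Filter ℕ) ≤ atTop := by rw [← Nat.cofinite_eq_atTop]; exact hyperfilter_le_cofinite
  obtain ⟨w, hw, l0, l1, l2, lb⟩ := compC U hα hu (fun R => ⟨b, Eventually.of_forall fun n => hb n R⟩)
  refine ⟨w, hw, ⟨b, fun R => lb R b (Eventually.of_forall fun n => hb n R)⟩, fun y => ?_⟩
  have t1 := (genL_tendsto (f := f) (a := a) (y := y) (fun i => tendsto_const_nhds (x := f y i))
    (fun i j => tendsto_const_nhds (x := a y i j)) (l1 y) (l2 y)).sub ((l0 y).const_mul lam)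
  refine tendsto_nhds_unique t1 ?_
  refine ((hg y).mono_left hUle).congr fun n => ?_
  exact (he n y).symm

lemma BC_lap {α lm : ℝ} (hlm : 0 < lm) : BC α lm lm (d := d) (fun _ _ => 0) (fun _ i j => if i = j then lm / 2 else 0) := by
  refine ⟨⟨hlm, fun y i j => by simp [eq_comm], fun y ξ => ?_⟩, fun y i j => ?_, fun y i => ?_, fun y y' i j => ?_, fun y y' i => ?_⟩
  · simp [Finset.mul_sum]
    exact le_of_eq (Finset.sum_congr rfl fun i _ => by ring)
  · split_ifs
    · rw [abs_of_pos (by positivity)]; linarith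
    · simpa using hlm.le
  · simpa using hlm.le
  · simp; positivity
  · simp; positivity

lemma base_solv {α : ℝ} (hα : 0 < α) (hα1 : α < 1) {lm lam : ℝ} (hlm : 0 < lm) (hl : 0 < lam) :
    Solv α lam (d := d) (fun _ _ => 0) (fun _ i j => if i = j then lm / 2 else 0) := by
  intro g N hN hg
  obtain ⟨gn, h1, h2⟩ := smooth_approx hα hα1.le hg
  obtain ⟨C, hC, hA⟩ := apriori (d := d) hα hα1 hlm hlm.le hl
  choose un c2 hb he using fun n => base_smooth (c0 := lm / 2) (by positivity) hl hα.le hα1.le (h1 n).1 (h1 n).2.1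
  exact solv_limit hα c2 (b := C * (2 * N))
    (fun n => hA _ _ _ _ _ (by positivity) (BC_lap hlm) (c2 n) (hb n) (he n) (h1 n).2.2) he h2

end Apri

section Contin
open Filter Topology
variable {d : ℕ}

lemma GB_add {α b c : ℝ} {u v : (Fin d → ℝ) → ℝ} (hu : ContDiff ℝ 2 u) (hv : ContDiff ℝ 2 v)
    (h1 : GB α b u) (h2 : GB α c v) : GB α (b + c) (fun y => u y + v y) := by
  intro R x hx
  obtain ⟨p0, p1, p2, p3⟩ := h1 R x hx
  obtain ⟨q0, q1, q2, q3⟩ := h2 R x hx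
  refine ⟨(abs_add_le _ _).trans (add_le_add p0 q0), fun i => ?_, fun i j => ?_, fun x' hx' i j => ?_⟩
  · rw [pd1_add (C2_diff hu) (C2_diff hv)]; exact (abs_add_le _ _).trans (add_le_add (p1 i) (q1 i))
  · rw [pd2_add hu hv]; exact (abs_add_le _ _).trans (add_le_add (p2 i j) (q2 i j))
  · rw [pd2_add hu hv, pd2_add hu hv, add_sub_add_comm, add_mul]
    exact (abs_add_le _ _).trans (add_le_add (p3 x' hx' i j) (q3 x' hx' i j))

lemma GB_zero {α : ℝ} : GB α 0 (fun _ : Fin d → ℝ => (0:ℝ)) := by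
  intro R x hx
  simp [pd1_const, pd2_const]

lemma mul_holder {p q p' q' P Q T A B : ℝ} (hp : |p| ≤ P) (hq : |q'| ≤ Q) (h1 : |p - p'| ≤ A * T)
    (h2 : |q - q'| ≤ B * T) (hP : 0 ≤ P) (hQ : 0 ≤ Q) : |p * q - p' * q'| ≤ (P * B + A * Q) * T := by
  have e : p * q - p' * q' = p * (q - q') + (p - p') * q' := by ring
  rw [e]
  refine (abs_add_le _ _).trans ?_
  rw [abs_mul, abs_mul]
  have a1 : |p| * |q - q'| ≤ P * (B * T) := mul_le_mul hp h2 (abs_nonneg _) hP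
  have a2 : |p - p'| * |q'| ≤ (A * T) * Q := mul_le_mul h1 hq (abs_nonneg _) ((abs_nonneg _).trans h1)
  linarith

lemma HN_genL {α Λ b : ℝ} (hα : 0 < α) (hα1 : α ≤ 1) {p : (Fin d → ℝ) → Fin d → ℝ}
    {q : (Fin d → ℝ) → Fin d → Fin d → ℝ}
    (pb : ∀ y i, |p y i| ≤ Λ) (ph : ∀ y y' i, |p y i - p y' i| ≤ Λ * ‖y - y'‖ ^ α)
    (qb : ∀ y i j, |q y i j| ≤ Λ) (qh : ∀ y y' i j, |q y i j - q y' i j| ≤ Λ * ‖y - y'‖ ^ α) (hΛ : 0 ≤ Λ)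
    {v : (Fin d → ℝ) → ℝ} (hv : ContDiff ℝ 2 v) (h : GB α b v) :
    HN α ((d + d * d) * (Λ * (d + 3)) * b) (genL p q v) := by
  have hb : 0 ≤ b := (abs_nonneg _).trans (h ‖(0 : Fin d → ℝ)‖ 0 le_rfl).1
  have v1 : ∀ y i, |pd1 v y i| ≤ b := fun y i => (h ‖y‖ y le_rfl).2.1 i
  have v2 : ∀ y i j, |pd2 v y i j| ≤ b := fun y i j => (h ‖y‖ y le_rfl).2.2.1 i j
  have v2h : ∀ y y' i j, |pd2 v y i j - pd2 v y' i j| ≤ b * ‖y - y'‖ ^ α := fun z z' i j =>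
    (h (max ‖z‖ ‖z'‖) z (le_max_left _ _)).2.2.2 z' (le_max_right _ _) i j
  have v1h : ∀ y y' i, |pd1 v y i - pd1 v y' i| ≤ (d * b + 2 * b) * ‖y - y'‖ ^ α := by
    intro y y' i
    refine holder_of_lip hα.le hα1 (norm_nonneg _) (by positivity) (by positivity) ?_ ?_
    · exact mvt_pd1 (φ := fun y => pd1 v y i) (C2_pd1_diff hv i) convex_univ hb (fun z _ k => v2 z k i)
        (Set.mem_univ _) (Set.mem_univ _)
    · refine (abs_sub _ _).trans ?_
      linarith [v1 y i, v1 y' i]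
  have hd0 : (0:ℝ) ≤ d := Nat.cast_nonneg d
  have hΛb : 0 ≤ Λ * b := by positivity
  have hdb : 0 ≤ d * (Λ * b) := by positivity
  refine ⟨fun y => ?_, fun y y' => ?_⟩
  · unfold genL
    have t1 : |∑ i, p y i * pd1 v y i| ≤ d * (Λ * (d + 3) * b) := abs_sum_le_card fun i => by
      rw [abs_mul]
      have := mul_le_mul (pb y i) (v1 y i) (abs_nonneg _) hΛ
      linarith
    have t2 : |∑ i, ∑ j, q y i j * pd2 v y i j| ≤ d * (d * (Λ * (d + 3) * b)) :=
      abs_sum_le_card fun i => abs_sum_le_card fun j => by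
        rw [abs_mul]
        have := mul_le_mul (qb y i j) (v2 y i j) (abs_nonneg _) hΛ
        linarith
    refine (abs_add_le _ _).trans ?_
    linarith
  · unfold genL
    set T := ‖y - y'‖ ^ α with hT
    have hT0 : 0 ≤ T := Real.rpow_nonneg (norm_nonneg _) _
    have t1 : |∑ i, (p y i * pd1 v y i - p y' i * pd1 v y' i)| ≤ d * (Λ * (d + 3) * b * T) :=
      abs_sum_le_card fun i => by
        have := mul_holder (pb y i) (v1 y' i) (ph y y' i) (v1h y y' i) hΛ hb
        refine this.trans (le_of_eq ?_)
        ring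
    have t2 : |∑ i, ∑ j, (q y i j * pd2 v y i j - q y' i j * pd2 v y' i j)| ≤ d * (d * (Λ * (d + 3) * b * T)) :=
      abs_sum_le_card fun i => abs_sum_le_card fun j => by
        have := mul_holder (qb y i j) (v2 y' i j) (qh y y' i j) (v2h y y' i j) hΛ hb
        refine this.trans ?_
        refine mul_le_mul_of_nonneg_right ?_ hT0
        linarith
    simp only [Finset.sum_sub_distrib] at t1 t2
    rw [add_sub_add_comm]
    refine (abs_add_le _ _).trans ?_
    linarith

lemma HN_cmul {α N : ℝ} {g : (Fin d → ℝ) → ℝ} (h : HN α N g) (c : ℝ) : HN α (|c| * N) (fun y => c * g y) := by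
  refine ⟨fun y => ?_, fun y y' => ?_⟩
  · rw [abs_mul]; exact mul_le_mul_of_nonneg_left (h.1 y) (abs_nonneg _)
  · rw [← mul_sub, abs_mul, mul_assoc]; exact mul_le_mul_of_nonneg_left (h.2 y y') (abs_nonneg _)

lemma HN_mono {α N M : ℝ} {g : (Fin d → ℝ) → ℝ} (h : HN α N g) (hM : N ≤ M) : HN α M g :=
  ⟨fun y => (h.1 y).trans hM, fun y y' => (h.2 y y').trans
    (mul_le_mul_of_nonneg_right hM (Real.rpow_nonneg (norm_nonneg _) _))⟩

/-- lemma M: solvability for bounded Hölder coefficients -/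
lemma solvM {α : ℝ} (hα : 0 < α) (hα1 : α < 1) {lm Λ lam : ℝ} (hΛ : 0 ≤ Λ) (hl : 0 < lam)
    {f : (Fin d → ℝ) → Fin d → ℝ} {a : (Fin d → ℝ) → Fin d → Fin d → ℝ} (h : BC α lm Λ f a) :
    Solv α lam f a := by
  have hlm := h.ell.1
  set a0 : (Fin d → ℝ) → Fin d → Fin d → ℝ := fun _ i j => if i = j then lm / 2 else 0 with ha0
  have hL := BC_lap (d := d) (α := α) hlm
  rw [← ha0] at hL
  set fs : ℝ → (Fin d → ℝ) → Fin d → ℝ := fun s y i => s * f y i with hfs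
  set as : ℝ → (Fin d → ℝ) → Fin d → Fin d → ℝ := fun s y i j => (1 - s) * a0 y i j + s * a y i j with has
  set Λ' := Λ + lm with hΛ'
  have conv : ∀ s x y X Y : ℝ, 0 ≤ s → s ≤ 1 → |x| ≤ X → |y| ≤ Y → |(1 - s) * x + s * y| ≤ Y + X := by
    intro s x y X Y h0 h1 hx hy
    refine (abs_add_le _ _).trans ?_
    rw [abs_mul, abs_mul, abs_of_nonneg h0, abs_of_nonneg (by linarith : 0 ≤ 1 - s)]
    nlinarith [abs_nonneg x, abs_nonneg y]
  have hBC : ∀ s, 0 ≤ s → s ≤ 1 → BC α lm Λ' (fs s) (as s) := by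
    intro s h0 h1
    have hT : ∀ y y' : Fin d → ℝ, 0 ≤ ‖y - y'‖ ^ α := fun y y' => Real.rpow_nonneg (norm_nonneg _) _
    refine ⟨⟨hlm, fun y i j => ?_, fun y ξ => ?_⟩, fun y i j => ?_, fun y i => ?_, fun y y' i j => ?_, fun y y' i => ?_⟩
    · simp only [has]; rw [hL.ell.2.1 y i j, h.ell.2.1 y i j]
    · have e1 := hL.ell.2.2 y ξ
      have e2 := h.ell.2.2 y ξ
      have e : ∑ i, ∑ j, ξ i * as s y i j * ξ j = (1 - s) * (∑ i, ∑ j, ξ i * a0 y i j * ξ j)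
          + s * ∑ i, ∑ j, ξ i * a y i j * ξ j := by
        simp only [Finset.mul_sum, ← Finset.sum_add_distrib, has]
        exact Finset.sum_congr rfl fun i _ => Finset.sum_congr rfl fun j _ => by ring
      rw [e]
      have := mul_le_mul_of_nonneg_left e1 (by linarith : 0 ≤ 1 - s)
      have := mul_le_mul_of_nonneg_left e2 h0
      linarith
    · exact conv s _ _ _ _ h0 h1 (hL.ab y i j) (h.ab y i j)
    · have := conv s _ _ _ _ h0 h1 (hL.fb y i) (h.fb y i)
      simpa [hfs] using this
    · have := conv s _ _ _ _ h0 h1 (hL.ah y y' i j) (h.ah y y' i j)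
      simp only [has, hΛ', add_mul]
      refine le_trans (le_of_eq ?_) this
      congr 1; ring
    · have := conv s _ _ _ _ h0 h1 (hL.fh y y' i) (h.fh y y' i)
      simp only [hfs, hΛ', add_mul]
      refine le_trans (le_of_eq ?_) this
      congr 1; ring
  obtain ⟨C, hC, hA⟩ := apriori (d := d) hα hα1 (Λ := Λ') hlm (by positivity) hl
  set C' : ℝ := (d + d * d) * (Λ' * (d + 3)) with hC'
  have hC'0 : 0 ≤ C' := by positivity
  set q : (Fin d → ℝ) → Fin d → Fin d → ℝ := fun y i j => a y i j - a0 y i j with hq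
  have diff : ∀ s t (v : (Fin d → ℝ) → ℝ) y, genL (fs t) (as t) v y = genL (fs s) (as s) v y + (t - s) * genL f q v y := by
    intro s t v y
    simp only [genL, hfs, has, hq, mul_add, Finset.mul_sum]
    rw [add_add_add_comm]
    have q1 : ∑ i, t * f y i * pd1 v y i = ∑ i, s * f y i * pd1 v y i + ∑ i, (t - s) * (f y i * pd1 v y i) := by
      rw [← Finset.sum_add_distrib]
      exact Finset.sum_congr rfl fun i _ => by ring
    rw [q1]
    congr 1
    rw [← Finset.sum_add_distrib]
    refine Finset.sum_congr rfl fun i _ => ?_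
    rw [← Finset.sum_add_distrib]
    exact Finset.sum_congr rfl fun j _ => by ring
  set δ := 1 / (2 * (C' * C + 1)) with hδ
  have hδp : 0 < δ := by positivity
  have step : ∀ s t, 0 ≤ s → s ≤ 1 → |t - s| ≤ δ → Solv α lam (fs s) (as s) → Solv α lam (fs t) (as t) := by
    intro s t h0 h1 hts hs g N hN hg
    have ind : ∀ k : ℕ, ∃ u e : (Fin d → ℝ) → ℝ, ContDiff ℝ 2 u ∧ GB α (2 * C * N * (1 - 1 / 2 ^ k)) u ∧
        (∀ y, genL (fs t) (as t) u y - lam * u y = g y - e y) ∧ HN α (N / 2 ^ k) e := by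
      intro k
      induction k with
      | zero =>
        refine ⟨fun _ => 0, g, contDiff_const, ?_, fun y => ?_, by simpa using hg⟩
        · simpa using GB_zero
        · rw [genL_const]; simp
      | succ k ih =>
        obtain ⟨u, e, hu, hub, heq, he⟩ := ih
        obtain ⟨v, hv, hvb, hveq⟩ := hs e (N / 2 ^ k) (by positivity) he
        have hvb' := hA _ _ _ _ _ (by positivity) (hBC s h0 h1) hv hvb hveq he
        have hn := HN_genL hα hα1.le (Λ := Λ') (p := f) (q := q)
          (fun y i => (h.fb y i).trans (by linarith))
          (fun y y' i => (h.fh y y' i).trans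
            (mul_le_mul_of_nonneg_right (by linarith) (Real.rpow_nonneg (norm_nonneg _) _)))
          (fun y i j => (abs_sub _ _).trans (add_le_add (h.ab y i j) (hL.ab y i j)))
          (fun y y' i j => by
            have : q y i j - q y' i j = a y i j - a y' i j := by simp only [hq, ha0]; ring
            rw [this]
            exact (h.ah y y' i j).trans
              (mul_le_mul_of_nonneg_right (by linarith) (Real.rpow_nonneg (norm_nonneg _) _)))
          (by positivity) hv hvb'
        refine ⟨fun y => u y + v y, fun y => -(t - s) * genL f q v y, hu.add hv, ?_, fun y => ?_, ?_⟩
        · have := GB_add hu hv hub hvb'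
          convert this using 1
          rw [pow_succ]; field_simp; ring
        · rw [genL_add _ _ hu hv]
          have e1 := heq y
          have e2 := hveq y
          rw [diff s t v y]
          linarith
        · refine HN_mono (HN_cmul hn (-(t - s))) ?_
          rw [← hC', abs_neg]
          have p : 0 ≤ C' * (C * (N / 2 ^ k)) := by positivity
          have := mul_le_mul_of_nonneg_right hts p
          refine this.trans ?_
          rw [hδ, pow_succ, one_div_mul_eq_div, div_le_iff₀ (by positivity)]
          have e3 : N / (2 ^ k * 2) * (2 * (C' * C + 1)) = C' * (C * (N / 2 ^ k)) + N / 2 ^ k := by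
            field_simp
          rw [e3]
          have : 0 < N / 2 ^ k := by positivity
          linarith
    choose u e hu hub heq he using ind
    refine solv_limit hα hu (b := 2 * C * N) (gn := fun n y => g y - e n y) (fun n R x hx => ?_) heq (fun y => ?_)
    · have hle : 2 * C * N * (1 - 1 / 2 ^ n) ≤ 2 * C * N := by
        have : (0:ℝ) ≤ 1 / 2 ^ n := by positivity
        have : 0 ≤ 2 * C * N := by positivity
        nlinarith
      obtain ⟨p0, p1, p2, p3⟩ := hub n R x hx
      exact ⟨p0.trans hle, fun i => (p1 i).trans hle, fun i j => (p2 i j).trans hle,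
        fun x' hx' i j => (p3 x' hx' i j).trans (mul_le_mul_of_nonneg_right hle (Real.rpow_nonneg (norm_nonneg _) _))⟩
    · have : Tendsto (fun n => e n y) atTop (𝓝 0) := by
        refine squeeze_zero_norm (fun n => (he n).1 y) ?_
        have := (tendsto_pow_atTop_nhds_zero_of_lt_one (r := (1/2 : ℝ)) (by norm_num) (by norm_num)).const_mul N
        simpa [div_eq_mul_inv] using this
      simpa using this.const_sub (g y)
  have all : ∀ n : ℕ, ∀ s, 0 ≤ s → s ≤ 1 → s ≤ n * δ → Solv α lam (fs s) (as s) := by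
    intro n
    induction n with
    | zero =>
      intro s h0 h1 h2
      have : s = 0 := le_antisymm (by simpa using h2) h0
      subst this
      have := base_solv (d := d) hα hα1 hlm hl
      simpa [hfs, has, ha0] using this
    | succ n ih =>
      intro s h0 h1 h2
      by_cases hs : s ≤ δ
      · refine step 0 s le_rfl zero_le_one (by rwa [sub_zero, abs_of_nonneg h0]) (ih 0 le_rfl zero_le_one (by positivity))
      · push Not at hs
        refine step (s - δ) s (by linarith) (by linarith) (by rw [sub_sub_cancel, abs_of_pos hδp]) ?_
        refine ih _ (by linarith) (by linarith) ?_
        push_cast at h2; linarith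
  obtain ⟨n, hn⟩ := exists_nat_ge (1 / δ)
  have := all n 1 zero_le_one le_rfl (by rwa [div_le_iff₀ hδp] at hn)
  simpa [hfs, has] using this

end Contin

section WS
open Filter Topology
variable {d : ℕ}

/-- weighted bounds -/
def WB (α : ℝ) (p : ℕ) (K : ℝ) (u : (Fin d → ℝ) → ℝ) : Prop :=
  ∀ x, |u x| ≤ K * VV x ^ p ∧ (∀ i, |pd1 u x i| ≤ K * VV x ^ p) ∧ (∀ i j, |pd2 u x i j| ≤ K * VV x ^ p) ∧
    ∀ x', ‖x - x'‖ ≤ 1 → ∀ i j, |pd2 u x i j - pd2 u x' i j| ≤ K * VV x ^ p * ‖x - x'‖ ^ α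

lemma WB_nonneg {α K : ℝ} {p : ℕ} {u : (Fin d → ℝ) → ℝ} (h : WB α p K u) : 0 ≤ K := by
  have := (abs_nonneg _).trans (h 0).1
  have h2 := pow_pos (VV_pos (0 : Fin d → ℝ)) p
  nlinarith

lemma VV_near {x y : Fin d → ℝ} (h : ‖x - y‖ ≤ 1) : VV x ≤ (1 + 2 * d) * VV y := by
  have h1 : ‖x‖ ≤ ‖y‖ + 1 := by
    have := norm_add_le (x - y) y
    rw [sub_add_cancel] at this; linarith
  have h2 := VV_le x
  have h3 := VV_ge y
  have hd0 : (0:ℝ) ≤ d := Nat.cast_nonneg d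
  have h4 : ‖x‖ ^ 2 ≤ 2 * ‖y‖ ^ 2 + 2 := by nlinarith [norm_nonneg x, norm_nonneg y, sq_nonneg (‖y‖ - 1)]
  have h5 : (d:ℝ) * ‖x‖ ^ 2 ≤ d * (2 * ‖y‖ ^ 2 + 2) := mul_le_mul_of_nonneg_left h4 hd0
  nlinarith [norm_nonneg y]

lemma WB_LB {α K : ℝ} (hα : 0 < α) {p : ℕ} {u : (Fin d → ℝ) → ℝ} (h : WB α p K u) (R : ℝ) :
    LB α R (2 * K * (1 + d * R ^ 2) ^ p) u := by
  have hK := WB_nonneg h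
  have hV : ∀ x : Fin d → ℝ, ‖x‖ ≤ R → K * VV x ^ p ≤ K * (1 + d * R ^ 2) ^ p := by
    intro x hx
    have : VV x ≤ 1 + d * R ^ 2 := (VV_le x).trans (by gcongr)
    have := pow_le_pow_left₀ (VV_pos x).le this p
    exact mul_le_mul_of_nonneg_left this hK
  intro x hx
  have hx' := hV x hx
  have h0 : 0 ≤ K * VV x ^ p := by have := VV_pos x; positivity
  obtain ⟨q0, q1, q2, q3⟩ := h x
  refine ⟨by linarith, fun i => by linarith [q1 i], fun i j => by linarith [q2 i j], fun x' hx'' i j => ?_⟩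
  have hT : 0 ≤ ‖x - x'‖ ^ α := Real.rpow_nonneg (norm_nonneg _) _
  rcases le_total ‖x - x'‖ 1 with h1 | h1
  · exact (q3 x' h1 i j).trans (mul_le_mul_of_nonneg_right (by linarith) hT)
  · have h2 : 1 ≤ ‖x - x'‖ ^ α := Real.one_le_rpow h1 hα.le
    have := (abs_sub (pd2 u x i j) (pd2 u x' i j)).trans (add_le_add (q2 i j) ((h x').2.2.1 i j))
    have := hV x' hx''
    nlinarith

set_option maxHeartbeats 1000000 in
/-- weighted Schauder estimates in the class -/
lemma wS {α : ℝ} (hα : 0 < α) (hα1 : α < 1) {lm Λ β : ℝ} (hlm : 0 < lm) (hΛ : 0 ≤ Λ) (p : ℕ) :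
    ∃ C, 1 ≤ C ∧ ∀ f a lam, ∀ u g : (Fin d → ℝ) → ℝ, ∀ N, 0 < N → Cl α lm Λ β f a → 0 ≤ lam → lam ≤ 1 →
      ContDiff ℝ 2 u → (∃ K, ∀ z z' i j, |pd2 u z i j - pd2 u z' i j| ≤ K * ‖z - z'‖ ^ α) →
      (∀ y, |u y| ≤ N * VV y ^ p) → (∀ y y', ‖y - y'‖ ≤ 1 → |g y - g y'| ≤ N * VV y ^ p * ‖y - y'‖ ^ α) →
      (∀ y, genL f a u y - lam * u y = g y) → WB α (p + 2) (C * N) u := by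
  have hd0 : (0:ℝ) ≤ d := Nat.cast_nonneg d
  set c0 : ℝ := 1 + 2 * d with hc0
  have hc1 : 1 ≤ c0 := by rw [hc0]; linarith
  have hc1p : 1 ≤ c0 ^ p := one_le_pow₀ hc1
  obtain ⟨C, hC, hS⟩ := schauderW (d := d) hα hα1 (c := c0 ^ p) (Λ := 2 * Λ + 1) hlm (by positivity) hc1p
  set E : ℝ := 32 * C * c0 ^ p with hE
  have hE0 : 0 ≤ E := by positivity
  refine ⟨1 + 8 * E * c0 ^ (p + 1), by have : 0 ≤ 8 * E * c0 ^ (p + 1) := by positivity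
                                       linarith, fun f a lam u g N hN h hl0 hl1 hu hol hub hgb heq => ?_⟩
  set r : (Fin d → ℝ) → ℝ := fun y => 1 / (2 * (1 + ‖y‖)) with hr
  set W : (Fin d → ℝ) → ℝ := fun y => N * c0 ^ p * VV y ^ p with hW
  have r0 : ∀ y, 0 < r y := fun y => by simp only [hr]; positivity
  have r12 : ∀ y, r y ≤ 1 / 2 := fun y => by
    simp only [hr]
    exact one_div_le_one_div_of_le (by norm_num) (by linarith [norm_nonneg y])
  have rmul : ∀ y, r y * (1 + ‖y‖) = 1 / 2 := fun y => by
    simp only [hr]; field_simp [(by positivity : (1 + ‖y‖) ≠ 0)]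
  have near : ∀ y z : Fin d → ℝ, ‖z‖ ≤ 1 → ‖(y + r y • z) - y‖ ≤ 1 := by
    intro y z hz
    rw [add_sub_cancel_left, norm_smul, Real.norm_of_nonneg (r0 y).le]
    nlinarith [r0 y, r12 y, norm_nonneg z]
  have VVn : ∀ y z : Fin d → ℝ, ‖z - y‖ ≤ 1 → N * VV z ^ p ≤ W y := by
    intro y z hz
    have := pow_le_pow_left₀ (VV_pos z).le (VV_near hz) p
    rw [mul_pow] at this
    have := mul_le_mul_of_nonneg_left this hN.le
    simp only [hW]; rw [← hc0] at this; linarith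
  have hrp : ∀ z z' : Fin d → ℝ, 0 ≤ ‖z - z'‖ ^ α := fun z z' => Real.rpow_nonneg (norm_nonneg _) _
  have dd : ∀ y z z' : Fin d → ℝ, ‖z‖ ≤ 1 → ‖z'‖ ≤ 1 → ‖(y + r y • z) - (y + r y • z')‖ ≤ 1 ∧
      ‖(y + r y • z) - (y + r y • z')‖ ^ α ≤ ‖z - z'‖ ^ α := by
    intro y z z' hz hz'
    rw [add_sub_add_left_eq_sub, ← smul_sub, norm_smul, Real.norm_of_nonneg (r0 y).le]
    have h2 : ‖z - z'‖ ≤ 2 := (norm_sub_le _ _).trans (by linarith)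
    refine ⟨by nlinarith [r0 y, r12 y, norm_nonneg (z - z')], ?_⟩
    refine Real.rpow_le_rpow (mul_nonneg (r0 y).le (norm_nonneg _)) ?_ hα.le
    nlinarith [r0 y, r12 y, norm_nonneg (z - z')]
  have fbd : ∀ y z : Fin d → ℝ, ‖z‖ ≤ 1 → r y * (Λ * (1 + ‖y + r y • z‖)) ≤ 2 * Λ := by
    intro y z hz
    have h1 := near y z hz
    have h2 : ‖y + r y • z‖ ≤ ‖y‖ + 1 := by
      have := norm_add_le ((y + r y • z) - y) y
      rw [sub_add_cancel] at this; linarith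
    have h3 : r y * (1 + ‖y + r y • z‖) ≤ r y * (2 * (1 + ‖y‖)) :=
      mul_le_mul_of_nonneg_left (by linarith [norm_nonneg y]) (r0 y).le
    have h4 := rmul y
    nlinarith
  have rsq : ∀ y, 0 ≤ r y ^ 2 ∧ r y ^ 2 ≤ 1 := fun y =>
    ⟨by positivity, by have := r0 y; have := r12 y; nlinarith⟩
  have hw : Wh α lm (2 * Λ + 1) (c0 ^ p) f a lam u g r W :=
    { r0 := r0
      r1 := fun y => (r12 y).trans (by norm_num)
      rr := fun y y' hy => by
        have h1 : ‖y'‖ ≤ ‖y‖ + 1 := by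
          have := norm_add_le (y' - y) y
          rw [sub_add_cancel] at this; linarith [r12 y]
        have h3 := rmul y
        have h4 := rmul y'
        have h5 : 1 + ‖y'‖ ≤ 2 * (1 + ‖y‖) := by linarith [norm_nonneg y]
        have h6 := mul_le_mul_of_nonneg_left h5 (r0 y').le
        by_contra hc
        push Not at hc
        have : 2 * r y' * (1 + ‖y‖) < r y * (1 + ‖y‖) := mul_lt_mul_of_pos_right hc (by positivity)
        linarith
      WW := fun y y' hy => by
        have := VVn y y' (hy.trans ((r12 y).trans (by norm_num)))
        have h2 := mul_le_mul_of_nonneg_left this (by positivity : 0 ≤ c0 ^ p)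
        simp only [hW] at h2 ⊢
        linarith
      W0 := ⟨N, hN, fun y => by
        have := one_le_pow₀ (VV_ge_one y) (n := p)
        simp only [hW]
        have h2 : 1 ≤ c0 ^ p * VV y ^ p := one_le_mul_of_one_le_of_one_le hc1p this
        nlinarith⟩
      cf := fun y z hz => by
        refine ⟨h.ell.2.1 _, h.ell.2.2 _, fun i j => ?_, fun i => ?_, fun z' hz' => ⟨fun i j => ?_, fun i => ?_⟩⟩
        · linarith [h.ab (y + r y • z) i j]
        · rw [abs_mul, abs_of_pos (r0 y)]
          have := mul_le_mul_of_nonneg_left (h.fb (y + r y • z) i) (r0 y).le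
          linarith [fbd y z hz]
        · obtain ⟨d1, d2⟩ := dd y z z' hz hz'
          refine (h.ah _ _ d1 i j).trans ?_
          have := mul_le_mul_of_nonneg_left d2 hΛ
          nlinarith [hrp z z']
        · obtain ⟨d1, d2⟩ := dd y z z' hz hz'
          rw [← mul_sub, abs_mul, abs_of_pos (r0 y)]
          have h1 := mul_le_mul_of_nonneg_left (h.fh _ _ d1 i) (r0 y).le
          have h2 := fbd y z hz
          have h3 : r y * (Λ * (1 + ‖y + r y • z‖)) * ‖(y + r y • z) - (y + r y • z')‖ ^ α ≤ 2 * Λ * ‖z - z'‖ ^ α :=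
            mul_le_mul h2 d2 (hrp _ _) (by positivity)
          nlinarith [hrp z z']
      hlam := fun y => by
        rw [abs_of_nonneg (mul_nonneg (rsq y).1 hl0)]
        nlinarith [rsq y]
      c2 := hu
      hol := hol
      bu := fun y z hz => (hub _).trans (VVn y _ (near y z hz))
      bg := fun y z z' hz hz' => by
        obtain ⟨d1, d2⟩ := dd y z z' hz hz'
        rw [← mul_sub, abs_mul, abs_of_nonneg (rsq y).1]
        have h1 := hgb _ _ d1
        have h2 := VVn y _ (near y z hz)
        have h3 : N * VV (y + r y • z) ^ p * ‖(y + r y • z) - (y + r y • z')‖ ^ α ≤ W y * ‖z - z'‖ ^ α :=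
          mul_le_mul h2 d2 (hrp _ _) (by have := VV_pos y; simp only [hW]; positivity)
        have h4 := abs_nonneg (g (y + r y • z) - g (y + r y • z'))
        nlinarith [rsq y]
      eq := heq }
  have hS' := hS f a lam u g _ _ hw
  -- conversion
  have big : ∀ y : Fin d → ℝ, (1 + ‖y‖) ^ 2 ≤ 2 * VV y := fun y => by
    have := VV_ge y; nlinarith [sq_nonneg (‖y‖ - 1)]
  have Wp : ∀ y, 0 < W y := fun y => by have := VV_pos y; simp only [hW]; positivity
  have rin : ∀ y, 1 = 4 * (1 + ‖y‖) ^ 2 * r y ^ 2 := fun y => by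
    have := rmul y
    have e : 4 * (1 + ‖y‖) ^ 2 * r y ^ 2 = 4 * (r y * (1 + ‖y‖)) ^ 2 := by ring
    rw [e, this]; norm_num
  have d2 : ∀ y i j, |pd2 u y i j| ≤ E * N * VV y ^ (p + 1) := by
    intro y i j
    have h1 := (hS' y).2.1 i j
    calc |pd2 u y i j| = 4 * (1 + ‖y‖) ^ 2 * (r y ^ 2 * |pd2 u y i j|) := by
          rw [← mul_assoc, ← rin, one_mul]
      _ ≤ 4 * (2 * VV y) * (C * W y) := by
          have := big y
          have := VV_pos y
          gcongr
      _ = 8 * C * c0 ^ p * (N * VV y ^ (p + 1)) := by simp only [hW]; ring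
      _ ≤ 32 * C * c0 ^ p * (N * VV y ^ (p + 1)) := by
          have := VV_pos y
          gcongr
          norm_num
      _ = _ := by rw [hE]; ring
  have d1 : ∀ y i, |pd1 u y i| ≤ E * N * VV y ^ (p + 1) := by
    intro y i
    have h1 := (hS' y).2.2 i
    have h2 := rmul y
    calc |pd1 u y i| = 2 * (1 + ‖y‖) * (r y * |pd1 u y i|) := by
          have : 2 * (1 + ‖y‖) * (r y * |pd1 u y i|) = 2 * (r y * (1 + ‖y‖)) * |pd1 u y i| := by ring
          rw [this, h2]; ring
      _ ≤ 2 * (2 * VV y) * (C * W y) := by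
          have := big y
          have : 1 + ‖y‖ ≤ 2 * VV y := by nlinarith [norm_nonneg y]
          have := VV_pos y
          gcongr
      _ = 4 * C * c0 ^ p * (N * VV y ^ (p + 1)) := by simp only [hW]; ring
      _ ≤ 32 * C * c0 ^ p * (N * VV y ^ (p + 1)) := by
          have := VV_pos y
          gcongr
          norm_num
      _ = _ := by rw [hE]; ring
  have raise : ∀ y : Fin d → ℝ, ∀ q, q ≤ p + 2 → VV y ^ q ≤ VV y ^ (p + 2) := fun y q hq =>
    pow_le_pow_right₀ (VV_ge_one y) hq
  have hEc : E ≤ 8 * E * c0 ^ (p + 1) := by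
    have : 1 ≤ c0 ^ (p + 1) := one_le_pow₀ hc1
    nlinarith
  have fin1 : ∀ y : Fin d → ℝ, E * N * VV y ^ (p + 1) ≤ (1 + 8 * E * c0 ^ (p + 1)) * N * VV y ^ (p + 2) := by
    intro y
    have := VV_pos y
    have := raise y (p + 1) (by omega)
    gcongr
    linarith
  intro x
  refine ⟨?_, fun i => (d1 x i).trans (fin1 x), fun i j => (d2 x i j).trans (fin1 x), fun x' hx' i j => ?_⟩
  · refine (hub x).trans ?_
    have h1 := raise x p (by omega)
    have h3 : 0 ≤ VV x ^ (p + 2) := by have := VV_pos x; positivity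
    have h2 : N * VV x ^ p ≤ N * VV x ^ (p + 2) := mul_le_mul_of_nonneg_left h1 hN.le
    have h4 : 0 ≤ 8 * E * c0 ^ (p + 1) * N * VV x ^ (p + 2) := by positivity
    nlinarith
  · have hT := hrp x x'
    have hVp := VV_pos x
    have rr1 : r x ≤ (r x) ^ α := by
      have := lip_min (r0 x).le hα.le hα1.le
      rwa [min_eq_right ((r12 x).trans (by norm_num))] at this
    have r3 : 1 ≤ 4 * VV x * r x := by
      have h1 := rmul x
      have h2 := big x
      have h3 : 1 + ‖x‖ ≤ 2 * VV x := by nlinarith [norm_nonneg x]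
      have := mul_le_mul_of_nonneg_left h3 (r0 x).le
      linarith
    rcases le_total ‖x - x'‖ (r x) with h1 | h1
    · have hz : ‖(r x)⁻¹ • (x' - x)‖ ≤ 1 := by
        rw [norm_smul, Real.norm_of_nonneg (inv_nonneg.2 (r0 x).le), norm_sub_rev, inv_mul_le_iff₀ (r0 x)]
        linarith
      have hth := (hS' x).1 0 ((r x)⁻¹ • (x' - x)) (by simp) hz i j
      rw [smul_zero, add_zero, smul_inv_smul₀ (r0 x).ne', add_sub_cancel, zero_sub, norm_neg, norm_smul,
        Real.norm_of_nonneg (inv_nonneg.2 (r0 x).le), norm_sub_rev,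
        Real.mul_rpow (inv_nonneg.2 (r0 x).le) (norm_nonneg _), Real.inv_rpow (r0 x).le] at hth
      have hinv : ((r x) ^ α)⁻¹ ≤ 4 * VV x := by
        have hp : 0 < r x ^ α := Real.rpow_pos_of_pos (r0 x) _
        rw [inv_le_iff_one_le_mul₀ hp]
        have : 4 * VV x * r x ≤ 4 * VV x * r x ^ α := mul_le_mul_of_nonneg_left rr1 (by positivity)
        linarith
      calc |pd2 u x i j - pd2 u x' i j| = 4 * (1 + ‖x‖) ^ 2 * (r x ^ 2 * |pd2 u x i j - pd2 u x' i j|) := by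
            rw [← mul_assoc, ← rin, one_mul]
        _ ≤ 4 * (2 * VV x) * (C * W x * ((4 * VV x) * ‖x - x'‖ ^ α)) := by
            have := big x
            have := Wp x
            refine mul_le_mul (by linarith) (hth.trans ?_) (by positivity) (by positivity)
            gcongr
        _ = E * N * VV x ^ (p + 2) * ‖x - x'‖ ^ α := by simp only [hW, hE]; ring
        _ ≤ _ := by
            gcongr
            linarith
    · have q1 := d2 x i j
      have q2 := d2 x' i j
      have q3 : E * N * VV x' ^ (p + 1) ≤ E * N * c0 ^ (p + 1) * VV x ^ (p + 1) := by
        have := pow_le_pow_left₀ (VV_pos x').le (VV_near (x := x') (y := x) (by rwa [norm_sub_rev])) (p + 1)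
        rw [mul_pow] at this
        rw [mul_assoc (E * N)]
        exact mul_le_mul_of_nonneg_left this (by positivity)
      have q4 : E * N * VV x ^ (p + 1) ≤ E * N * c0 ^ (p + 1) * VV x ^ (p + 1) := by
        have : 1 ≤ c0 ^ (p + 1) := one_le_pow₀ hc1
        have h5 : 0 ≤ E * N * VV x ^ (p + 1) := by positivity
        nlinarith
      have q5 : 1 ≤ 4 * VV x * ‖x - x'‖ ^ α := by
        have h6 : r x ^ α ≤ ‖x - x'‖ ^ α := Real.rpow_le_rpow (r0 x).le h1 hα.le
        have : 4 * VV x * r x ≤ 4 * VV x * ‖x - x'‖ ^ α := mul_le_mul_of_nonneg_left (rr1.trans h6) (by positivity)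
        linarith
      calc |pd2 u x i j - pd2 u x' i j| ≤ 2 * (E * N * c0 ^ (p + 1) * VV x ^ (p + 1)) := by
            refine (abs_sub _ _).trans ?_
            linarith
        _ ≤ 2 * (E * N * c0 ^ (p + 1) * VV x ^ (p + 1)) * (4 * VV x * ‖x - x'‖ ^ α) :=
            le_mul_of_one_le_right (by positivity) q5
        _ = 8 * E * c0 ^ (p + 1) * N * VV x ^ (p + 2) * ‖x - x'‖ ^ α := by ring
        _ ≤ _ := by
            gcongr
            linarith

end WS

section QQ
open Filter Topology
variable {d : ℕ}

lemma Cl_limit {ι : Type*} [Nonempty ι] (U : Ultrafilter ι) {α lm Λ β : ℝ} {fn : ι → (Fin d → ℝ) → Fin d → ℝ}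
    {an : ι → (Fin d → ℝ) → Fin d → Fin d → ℝ} {f : (Fin d → ℝ) → Fin d → ℝ}
    {a : (Fin d → ℝ) → Fin d → Fin d → ℝ} (h : ∀ n, Cl α lm Λ β (fn n) (an n))
    (hf : ∀ y i, Tendsto (fun n => fn n y i) U (𝓝 (f y i)))
    (ha : ∀ y i j, Tendsto (fun n => an n y i j) U (𝓝 (a y i j))) : Cl α lm Λ β f a where
  ell := by
    refine ⟨(h (Classical.arbitrary ι)).ell.1, fun y i j => ?_, fun y ξ => ?_⟩
    · refine tendsto_nhds_unique (ha y i j) ?_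
      refine (ha y j i).congr (fun n => ?_)
      exact (h n).ell.2.1 y j i
    · refine ge_of_tendsto (f := fun n => 2 * ∑ i, ∑ j, ξ i * an n y i j * ξ j) (x := (U : Filter ι)) ?_
        (Eventually.of_forall fun n => (h n).ell.2.2 y ξ)
      exact (tendsto_finsetSum _ fun i _ => tendsto_finsetSum _ fun j _ =>
        ((ha y i j).const_mul (ξ i)).mul_const (ξ j)).const_mul 2
  ab y i j := le_of_tendsto (ha y i j).abs (Eventually.of_forall fun n => (h n).ab y i j)
  fb y i := le_of_tendsto (hf y i).abs (Eventually.of_forall fun n => (h n).fb y i)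
  ah y y' hy i j := le_of_tendsto ((ha y i j).sub (ha y' i j)).abs
    (Eventually.of_forall fun n => (h n).ah y y' hy i j)
  fh y y' hy i := le_of_tendsto ((hf y i).sub (hf y' i)).abs
    (Eventually.of_forall fun n => (h n).fh y y' hy i)
  dis y := le_of_tendsto (f := fun n => ∑ i, fn n y i * y i) (x := (U : Filter ι))
    (tendsto_finsetSum _ fun i _ => (hf y i).mul_const (y i))
    (Eventually.of_forall fun n => (h n).dis y)

/-- hypotheses on a bounded normalized solution -/
structure QH (α lm Λ β : ℝ) (p : ℕ) (ε : ℝ) (f : (Fin d → ℝ) → Fin d → ℝ)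
    (a : (Fin d → ℝ) → Fin d → Fin d → ℝ) (lam : ℝ) (w g : (Fin d → ℝ) → ℝ) : Prop where
  cl : Cl α lm Λ β f a
  l0 : 0 ≤ lam
  l1 : lam ≤ 1
  c2 : ContDiff ℝ 2 w
  w0 : w 0 = 0
  bd : ∃ K, ∀ y, |w y| ≤ K
  hol : ∃ K, ∀ z z' i j, |pd2 w z i j - pd2 w z' i j| ≤ K * ‖z - z'‖ ^ α
  eq : ∀ y, genL f a w y - lam * w y = g y
  gb : ∀ y, |g y| ≤ ε * VV y ^ p
  gh : ∀ y y', ‖y - y'‖ ≤ 1 → |g y - g y'| ≤ ε * VV y ^ p * ‖y - y'‖ ^ α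

/-- uniform convergence on balls -/
lemma unif_small {α : ℝ} (U : Ultrafilter ℕ) {w : ℕ → (Fin d → ℝ) → ℝ} (hw : ∀ n, ContDiff ℝ 2 (w n))
    {R b : ℝ} (hb : ∀ n, LB α R b (w n)) (h0 : ∀ x, Tendsto (fun n => w n x) U (𝓝 0)) {ε : ℝ} (hε : 0 < ε) :
    ∀ᶠ n in U, ∀ y, ‖y‖ ≤ R → |w n y| ≤ ε := by
  by_contra hcon
  rw [← Ultrafilter.eventually_not] at hcon
  have hch : ∀ n, ∃ x : Fin d → ℝ, (¬ ∀ y, ‖y‖ ≤ R → |w n y| ≤ ε) → ‖x‖ ≤ R ∧ ε < |w n x| := by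
    intro n
    by_cases h : ∀ y, ‖y‖ ≤ R → |w n y| ≤ ε
    · exact ⟨0, fun h' => absurd h h'⟩
    · push Not at h
      obtain ⟨x, h1, h2⟩ := h
      exact ⟨x, fun _ => ⟨h1, h2⟩⟩
  choose x hx using hch
  have hev : ∀ᶠ n in U, ‖x n‖ ≤ R ∧ ε < |w n (x n)| := hcon.mono fun n h => hx n h
  obtain ⟨x0, hx0, hlim⟩ := (isCompact_closedBall (0 : Fin d → ℝ) R).ultrafilter_le_nhds (U.map x) (by
    rw [le_principal_iff]
    change x ⁻¹' _ ∈ U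
    filter_upwards [hev] with n hn
    simpa using hn.1)
  have hlim' : Tendsto x U (𝓝 x0) := hlim
  have hx0' : ‖x0‖ ≤ R := by simpa using hx0
  have hb0 : 0 ≤ b := (abs_nonneg _).trans (hb 0 x0 hx0').1
  have key : ∀ᶠ n in U, ε < |w n x0| + d * b * ‖x n - x0‖ := by
    filter_upwards [hev] with n hn
    have := mvt_pd1 (C2_diff (hw n)) (s := Metric.closedBall 0 R) (convex_closedBall _ _) hb0
      (fun z hz i => (hb n z (by simpa using hz)).2.1 i) (y := x n) (y' := x0) (by simpa using hn.1) hx0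
    have h2 := abs_sub_abs_le_abs_sub (w n (x n)) (w n x0)
    linarith [hn.2]
  have hl : Tendsto (fun n => |w n x0| + d * b * ‖x n - x0‖) U (𝓝 (|(0:ℝ)| + d * b * ‖x0 - x0‖)) :=
    (h0 x0).abs.add ((hlim'.sub_const x0).norm.const_mul _)
  have := ge_of_tendsto hl (key.mono fun n h => h.le)
  simp at this
  linarith

/-- the normalized estimate -/
lemma Qn {α : ℝ} (hα : 0 < α) (hα1 : α < 1) {lm Λ β : ℝ} (hlm : 0 < lm) (hΛ : 0 ≤ Λ) (hβ : 0 < β) (p : ℕ) :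
    ∃ ε, 0 < ε ∧ ∀ f a lam, ∀ w g : (Fin d → ℝ) → ℝ, QH α lm Λ β p ε f a lam w g →
      (∀ y, |w y| ≤ VV y ^ (p + 1)) → ∀ y, |w y| ≤ 1 / 2 * VV y ^ (p + 1) := by
  by_contra hcon
  push Not at hcon
  have hpos : ∀ n : ℕ, (0:ℝ) < 1 / (n + 1) := fun n => by positivity
  choose f a lam w g hQ hw1 yb hyb using fun n : ℕ => hcon (1 / (n + 1)) (hpos n)
  obtain ⟨C, hC, hS⟩ := wS (d := d) (β := β) hα hα1 hlm hΛ (p + 1)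
  obtain ⟨R, C0, hR, hC0, hly⟩ := lyap (d := d) hΛ hβ p
  have hle1 : ∀ n : ℕ, (1:ℝ) / (n + 1) ≤ 1 := fun n => by
    rw [div_le_one (by positivity)]
    have : (0:ℝ) ≤ n := Nat.cast_nonneg n
    linarith
  have hWB : ∀ n, WB α (p + 1 + 2) (C * 1) (w n) := by
    intro n
    refine hS (f n) (a n) (lam n) (w n) (g n) 1 one_pos (hQ n).cl (hQ n).l0 (hQ n).l1 (hQ n).c2 (hQ n).hol
      (fun y => by rw [one_mul]; exact hw1 n y) (fun y y' hy => ?_) (hQ n).eq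
    refine ((hQ n).gh y y' hy).trans ?_
    have h1 : VV y ^ p ≤ VV y ^ (p + 1) := pow_le_pow_right₀ (VV_ge_one y) (by omega)
    have h2 : 0 < VV y ^ p := pow_pos (VV_pos y) p
    refine mul_le_mul_of_nonneg_right (mul_le_mul (hle1 n) h1 h2.le zero_le_one) (Real.rpow_nonneg (norm_nonneg _) _)
  set U : Ultrafilter ℕ := hyperfilter ℕ with hU
  have hUle : (U : Filter ℕ) ≤ atTop := by rw [← Nat.cofinite_eq_atTop]; exact hyperfilter_le_cofinite
  obtain ⟨v, hv2, hv, hvd1, hvd2, -⟩ := compC U hα (fun n => (hQ n).c2)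
    (fun R => ⟨_, Eventually.of_forall fun n => WB_LB hα (hWB n) R⟩)
  have hfl : ∀ y i, ∃ L, Tendsto (fun n => f n y i) U (𝓝 L) := fun y i =>
    ultra_lim U (Eventually.of_forall fun n => (hQ n).cl.fb y i)
  have hal : ∀ y i j, ∃ L, Tendsto (fun n => a n y i j) U (𝓝 L) := fun y i j =>
    ultra_lim U (Eventually.of_forall fun n => (hQ n).cl.ab y i j)
  choose f0 hf0 using hfl
  choose a0 ha0 using hal
  obtain ⟨l0, hl0⟩ := ultra_lim U (x := lam) (b := 1) (Eventually.of_forall fun n => by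
    rw [abs_of_nonneg (hQ n).l0]; exact (hQ n).l1)
  have hCl : Cl α lm Λ β f0 a0 := Cl_limit U (fun n => (hQ n).cl) hf0 ha0
  have hl0' : 0 ≤ l0 := ge_of_tendsto hl0 (Eventually.of_forall fun n => (hQ n).l0)
  have hone : Tendsto (fun n : ℕ => (1:ℝ) / (n + 1)) U (𝓝 0) :=
    tendsto_one_div_add_atTop_nhds_zero_nat.mono_left hUle
  have hg0 : ∀ y, Tendsto (fun n => g n y) U (𝓝 0) := by
    intro y
    refine squeeze_zero_norm (fun n => ?_) (by simpa using hone.mul_const (VV y ^ p))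
    rw [← one_div]
    exact (hQ n).gb y
  have hveq : ∀ y, genL f0 a0 v y = l0 * v y := by
    intro y
    have h1 := genL_tendsto (fn := fun n => f n y) (an := fun n => a n y) (hf0 y) (ha0 y) (hvd1 y) (hvd2 y)
    have h2 : Tendsto (fun n => lam n * w n y + g n y) U (𝓝 (l0 * v y + 0)) :=
      (hl0.mul (hv y)).add (hg0 y)
    rw [add_zero] at h2
    refine tendsto_nhds_unique (h1.congr (fun n => ?_)) h2
    have := (hQ n).eq y
    unfold genL at this
    linarith
  have hv0 : ∀ y, v y = 0 := liouvilleL hΛ hβ hCl hl0' hv2 hveq (K := 1) (p := p + 1)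
    (fun y => by
      rw [one_mul]
      exact le_of_tendsto (hv y).abs (Eventually.of_forall fun n => hw1 n y))
    (tendsto_nhds_unique (hv 0) (tendsto_const_nhds.congr fun n => ((hQ n).w0).symm))
  have hsm := unif_small (ε := 1/4) U (fun n => (hQ n).c2) (fun n => WB_LB hα (hWB n) R)
    (fun x => by have := hv x; rwa [hv0 x] at this) (by norm_num)
  have hsm2 : ∀ᶠ n : ℕ in U, (1:ℝ) / (n + 1) < 1 / 4 := hone.eventually_lt_const (by norm_num)
  obtain ⟨n, hn1, hn2⟩ := (hsm.and hsm2).exists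
  -- exterior maximum principle
  have ext : ∀ s : ℝ, |s| = 1 → ∀ y, s * w n y - (1 / 4 * VV y ^ (p + 1) + 1 / 4) ≤ 0 := by
    intro s hs
    have hVc : ContDiff ℝ 2 (fun y : Fin d → ℝ => 1 / 4 * VV y ^ (p + 1)) := contDiff_const.mul (VV_contDiff (p + 1))
    have hVc' : ContDiff ℝ 2 (fun y : Fin d → ℝ => 1 / 4 * VV y ^ (p + 1) + 1 / 4) := hVc.add contDiff_const
    have hsw : ContDiff ℝ 2 (fun y => s * w n y) := contDiff_const.mul (hQ n).c2
    have habs : ∀ y, s * w n y ≤ |w n y| := fun y => by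
      have := le_abs_self (s * w n y)
      rwa [abs_mul, hs, one_mul] at this
    obtain ⟨K, hK⟩ := (hQ n).bd
    obtain ⟨R1, hR1⟩ := VV_pow_large (d := d) (1 / 4) K (by norm_num) 0 p
    refine MP (hsw.sub hVc') (f n) (hQ n).cl.ell (R := R1) (fun y hy => ?_) (fun y hy => ?_)
    · have h1 := hR1 y hy
      have h2 := (habs y).trans (hK y)
      simp only [pow_zero, mul_one, zero_add] at h1
      linarith
    · have hRy : R ≤ ‖y‖ := by
        by_contra hlt
        have := (habs y).trans (hn1 y (not_le.1 hlt).le)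
        have h3 := pow_pos (VV_pos y) (p + 1)
        linarith
      have h1 := (hly α lm (f n) (a n) (hQ n).cl).1 y hRy
      rw [genL_sub (f n) (a n) hsw hVc', genL_add (f n) (a n) hVc contDiff_const,
        genL_cmul (f n) (a n) (VV_contDiff (p + 1)), genL_const, genL_cmul (f n) (a n) (hQ n).c2]
      have h2 := (hQ n).eq y
      have h3 := pow_pos (VV_pos y) (p + 1)
      have h4 := pow_pos (VV_pos y) p
      have h5 : 0 < s * w n y := by linarith
      have h6 : s * genL (f n) (a n) (w n) y = lam n * (s * w n y) + s * g n y := by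
        rw [show genL (f n) (a n) (w n) y = lam n * w n y + g n y by linarith]; ring
      have h7 : -(1 / (n + 1) * VV y ^ p) ≤ s * g n y := by
        have h8 := neg_abs_le (s * g n y)
        rw [abs_mul, hs, one_mul] at h8
        linarith [(hQ n).gb y]
      have h9 := mul_nonneg (hQ n).l0 h5.le
      have h10 := mul_lt_mul_of_pos_right hn2 h4
      rw [h6]
      linarith
  have hV1 : 1 ≤ VV (yb n) ^ (p + 1) := one_le_pow₀ (VV_ge_one _)
  have e1 := ext 1 (by simp) (yb n)
  have e2 := ext (-1) (by simp) (yb n)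
  have : |w n (yb n)| ≤ 1 / 2 * VV (yb n) ^ (p + 1) := abs_le.2 ⟨by linarith, by linarith⟩
  linarith [hyb n]

/-- a priori estimate, uniform in `lam` -/
lemma Qest {α : ℝ} (hα : 0 < α) (hα1 : α < 1) {lm Λ β : ℝ} (hlm : 0 < lm) (hΛ : 0 ≤ Λ) (hβ : 0 < β) (p : ℕ) :
    ∃ C, 1 ≤ C ∧ ∀ f a lam, ∀ u g : (Fin d → ℝ) → ℝ, ∀ N, 0 < N → Cl α lm Λ β f a → 0 < lam → lam ≤ 1 →
      ContDiff ℝ 2 u → (∃ K, ∀ y, |u y| ≤ K) →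
      (∃ K, ∀ z z' i j, |pd2 u z i j - pd2 u z' i j| ≤ K * ‖z - z'‖ ^ α) →
      (∀ y, genL f a u y - lam * u y = g y) → (∀ y, |g y| ≤ N * VV y ^ p) →
      (∀ y y', ‖y - y'‖ ≤ 1 → |g y - g y'| ≤ N * VV y ^ p * ‖y - y'‖ ^ α) →
      (∀ y, |u y - u 0| ≤ C * N * VV y ^ (p + 1)) ∧ lam * |u 0| ≤ C * N := by
  obtain ⟨ε, hε, hQn⟩ := Qn (d := d) hα hα1 hlm hΛ hβ p
  obtain ⟨R, C0, hR, hC0, hly⟩ := lyap (d := d) hΛ hβ p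
  have hC1 : 0 ≤ (2 + C0) / ε := by positivity
  refine ⟨(2 + C0) + (2 + C0) / ε, by linarith, fun f a lam u g N hN hCl hl hl1 hu hub hol heq hg hgh => ?_⟩
  have bar : ∀ s : ℝ, |s| = 1 → ∀ y, s * u y - (N * VV y ^ (p + 1) + N * C0 / lam) ≤ 0 := by
    intro s hs
    have hVc : ContDiff ℝ 2 (fun y : Fin d → ℝ => N * VV y ^ (p + 1)) := contDiff_const.mul (VV_contDiff (p + 1))
    have hVc' : ContDiff ℝ 2 (fun y : Fin d → ℝ => N * VV y ^ (p + 1) + N * C0 / lam) := hVc.add contDiff_const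
    have hsw : ContDiff ℝ 2 (fun y => s * u y) := contDiff_const.mul hu
    have habs : ∀ y, s * u y ≤ |u y| := fun y => by
      have := le_abs_self (s * u y)
      rwa [abs_mul, hs, one_mul] at this
    have hnn : 0 ≤ N * C0 / lam := by positivity
    obtain ⟨K, hK⟩ := hub
    obtain ⟨R1, hR1⟩ := VV_pow_large (d := d) N K hN 0 p
    refine MP (hsw.sub hVc') f hCl.ell (R := R1) (fun y hy => ?_) (fun y hy => ?_)
    · have h1 := hR1 y hy
      have h2 := (habs y).trans (hK y)
      simp only [pow_zero, mul_one, zero_add] at h1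
      linarith
    · have h1 := (hly α lm f a hCl).2 y
      rw [genL_sub f a hsw hVc', genL_add f a hVc contDiff_const,
        genL_cmul f a (VV_contDiff (p + 1)), genL_const, genL_cmul f a hu]
      have h2 := heq y
      have h3 : 0 < N * VV y ^ (p + 1) := mul_pos hN (pow_pos (VV_pos y) (p + 1))
      have h6 : s * genL f a u y = lam * (s * u y) + s * g y := by
        rw [show genL f a u y = lam * u y + g y by linarith]; ring
      have h7 : -(N * VV y ^ p) ≤ s * g y := by
        have h8 := neg_abs_le (s * g y)
        rw [abs_mul, hs, one_mul] at h8
        linarith [hg y]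
      have h8 : N * C0 / lam < s * u y := by linarith
      rw [div_lt_iff₀ hl] at h8
      have h9 := mul_le_mul_of_nonneg_left h1 hN.le
      rw [h6]
      linarith
  have hV0 : VV (0 : Fin d → ℝ) = 1 := le_antisymm (by simpa using VV_le (0 : Fin d → ℝ)) (VV_ge_one 0)
  have hu0 : lam * |u 0| ≤ (1 + C0) * N := by
    have e1 := bar 1 (by simp) 0
    have e2 := bar (-1) (by simp) 0
    rw [hV0, one_pow] at e1 e2
    have : |u 0| ≤ N + N * C0 / lam := abs_le.2 ⟨by linarith, by linarith⟩
    have := mul_le_mul_of_nonneg_left this hl.le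
    rw [mul_add, mul_div_cancel₀ _ hl.ne'] at this
    nlinarith
  have hCN : (2 + C0) * N ≤ ((2 + C0) + (2 + C0) / ε) * N := mul_le_mul_of_nonneg_right (by linarith) hN.le
  refine ⟨?_, hu0.trans (by linarith)⟩
  set K0 : ℝ := (2 + C0) * N / ε with hK0
  have hK0p : 0 < K0 := by positivity
  have step : ∀ K, K0 ≤ K → (∀ y, |u y - u 0| ≤ K * VV y ^ (p + 1)) →
      ∀ y, |u y - u 0| ≤ K / 2 * VV y ^ (p + 1) := by
    intro K hK hb
    have hKp : 0 < K := hK0p.trans_le hK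
    have hNK : (2 + C0) * N ≤ K * ε := by rwa [hK0, div_le_iff₀ hε] at hK
    have hc2 : ContDiff ℝ 2 (fun y => u y - u 0) := hu.sub contDiff_const
    have hpd2 : ∀ y i j, pd2 (fun y => K⁻¹ * (u y - u 0)) y i j = K⁻¹ * pd2 u y i j := by
      intro y i j
      rw [pd2_cmul hc2, pd2_sub hu contDiff_const, pd2_const, sub_zero]
    have hQ : QH α lm Λ β p ε f a lam (fun y => K⁻¹ * (u y - u 0)) (fun y => K⁻¹ * (g y + lam * u 0)) :=
      { cl := hCl
        l0 := hl.le
        l1 := hl1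
        c2 := contDiff_const.mul hc2
        w0 := by simp
        bd := by
          obtain ⟨M, hM⟩ := hub
          refine ⟨K⁻¹ * (M + M), fun y => ?_⟩
          rw [abs_mul, abs_of_pos (inv_pos.2 hKp)]
          refine mul_le_mul_of_nonneg_left ?_ (inv_pos.2 hKp).le
          exact (abs_sub _ _).trans (add_le_add (hM y) (hM 0))
        hol := by
          obtain ⟨M, hM⟩ := hol
          refine ⟨K⁻¹ * M, fun z z' i j => ?_⟩
          rw [hpd2, hpd2, ← mul_sub, abs_mul, abs_of_pos (inv_pos.2 hKp), mul_assoc]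
          exact mul_le_mul_of_nonneg_left (hM z z' i j) (inv_pos.2 hKp).le
        eq := fun y => by
          rw [genL_cmul f a hc2, genL_sub f a hu contDiff_const, genL_const, ← heq y]
          ring
        gb := fun y => by
          rw [abs_mul, abs_of_pos (inv_pos.2 hKp), inv_mul_le_iff₀ hKp]
          have h1 : |lam * u 0| ≤ (1 + C0) * N := by rwa [abs_mul, abs_of_pos hl]
          have h2 : 1 ≤ VV y ^ p := one_le_pow₀ (VV_ge_one y)
          have h3 : (1 + C0) * N * 1 ≤ (1 + C0) * N * VV y ^ p := mul_le_mul_of_nonneg_left h2 (by positivity)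
          have h4 := mul_le_mul_of_nonneg_right hNK (by positivity : 0 ≤ VV y ^ p)
          have h5 := abs_add_le (g y) (lam * u 0)
          linarith [hg y]
        gh := fun y y' hy => by
          rw [← mul_sub, abs_mul, abs_of_pos (inv_pos.2 hKp), inv_mul_le_iff₀ hKp, add_sub_add_right_eq_sub]
          refine (hgh y y' hy).trans ?_
          have h6 : N ≤ K * ε := le_trans (by nlinarith) hNK
          have h7 : 0 ≤ VV y ^ p * ‖y - y'‖ ^ α :=
            mul_nonneg (pow_pos (VV_pos y) p).le (Real.rpow_nonneg (norm_nonneg _) _)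
          have := mul_le_mul_of_nonneg_right h6 h7
          linarith }
    intro y
    have h1 := hQn f a lam _ _ hQ (fun y => by
      rw [abs_mul, abs_of_pos (inv_pos.2 hKp), inv_mul_le_iff₀ hKp]; exact hb y) y
    rw [abs_mul, abs_of_pos (inv_pos.2 hKp), inv_mul_le_iff₀ hKp] at h1
    linarith
  have iter : ∀ j : ℕ, (∀ y, |u y - u 0| ≤ 2 ^ j * K0 * VV y ^ (p + 1)) →
      ∀ y, |u y - u 0| ≤ K0 * VV y ^ (p + 1) := by
    intro j
    induction j with
    | zero => intro h y; simpa using h y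
    | succ j ih =>
      intro h
      refine ih fun y => ?_
      have h1 : K0 ≤ 2 ^ (j + 1) * K0 := le_mul_of_one_le_left hK0p.le (one_le_pow₀ (by norm_num))
      have := step _ h1 h y
      rw [pow_succ] at this
      linarith
  obtain ⟨M, hM⟩ := hub
  obtain ⟨j, hj⟩ := pow_unbounded_of_one_lt ((M + M) / K0) (one_lt_two)
  have fin := iter j (fun y => by
    have h1 : |u y - u 0| ≤ M + M := (abs_sub _ _).trans (add_le_add (hM y) (hM 0))
    rw [div_lt_iff₀ hK0p] at hj
    have h2 : 1 ≤ VV y ^ (p + 1) := one_le_pow₀ (VV_ge_one y)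
    have h3 : 2 ^ j * K0 * 1 ≤ 2 ^ j * K0 * VV y ^ (p + 1) := mul_le_mul_of_nonneg_left h2 (by positivity)
    linarith)
  intro y
  refine (fin y).trans (mul_le_mul_of_nonneg_right ?_ (pow_pos (VV_pos y) _).le)
  rw [hK0]
  have : (2 + C0) * N / ε = (2 + C0) / ε * N := by ring
  rw [this]
  nlinarith

end QQ

section EX
open Filter Topology
variable {d : ℕ}

/-- the original coefficients -/
structure OrC (α lm Λ β : ℝ) (f : (Fin d → ℝ) → Fin d → ℝ) (a : (Fin d → ℝ) → Fin d → Fin d → ℝ) : Prop where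
  ell : Ell lm a
  ab : ∀ y i j, |a y i j| ≤ Λ
  fb : ∀ y i, |f y i| ≤ Λ * (1 + ‖y‖)
  ah : ∀ y y', ‖y - y'‖ ≤ 1 → ∀ i j, |a y i j - a y' i j| ≤ Λ * ‖y - y'‖ ^ α
  fh : ∀ y y', ‖y - y'‖ ≤ 1 → ∀ i, |f y i - f y' i| ≤ Λ * (1 + ‖y‖) * ‖y - y'‖ ^ α
  dis : ∀ y, ∑ i, f y i * y i ≤ Λ - β * ‖y‖ ^ 2

def chi (ε : ℝ) (y : Fin d → ℝ) : ℝ := (1 + ε * ‖y‖)⁻¹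

lemma near_far {D t M b α : ℝ} (hα : 0 < α) (hM : 0 ≤ M) (ht : 0 ≤ t) (h1 : t ≤ 1 → D ≤ M * t ^ α)
    (hb : 0 ≤ b) (h2 : D ≤ b) : D ≤ (M + b) * t ^ α := by
  have hT : 0 ≤ t ^ α := Real.rpow_nonneg ht _
  rcases le_total t 1 with h | h
  · have := h1 h
    nlinarith
  · have : 1 ≤ t ^ α := Real.one_le_rpow h hα.le
    nlinarith

lemma chi_pos {ε : ℝ} (hε : 0 ≤ ε) (y : Fin d → ℝ) : 0 < chi ε y := by
  unfold chi; positivity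

lemma chi_mul {ε : ℝ} (hε : 0 ≤ ε) (y : Fin d → ℝ) : chi ε y * (1 + ε * ‖y‖) = 1 := by
  unfold chi; exact inv_mul_cancel₀ (by positivity)

lemma chi_le {ε : ℝ} (hε : 0 ≤ ε) (y : Fin d → ℝ) : chi ε y ≤ 1 := by
  have h1 := chi_pos hε y
  have h2 := chi_mul hε y
  have : 0 ≤ chi ε y * (ε * ‖y‖) := by positivity
  nlinarith

lemma chi_grow {ε : ℝ} (hε : 0 < ε) (hε1 : ε ≤ 1) (y : Fin d → ℝ) : chi ε y * (1 + ‖y‖) ≤ ε⁻¹ := by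
  have h1 := chi_pos hε.le y
  have h2 := chi_mul hε.le y
  rw [le_inv_comm₀ (by positivity) hε, ← one_div, le_div_iff₀ (by positivity)]
  nlinarith [norm_nonneg y]

lemma chi_sub {ε : ℝ} (hε : 0 < ε) (y y' : Fin d → ℝ) :
    |chi ε y - chi ε y'| ≤ ε * chi ε y * ‖y - y'‖ := by
  have h1 := chi_pos hε.le y
  have h1' := chi_pos hε.le y'
  have h2 := chi_mul hε.le y
  have h2' := chi_mul hε.le y'
  have h3 := chi_le hε.le y'
  have e : chi ε y - chi ε y' = ε * chi ε y * (chi ε y' * (‖y'‖ - ‖y‖)) := by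
    have : chi ε y - chi ε y' = chi ε y * (chi ε y' * (1 + ε * ‖y'‖)) - chi ε y' * (chi ε y * (1 + ε * ‖y‖)) := by
      rw [h2, h2']; ring
    rw [this]; ring
  rw [e, abs_mul, abs_of_pos (by positivity : 0 < ε * chi ε y)]
  refine mul_le_mul_of_nonneg_left ?_ (by positivity)
  rw [abs_mul, abs_of_pos h1']
  have h4 := abs_norm_sub_norm_le y' y
  rw [norm_sub_rev] at h4
  nlinarith [abs_nonneg (‖y'‖ - ‖y‖)]

lemma fchi_near {α lm Λ β : ℝ} (hα1 : α < 1) (hα : 0 < α) (hΛ : 0 ≤ Λ) {f : (Fin d → ℝ) → Fin d → ℝ}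
    {a : (Fin d → ℝ) → Fin d → Fin d → ℝ} (h : OrC α lm Λ β f a) {ε : ℝ} (hε : 0 < ε)
    (y y' : Fin d → ℝ) (hy : ‖y - y'‖ ≤ 1) (i : Fin d) :
    |chi ε y * f y i - chi ε y' * f y' i| ≤ (chi ε y' + ε * chi ε y) * (Λ * (1 + ‖y‖) * ‖y - y'‖ ^ α) := by
  have e : chi ε y * f y i - chi ε y' * f y' i = chi ε y' * (f y i - f y' i) + (chi ε y - chi ε y') * f y i := by ring
  have h1 := mul_le_mul_of_nonneg_left (h.fh y y' hy i) (chi_pos hε.le y').le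
  have hT : ‖y - y'‖ ≤ ‖y - y'‖ ^ α := by
    have := lip_min (norm_nonneg (y - y')) hα.le hα1.le
    rwa [min_eq_right hy] at this
  have hc := chi_pos hε.le y
  have h2 : |chi ε y - chi ε y'| * |f y i| ≤ (ε * chi ε y * ‖y - y'‖ ^ α) * (Λ * (1 + ‖y‖)) := by
    refine mul_le_mul ((chi_sub hε y y').trans ?_) (h.fb y i) (abs_nonneg _) (by positivity)
    exact mul_le_mul_of_nonneg_left hT (by positivity)
  rw [e]
  refine (abs_add_le _ _).trans ?_
  rw [abs_mul, abs_mul, abs_of_pos (chi_pos hε.le y')]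
  linarith

lemma Or_Cl {α lm Λ β : ℝ} (hα1 : α < 1) (hα : 0 < α) (hΛ : 0 ≤ Λ) (hβ : 0 < β) {f : (Fin d → ℝ) → Fin d → ℝ}
    {a : (Fin d → ℝ) → Fin d → Fin d → ℝ} (h : OrC α lm Λ β f a) {ε : ℝ} (hε : 0 < ε) (hε1 : ε ≤ 1) :
    Cl α lm (2 * Λ + β) β (fun y i => chi ε y * f y i) a where
  ell := h.ell
  ab y i j := (h.ab y i j).trans (by linarith)
  fb y i := by
    rw [abs_mul, abs_of_pos (chi_pos hε.le y)]
    have h1 := h.fb y i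
    have h2 := chi_le hε.le y
    have h3 := norm_nonneg y
    have h4 : chi ε y * |f y i| ≤ |f y i| := mul_le_of_le_one_left (abs_nonneg _) h2
    nlinarith
  ah y y' hy i j := (h.ah y y' hy i j).trans
    (mul_le_mul_of_nonneg_right (by linarith) (Real.rpow_nonneg (norm_nonneg _) _))
  fh y y' hy i := by
    refine (fchi_near hα1 hα hΛ h hε y y' hy i).trans ?_
    have h1 : 0 ≤ (1 + ‖y‖) * ‖y - y'‖ ^ α := mul_nonneg (by positivity) (Real.rpow_nonneg (norm_nonneg _) _)
    have h2 := chi_le hε.le y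
    have h2' := chi_le hε.le y'
    have h3 := chi_pos hε.le y
    have h4 : chi ε y' + ε * chi ε y ≤ 2 := by nlinarith
    have h5 : (chi ε y' + ε * chi ε y) * (Λ * (1 + ‖y‖) * ‖y - y'‖ ^ α) ≤ 2 * (Λ * (1 + ‖y‖) * ‖y - y'‖ ^ α) :=
      mul_le_mul_of_nonneg_right h4 (by rw [mul_assoc]; exact mul_nonneg hΛ h1)
    nlinarith
  dis y := by
    have e : ∑ i, chi ε y * f y i * y i = chi ε y * ∑ i, f y i * y i := by
      rw [Finset.mul_sum]; exact Finset.sum_congr rfl fun i _ => by ring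
    rw [e]
    have h1 := chi_pos hε.le y
    have h2 := chi_mul hε.le y
    have h3 := chi_le hε.le y
    have h4 := mul_le_mul_of_nonneg_left (h.dis y) h1.le
    have hn := norm_nonneg y
    have h5 : ‖y‖ - 1 ≤ chi ε y * ‖y‖ ^ 2 := by
      have h6 : 1 ≤ chi ε y * (1 + ‖y‖) := by nlinarith [mul_nonneg h1.le hn]
      nlinarith [mul_nonneg h1.le hn, mul_le_mul_of_nonneg_right h6 hn]
    have h7 := mul_le_mul_of_nonneg_left h5 hβ.le
    nlinarith

lemma Or_BC {α lm Λ β : ℝ} (hα1 : α < 1) (hα : 0 < α) (hΛ : 0 ≤ Λ) {f : (Fin d → ℝ) → Fin d → ℝ}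
    {a : (Fin d → ℝ) → Fin d → Fin d → ℝ} (h : OrC α lm Λ β f a) {ε : ℝ} (hε : 0 < ε) (hε1 : ε ≤ 1) :
    BC α lm (6 * Λ * ε⁻¹) (fun y i => chi ε y * f y i) a := by
  have hi : 1 ≤ ε⁻¹ := (one_le_inv₀ hε).2 hε1
  have hΛi : Λ ≤ Λ * ε⁻¹ := le_mul_of_one_le_right hΛ hi
  have fb : ∀ y i, |chi ε y * f y i| ≤ Λ * ε⁻¹ := fun y i => by
    rw [abs_mul, abs_of_pos (chi_pos hε.le y)]
    have h1 := mul_le_mul_of_nonneg_left (h.fb y i) (chi_pos hε.le y).le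
    have h2 := mul_le_mul_of_nonneg_left (chi_grow hε hε1 y) hΛ
    linarith
  refine ⟨h.ell, fun y i j => (h.ab y i j).trans (by linarith), fun y i => (fb y i).trans (by linarith),
    fun y y' i j => ?_, fun y y' i => ?_⟩
  · refine (near_far hα hΛ (norm_nonneg _) (fun hy => h.ah y y' hy i j) (b := 2 * Λ) (by positivity) ?_).trans
      (mul_le_mul_of_nonneg_right (by linarith) (Real.rpow_nonneg (norm_nonneg _) _))
    exact (abs_sub _ _).trans (by linarith [h.ab y i j, h.ab y' i j])
  · refine (near_far hα (M := 4 * (Λ * ε⁻¹)) (by positivity) (norm_nonneg (y - y')) (fun hy => ?_) (b := 2 * (Λ * ε⁻¹))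
      (by positivity) ?_).trans
      (mul_le_mul_of_nonneg_right (by linarith) (Real.rpow_nonneg (norm_nonneg _) _))
    · refine (fchi_near hα1 hα hΛ h hε y y' hy i).trans ?_
      have hT := Real.rpow_nonneg (norm_nonneg (y - y')) α
      have h1 : (chi ε y' + ε * chi ε y) * (1 + ‖y‖) ≤ 4 * ε⁻¹ := by
        have q1 := chi_grow hε hε1 y
        have q2 := chi_grow hε hε1 y'
        have q3 := chi_pos hε.le y'
        have q4 := chi_le hε.le y'
        have q5 : ‖y‖ ≤ ‖y'‖ + 1 := by
          have := norm_add_le (y - y') y'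
          rw [sub_add_cancel] at this; linarith
        have q6 : 0 ≤ chi ε y * (1 + ‖y‖) := mul_nonneg (chi_pos hε.le y).le (by positivity)
        have q7 := mul_le_mul_of_nonneg_left q5 q3.le
        nlinarith
      have h2 := mul_le_mul_of_nonneg_right h1 (mul_nonneg hΛ hT)
      linarith
    · exact (abs_sub _ _).trans (by linarith [fb y i, fb y' i])

/-- coordinatewise clamp -/
def clampV (R : ℝ) (y : Fin d → ℝ) : Fin d → ℝ := fun i => max (-R) (min R (y i))

lemma clampV_lip (R : ℝ) (y y' : Fin d → ℝ) : ‖clampV R y - clampV R y'‖ ≤ ‖y - y'‖ := by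
  rw [pi_norm_le_iff_of_nonneg (norm_nonneg _)]
  intro i
  refine le_trans ?_ (norm_le_pi_norm (y - y') i)
  simp only [Pi.sub_apply, Real.norm_eq_abs, clampV]
  refine (abs_max_sub_max_le_max _ _ _ _).trans ?_
  rw [sub_self, abs_zero, max_eq_right (abs_nonneg _)]
  refine (abs_min_sub_min_le_max _ _ _ _).trans ?_
  rw [sub_self, abs_zero, max_eq_right (abs_nonneg _)]

lemma clampV_abs {R : ℝ} (hR : 0 ≤ R) (y : Fin d → ℝ) (i : Fin d) :
    |clampV R y i| ≤ R ∧ |clampV R y i| ≤ |y i| := by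
  simp only [clampV]
  refine ⟨abs_le.2 ⟨le_max_left _ _, max_le (by linarith) (min_le_left _ _)⟩, abs_le.2 ⟨?_, ?_⟩⟩
  · rcases le_total R (y i) with h | h
    · rw [min_eq_left h]
      exact le_trans (by have := abs_nonneg (y i); linarith) (le_max_right _ _)
    · rw [min_eq_right h]; exact le_trans (neg_abs_le _) (le_max_right _ _)
  · exact max_le (by have := abs_nonneg (y i); linarith) ((min_le_right _ _).trans (le_abs_self _))

lemma clampV_norm {R : ℝ} (hR : 0 ≤ R) (y : Fin d → ℝ) : ‖clampV R y‖ ≤ R :=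
  (pi_norm_le_iff_of_nonneg hR).2 fun i => (clampV_abs hR y i).1

lemma clampV_VV {R : ℝ} (hR : 0 ≤ R) (y : Fin d → ℝ) : VV (clampV R y) ≤ VV y := by
  unfold VV esq
  gcongr 1 + ∑ i, ?_ with i
  simp only [Pi.zero_apply, sub_zero]
  exact sq_le_sq.2 (clampV_abs hR y i).2

lemma clampV_eq {R : ℝ} {y : Fin d → ℝ} (h : ‖y‖ ≤ R) : clampV R y = y := by
  funext i
  have := abs_le.1 ((norm_le_pi_norm y i).trans h)
  simp only [clampV]
  rw [min_eq_right this.2, max_eq_right this.1]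

lemma WB_limit {ι : Type*} (U : Ultrafilter ι) {α K : ℝ} {p : ℕ} {u : ι → (Fin d → ℝ) → ℝ} {w : (Fin d → ℝ) → ℝ}
    (h : ∀ n, WB α p K (u n)) (h0 : ∀ x, Tendsto (fun n => u n x) U (𝓝 (w x)))
    (h1 : ∀ x i, Tendsto (fun n => pd1 (u n) x i) U (𝓝 (pd1 w x i)))
    (h2 : ∀ x i j, Tendsto (fun n => pd2 (u n) x i j) U (𝓝 (pd2 w x i j))) : WB α p K w := fun x =>
  ⟨le_of_tendsto (h0 x).abs (Eventually.of_forall fun n => (h n x).1),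
    fun i => le_of_tendsto (h1 x i).abs (Eventually.of_forall fun n => (h n x).2.1 i),
    fun i j => le_of_tendsto (h2 x i j).abs (Eventually.of_forall fun n => (h n x).2.2.1 i j),
    fun x' hx' i j => le_of_tendsto ((h2 x i j).sub (h2 x' i j)).abs
      (Eventually.of_forall fun n => (h n x).2.2.2 x' hx' i j)⟩

lemma exist0 {α : ℝ} (hα : 0 < α) (hα1 : α < 1) {lm Λ β : ℝ} (hlm : 0 < lm) (hΛ : 0 ≤ Λ) (hβ : 0 < β) (p : ℕ) :
    ∃ C, 1 ≤ C ∧ ∀ f a, OrC α lm Λ β f a → ∀ B : (Fin d → ℝ) → ℝ, ∀ N, 0 < N → (∀ y, |B y| ≤ N * VV y ^ p) →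
      (∀ y y', ‖y - y'‖ ≤ 1 → |B y - B y'| ≤ N * VV y ^ p * ‖y - y'‖ ^ α) →
      ∃ w c, ContDiff ℝ 2 w ∧ WB α (p + 3) (C * N) w ∧ ∀ y, genL f a w y = B y + c := by
  have hΛ' : 0 ≤ 2 * Λ + β := by positivity
  obtain ⟨C1, hC1, hQ⟩ := Qest (d := d) hα hα1 hlm hΛ' hβ p
  obtain ⟨C2, hC2, hS⟩ := wS (d := d) (β := β) hα hα1 hlm hΛ' (p + 1)
  refine ⟨C2 * C1, one_le_mul_of_one_le_of_one_le hC2 hC1, fun f a h B N hN hB hBh => ?_⟩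
  set ε : ℕ → ℝ := fun n => 1 / ((n:ℝ) + 1) with hε
  have ε0 : ∀ n, 0 < ε n := fun n => by simp only [hε]; positivity
  have ε1 : ∀ n, ε n ≤ 1 := fun n => by
    simp only [hε]
    rw [div_le_one (by positivity)]
    have : (0:ℝ) ≤ n := Nat.cast_nonneg n
    linarith
  set g : ℕ → (Fin d → ℝ) → ℝ := fun n y => B (clampV (n:ℝ) y) with hg
  have gb : ∀ n y, |g n y| ≤ N * VV y ^ p := fun n y => by
    refine (hB _).trans (mul_le_mul_of_nonneg_left ?_ hN.le)
    exact pow_le_pow_left₀ (VV_pos _).le (clampV_VV (Nat.cast_nonneg n) y) p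
  have gh : ∀ n y y', ‖y - y'‖ ≤ 1 → |g n y - g n y'| ≤ N * VV y ^ p * ‖y - y'‖ ^ α := fun n y y' hy => by
    refine (hBh _ _ ((clampV_lip _ _ _).trans hy)).trans ?_
    have h1 := VV_pos y
    have h2 := VV_pos (clampV (n:ℝ) y)
    refine mul_le_mul (mul_le_mul_of_nonneg_left ?_ hN.le) ?_ (Real.rpow_nonneg (norm_nonneg _) _) (by positivity)
    · exact pow_le_pow_left₀ h2.le (clampV_VV (Nat.cast_nonneg n) y) p
    · exact Real.rpow_le_rpow (norm_nonneg _) (clampV_lip _ _ _) hα.le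
  have gHN : ∀ n : ℕ, HN α (3 * (N * (1 + d * (n:ℝ) ^ 2) ^ p)) (g n) := by
    intro n
    set b : ℝ := N * (1 + d * (n:ℝ) ^ 2) ^ p with hb
    have hb0 : 0 ≤ b := by positivity
    have q0 : ∀ y : Fin d → ℝ, N * VV (clampV (n:ℝ) y) ^ p ≤ b := fun y => by
      refine mul_le_mul_of_nonneg_left (pow_le_pow_left₀ (VV_pos _).le ?_ p) hN.le
      refine (VV_le _).trans ?_
      have := clampV_norm (Nat.cast_nonneg (α := ℝ) n) y
      gcongr
    have q1 : ∀ y, |g n y| ≤ b := fun y => (hB _).trans (q0 y)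
    refine ⟨fun y => (q1 y).trans (by linarith), fun y y' => ?_⟩
    refine (near_far hα hb0 (norm_nonneg (y - y')) (fun hy => ?_) (b := 2 * b) (by positivity) ?_).trans
      (mul_le_mul_of_nonneg_right (by linarith) (Real.rpow_nonneg (norm_nonneg _) _))
    · refine (hBh _ _ ((clampV_lip _ _ _).trans hy)).trans ?_
      exact mul_le_mul (q0 y) (Real.rpow_le_rpow (norm_nonneg _) (clampV_lip _ _ _) hα.le)
        (Real.rpow_nonneg (norm_nonneg _) _) hb0
    · exact (abs_sub _ _).trans (by linarith [q1 y, q1 y'])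
  have hsol : ∀ n, ∃ u, ContDiff ℝ 2 u ∧ (∃ b, GB α b u) ∧
      ∀ y, genL (fun y i => chi (ε n) y * f y i) a u y - ε n * u y = g n y := fun n =>
    solvM hα hα1 (by have := ε0 n; positivity) (ε0 n) (Or_BC hα1 hα hΛ h (ε0 n) (ε1 n)) (g n) _ (by positivity) (gHN n)
  choose u hu hGB heq using hsol
  have hCl : ∀ n, Cl α lm (2 * Λ + β) β (fun y i => chi (ε n) y * f y i) a := fun n =>
    Or_Cl hα1 hα hΛ hβ h (ε0 n) (ε1 n)
  have hub : ∀ n, ∃ K, ∀ y, |u n y| ≤ K := fun n => by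
    obtain ⟨b, hb⟩ := hGB n
    exact ⟨b, fun y => (hb ‖y‖ y le_rfl).1⟩
  have hol : ∀ n, ∃ K, ∀ z z' i j, |pd2 (u n) z i j - pd2 (u n) z' i j| ≤ K * ‖z - z'‖ ^ α := fun n => by
    obtain ⟨b, hb⟩ := hGB n
    exact ⟨b, fun z z' i j => (hb (max ‖z‖ ‖z'‖) z (le_max_left _ _)).2.2.2 z' (le_max_right _ _) i j⟩
  have hq := fun n => hQ _ _ _ (u n) (g n) N hN (hCl n) (ε0 n) (ε1 n) (hu n) (hub n) (hol n) (heq n) (gb n) (gh n)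
  set w : ℕ → (Fin d → ℝ) → ℝ := fun n y => u n y - u n 0 with hw
  have hwc : ∀ n, ContDiff ℝ 2 (w n) := fun n => (hu n).sub contDiff_const
  have hwp2 : ∀ n y i j, pd2 (w n) y i j = pd2 (u n) y i j := fun n y i j => by
    simp only [hw]
    rw [pd2_sub (hu n) contDiff_const, pd2_const, sub_zero]
  have hweq : ∀ n y, genL (fun y i => chi (ε n) y * f y i) a (w n) y - ε n * w n y = g n y + ε n * u n 0 := by
    intro n y
    simp only [hw]
    rw [genL_sub _ a (hu n) contDiff_const, genL_const, ← heq n y]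
    ring
  have hWB : ∀ n, WB α (p + 1 + 2) (C2 * (C1 * N)) (w n) := by
    intro n
    refine hS _ a (ε n) (w n) _ (C1 * N) (by positivity) (hCl n) (ε0 n).le (ε1 n) (hwc n) ?_ (hq n).1 ?_ (hweq n)
    · obtain ⟨K, hK⟩ := hol n
      exact ⟨K, fun z z' i j => by rw [hwp2, hwp2]; exact hK z z' i j⟩
    · intro y y' hy
      rw [add_sub_add_right_eq_sub]
      refine (gh n y y' hy).trans (mul_le_mul_of_nonneg_right ?_ (Real.rpow_nonneg (norm_nonneg _) _))
      have h1 := VV_pos y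
      refine mul_le_mul (le_mul_of_one_le_left hN.le hC1) (pow_le_pow_right₀ (VV_ge_one y) (by omega))
        (by positivity) (by positivity)
  set U : Ultrafilter ℕ := hyperfilter ℕ with hU
  have hUle : (U : Filter ℕ) ≤ atTop := by rw [← Nat.cofinite_eq_atTop]; exact hyperfilter_le_cofinite
  obtain ⟨v, hv2, hv, hvd1, hvd2, -⟩ := compC U hα hwc
    (fun R => ⟨_, Eventually.of_forall fun n => WB_LB hα (hWB n) R⟩)
  obtain ⟨c, hc⟩ := ultra_lim U (x := fun n => ε n * u n 0) (b := C1 * N) (Eventually.of_forall fun n => by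
    rw [abs_mul, abs_of_pos (ε0 n)]; exact (hq n).2)
  refine ⟨v, c, hv2, ?_, fun y => ?_⟩
  · rw [mul_assoc]
    exact WB_limit U hWB hv hvd1 hvd2
  · have hone : Tendsto ε U (𝓝 0) := tendsto_one_div_add_atTop_nhds_zero_nat.mono_left hUle
    have hchi : Tendsto (fun n => chi (ε n) y) U (𝓝 1) := by
      have : Tendsto (fun n => (1 + ε n * ‖y‖)⁻¹) U (𝓝 ((1 + 0 * ‖y‖)⁻¹)) :=
        ((hone.mul_const _).const_add 1).inv₀ (by simp)
      simpa [chi] using this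
    have hfn : ∀ i, Tendsto (fun n => chi (ε n) y * f y i) U (𝓝 (f y i)) := fun i => by
      simpa using hchi.mul_const (f y i)
    have hgl : Tendsto (fun n => g n y) U (𝓝 (B y)) := by
      refine tendsto_const_nhds.congr' (Eventually.filter_mono hUle ?_)
      filter_upwards [eventually_ge_atTop ⌈‖y‖⌉₊] with n hn
      simp only [hg]
      rw [clampV_eq ((Nat.le_ceil _).trans (by exact_mod_cast hn))]
    have h1 := genL_tendsto (fn := fun n i => chi (ε n) y * f y i) (an := fun n => a y) hfn
      (fun i j => tendsto_const_nhds) (hvd1 y) (hvd2 y)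
    have h2 : Tendsto (fun n => ε n * w n y + (g n y + ε n * u n 0)) U (𝓝 (0 * v y + (B y + c))) :=
      (hone.mul (hv y)).add (hgl.add hc)
    rw [zero_mul, zero_add] at h2
    refine tendsto_nhds_unique (h1.congr (fun n => ?_)) h2
    have := hweq n y
    unfold genL at this
    linarith

end EX

section PI
open Filter Topology
variable {d : ℕ}

lemma pos_sq_deriv (t : ℝ) : HasDerivAt (fun s : ℝ => max 0 s ^ 2) (2 * max 0 t) t := by
  rcases lt_trichotomy t 0 with h | h | h
  · rw [max_eq_left h.le, mul_zero]
    refine (hasDerivAt_const t (0:ℝ)).congr_of_eventuallyEq ?_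
    filter_upwards [Iio_mem_nhds h] with s hs
    rw [max_eq_left (le_of_lt hs)]; norm_num
  · subst h
    have : HasFDerivAt (fun s : ℝ => max 0 s ^ 2) (0 : ℝ →L[ℝ] ℝ) 0 := by
      refine Asymptotics.IsBigO.hasFDerivAt (n := 2) ?_ (by norm_num)
      refine Asymptotics.IsBigO.of_bound 1 (Eventually.of_forall fun s => ?_)
      rw [one_mul, norm_pow, norm_pow, sub_zero, norm_norm]
      refine pow_le_pow_left₀ (norm_nonneg _) ?_ 2
      rw [Real.norm_eq_abs, Real.norm_eq_abs, abs_of_nonneg (le_max_left _ _)]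
      exact max_le (abs_nonneg s) (le_abs_self s)
    have := this.hasDerivAt
    simpa using this
  · rw [max_eq_right h.le]
    have h2 : HasDerivAt (fun s : ℝ => s ^ 2) (2 * t) t := by simpa using hasDerivAt_pow 2 t
    refine h2.congr_of_eventuallyEq ?_
    filter_upwards [Ioi_mem_nhds h] with s hs
    rw [max_eq_right (le_of_lt hs)]

lemma pos_cube_deriv (t : ℝ) : HasDerivAt (fun s : ℝ => max 0 s ^ 3) (3 * max 0 t ^ 2) t := by
  rcases lt_trichotomy t 0 with h | h | h
  · rw [max_eq_left h.le]
    norm_num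
    refine (hasDerivAt_const t (0:ℝ)).congr_of_eventuallyEq ?_
    filter_upwards [Iio_mem_nhds h] with s hs
    rw [max_eq_left (le_of_lt hs)]; norm_num
  · subst h
    have : HasFDerivAt (fun s : ℝ => max 0 s ^ 3) (0 : ℝ →L[ℝ] ℝ) 0 := by
      refine Asymptotics.IsBigO.hasFDerivAt (n := 3) ?_ (by norm_num)
      refine Asymptotics.IsBigO.of_bound 1 (Eventually.of_forall fun s => ?_)
      rw [one_mul, norm_pow, norm_pow, sub_zero, norm_norm]
      refine pow_le_pow_left₀ (norm_nonneg _) ?_ 3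
      rw [Real.norm_eq_abs, Real.norm_eq_abs, abs_of_nonneg (le_max_left _ _)]
      exact max_le (abs_nonneg s) (le_abs_self s)
    have := this.hasDerivAt
    simpa using this
  · rw [max_eq_right h.le]
    have h2 : HasDerivAt (fun s : ℝ => s ^ 3) (3 * t ^ 2) t := by simpa using hasDerivAt_pow 3 t
    refine h2.congr_of_eventuallyEq ?_
    filter_upwards [Ioi_mem_nhds h] with s hs
    rw [max_eq_right (le_of_lt hs)]

lemma pos_cube_contDiff : ContDiff ℝ 2 (fun s : ℝ => max 0 s ^ 3) := by
  rw [show (2 : WithTop ℕ∞) = 1 + 1 by norm_num, contDiff_succ_iff_deriv]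
  refine ⟨fun t => (pos_cube_deriv t).differentiableAt, by simp, ?_⟩
  have e : deriv (fun s : ℝ => max 0 s ^ 3) = fun t => 3 * max 0 t ^ 2 := by
    funext t; exact (pos_cube_deriv t).deriv
  rw [e]
  refine contDiff_const.mul ?_
  rw [contDiff_one_iff_deriv]
  refine ⟨fun t => (pos_sq_deriv t).differentiableAt, ?_⟩
  have e2 : deriv (fun s : ℝ => max 0 s ^ 2) = fun t => 2 * max 0 t := by
    funext t; exact (pos_sq_deriv t).deriv
  rw [e2]; fun_prop

/-- cutoff profile and its derivatives -/
def ct (R t : ℝ) : ℝ := max 0 (1 - t / R)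

lemma ct_nonneg (R t : ℝ) : 0 ≤ ct R t := le_max_left _ _
lemma ct_le {R t : ℝ} (hR : 0 < R) (ht : 0 ≤ t) : ct R t ≤ 1 :=
  max_le zero_le_one (by have : 0 ≤ t / R := by positivity
                         linarith)
lemma ct_zero {R t : ℝ} (hR : 0 < R) (ht : R ≤ t) : ct R t = 0 :=
  max_eq_left (by have : 1 ≤ t / R := (one_le_div hR).2 ht
                  linarith)
lemma ct_cont (R : ℝ) : Continuous (ct R) := by unfold ct; fun_prop

lemma ct3_deriv (R t : ℝ) : HasDerivAt (fun s => ct R s ^ 3) (-(3 / R) * ct R t ^ 2) t := by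
  have h1 : HasDerivAt (fun s : ℝ => 1 - s / R) (-(1 / R)) t := by
    simpa using ((hasDerivAt_id t).div_const R).const_sub 1
  have := (pos_cube_deriv (1 - t / R)).comp t h1
  simp only [Function.comp_def] at this
  exact this.congr_deriv (by simp only [ct]; ring)

lemma ct2_deriv (R t : ℝ) : HasDerivAt (fun s => -(3 / R) * ct R s ^ 2) (6 / R ^ 2 * ct R t) t := by
  have h1 : HasDerivAt (fun s : ℝ => 1 - s / R) (-(1 / R)) t := by
    simpa using ((hasDerivAt_id t).div_const R).const_sub 1
  have := ((pos_sq_deriv (1 - t / R)).comp t h1).const_mul (-(3 / R))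
  simp only [Function.comp_def] at this
  exact this.congr_deriv (by simp only [ct]; ring)

lemma ct3_contDiff (R : ℝ) : ContDiff ℝ 2 (fun s => ct R s ^ 3) := by
  have : ContDiff ℝ 2 (fun s : ℝ => 1 - s / R) := by fun_prop
  exact pos_cube_contDiff.comp this

lemma ct_tendsto (t : ℝ) : Tendsto (fun n : ℕ => ct ((n:ℝ) + 1) t) atTop (𝓝 1) := by
  have h : Tendsto (fun n : ℕ => t / ((n:ℝ) + 1)) atTop (𝓝 0) := by
    have := (tendsto_one_div_add_atTop_nhds_zero_nat (𝕜 := ℝ)).const_mul t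
    simp only [mul_zero] at this
    refine this.congr fun n => ?_
    ring
  have h2 : Tendsto (fun n : ℕ => max 0 (1 - t / ((n:ℝ) + 1))) atTop (𝓝 (max 0 (1 - 0))) :=
    tendsto_const_nhds.max (h.const_sub 1)
  simpa [ct] using h2

lemma pd2_comp {G G1 G2 : ℝ → ℝ} (h1 : ∀ t, HasDerivAt G (G1 t) t) (h2 : ∀ t, HasDerivAt G1 (G2 t) t)
    {s : (Fin d → ℝ) → ℝ} (hs : ContDiff ℝ 2 s) (y : Fin d → ℝ) (i j : Fin d) :
    pd2 (fun y => G (s y)) y i j = G1 (s y) * pd2 s y i j + G2 (s y) * (pd1 s y i * pd1 s y j) := by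
  rw [pd2_eq]
  have e : (fun z => pd1 (fun y => G (s y)) z j) = fun z => G1 (s z) * pd1 s z j :=
    funext fun z => pd1_comp (C2_diff hs z) (h1 _) j
  have hd : Differentiable ℝ (fun y => G1 (s y)) := fun z =>
    ((h2 _).comp_hasFDerivAt z (C2_diff hs z).hasFDerivAt).differentiableAt
  rw [e, pd1_mul hd (C2_pd1_diff hs j), pd1_comp (C2_diff hs y) (h2 _), pd2_eq]
  ring

lemma genL_comp {G G1 G2 : ℝ → ℝ} (h1 : ∀ t, HasDerivAt G (G1 t) t) (h2 : ∀ t, HasDerivAt G1 (G2 t) t)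
    {s : (Fin d → ℝ) → ℝ} (hs : ContDiff ℝ 2 s) (f : (Fin d → ℝ) → Fin d → ℝ)
    (a : (Fin d → ℝ) → Fin d → Fin d → ℝ) (y : Fin d → ℝ) :
    genL f a (fun y => G (s y)) y = G1 (s y) * genL f a s y +
      G2 (s y) * ∑ i, ∑ j, pd1 s y i * a y i j * pd1 s y j := by
  have e0 : ∀ i, pd1 (fun y => G (s y)) y i = G1 (s y) * pd1 s y i := fun i => pd1_comp (C2_diff hs y) (h1 _) i
  unfold genL
  simp_rw [e0, pd2_comp h1 h2 hs, mul_add, Finset.sum_add_distrib, Finset.mul_sum]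
  have e1 : ∀ i, f y i * (G1 (s y) * pd1 s y i) = G1 (s y) * (f y i * pd1 s y i) := fun i => by ring
  have e2 : ∀ i j, a y i j * (G1 (s y) * pd2 s y i j) = G1 (s y) * (a y i j * pd2 s y i j) := fun i j => by ring
  have e3 : ∀ i j, a y i j * (G2 (s y) * (pd1 s y i * pd1 s y j)) = G2 (s y) * (pd1 s y i * a y i j * pd1 s y j) :=
    fun i j => by ring
  simp_rw [e1, e2, e3]
  ring

lemma near_cont {α : ℝ} (hα : 0 < α) {g c : (Fin d → ℝ) → ℝ}
    (h : ∀ y y', ‖y - y'‖ ≤ 1 → |g y - g y'| ≤ c y * ‖y - y'‖ ^ α) : Continuous g := by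
  rw [continuous_iff_continuousAt]
  intro y
  have h1 : Tendsto (fun y' => c y * ‖y - y'‖ ^ α) (𝓝 y) (𝓝 0) := by
    have h2 : Continuous fun y' => c y * ‖y - y'‖ ^ α :=
      continuous_const.mul (((continuous_const.sub continuous_id).norm).rpow_const fun _ => Or.inr hα.le)
    have := h2.tendsto y
    simpa [Real.zero_rpow hα.ne'] using this
  rw [ContinuousAt, tendsto_iff_norm_sub_tendsto_zero]
  refine squeeze_zero' (Eventually.of_forall fun _ => norm_nonneg _) ?_ h1
  filter_upwards [Metric.closedBall_mem_nhds y one_pos] with y' hy'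
  rw [Real.norm_eq_abs, abs_sub_comm]
  refine h y y' ?_
  rwa [Metric.mem_closedBall, dist_eq_norm, norm_sub_rev] at hy'

lemma Cl_cont {α lm Λ β : ℝ} (hα : 0 < α) {f : (Fin d → ℝ) → Fin d → ℝ} {a : (Fin d → ℝ) → Fin d → Fin d → ℝ}
    (h : Cl α lm Λ β f a) : (∀ i, Continuous fun y => f y i) ∧ ∀ i j, Continuous fun y => a y i j :=
  ⟨fun i => near_cont hα (c := fun y => Λ * (1 + ‖y‖)) fun y y' hy => h.fh y y' hy i,
    fun i j => near_cont hα (c := fun _ => Λ) fun y y' hy => h.ah y y' hy i j⟩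

lemma genL_cont {α lm Λ β : ℝ} (hα : 0 < α) {f : (Fin d → ℝ) → Fin d → ℝ} {a : (Fin d → ℝ) → Fin d → Fin d → ℝ}
    (h : Cl α lm Λ β f a) {u : (Fin d → ℝ) → ℝ} (hu : ContDiff ℝ 2 u) : Continuous (genL f a u) := by
  obtain ⟨h1, h2⟩ := Cl_cont hα h
  unfold genL
  exact (continuous_finsetSum _ fun i _ => (h1 i).mul (C2_pd1_cont hu i)).add
    (continuous_finsetSum _ fun i _ => continuous_finsetSum _ fun j _ => (h2 i j).mul (C2_pd2_cont hu i j))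

lemma cs_of_zero {g : (Fin d → ℝ) → ℝ} {ρ : ℝ} (h0 : ∀ y, ρ < ‖y‖ → g y = 0) : HasCompactSupport g :=
  HasCompactSupport.intro (isCompact_closedBall 0 ρ) fun y hy => h0 y (by simpa using hy)

lemma int_of_zero {g : (Fin d → ℝ) → ℝ} (hg : Continuous g) {ρ : ℝ} (h0 : ∀ y, ρ < ‖y‖ → g y = 0)
    (π : Measure (Fin d → ℝ)) [IsProbabilityMeasure π] : Integrable g π :=
  hg.integrable_of_hasCompactSupport (cs_of_zero h0)

lemma cbTwo_of_zero {g : (Fin d → ℝ) → ℝ} (hg : ContDiff ℝ 2 g) {ρ : ℝ} (h0 : ∀ y, ρ < ‖y‖ → g y = 0) : CbTwo g := by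
  have hc := cs_of_zero h0
  obtain ⟨K0, h0⟩ := hg.continuous.bounded_above_of_compact_support hc
  obtain ⟨K1, h1⟩ := (hg.continuous_iteratedFDeriv (m := 1) (by norm_num)).bounded_above_of_compact_support
    (hc.iteratedFDeriv (𝕜 := ℝ) 1)
  obtain ⟨K2, h2⟩ := (hg.continuous_iteratedFDeriv (m := 2) (by norm_num)).bounded_above_of_compact_support
    (hc.iteratedFDeriv (𝕜 := ℝ) 2)
  exact ⟨hg, max K0 (max K1 K2), fun y => ⟨(h0 y).trans (le_max_left _ _),
    (h1 y).trans ((le_max_left _ _).trans (le_max_right _ _)),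
    (h2 y).trans ((le_max_right _ _).trans (le_max_right _ _))⟩⟩

lemma VV_far {R : ℝ} (hR : 0 < R) {y : Fin d → ℝ} (hy : R < ‖y‖) (m : ℕ) : R ≤ VV y ^ (m + 1) := by
  have h1 := VV_ge y
  have h2 : VV y ≤ VV y ^ (m + 1) := le_self_pow₀ (VV_ge_one y) (by omega)
  nlinarith [sq_nonneg (‖y‖ - 1)]

lemma moments {Λ β : ℝ} (hΛ : 0 ≤ Λ) (hβ : 0 < β) (m : ℕ) : ∃ M, 0 ≤ M ∧ ∀ (α lm : ℝ), 0 < α → ∀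
    (f : (Fin d → ℝ) → Fin d → ℝ) (a : (Fin d → ℝ) → Fin d → Fin d → ℝ) (π : Measure (Fin d → ℝ)),
    Cl α lm Λ β f a → IsInvariantMeasure f a π →
    Integrable (fun y => VV y ^ m) π ∧ ∫ y, VV y ^ m ∂π ≤ M := by
  obtain ⟨R0, C, hR0, hC, hly⟩ := lyap (d := d) hΛ hβ m
  refine ⟨C, hC, fun α lm hα f a π h hπ => ?_⟩
  have := hπ.1
  have hVc : ∀ k, Continuous (fun y : Fin d → ℝ => VV y ^ k) := fun k => (VV_contDiff (n := 2) k).continuous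
  have key : ∀ n : ℕ, Integrable (fun y => ct ((n:ℝ) + 1) (VV y ^ (m + 1)) ^ 2 * VV y ^ m) π ∧
      ∫ y, ct ((n:ℝ) + 1) (VV y ^ (m + 1)) ^ 2 * VV y ^ m ∂π ≤ C := by
    intro n
    set R : ℝ := (n:ℝ) + 1 with hRdef
    have hR : 0 < R := by positivity
    have hP : Continuous fun y : Fin d → ℝ => ct R (VV y ^ (m + 1)) := (ct_cont R).comp (hVc (m + 1))
    have hP0 : ∀ y : Fin d → ℝ, R < ‖y‖ → ct R (VV y ^ (m + 1)) = 0 := fun y hy => ct_zero hR (VV_far hR hy m)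
    have hη2 : ContDiff ℝ 2 (fun y : Fin d → ℝ => ct R (VV y ^ (m + 1)) ^ 3) := (ct3_contDiff R).comp (VV_contDiff (m + 1))
    have hcb := cbTwo_of_zero hη2 (ρ := R) (fun y hy => by rw [hP0 y hy]; norm_num)
    have h0 := hπ.2 _ hcb
    have hform := genL_comp (ct3_deriv R) (ct2_deriv R) (VV_contDiff (d := d) (m + 1)) f a
    have i1 : Integrable (fun y => ct R (VV y ^ (m + 1)) ^ 2 * VV y ^ m) π :=
      int_of_zero ((hP.pow 2).mul (hVc m)) (ρ := R) (fun y hy => by simp [hP0 y hy]) π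
    have i2 : Integrable (fun y => ct R (VV y ^ (m + 1)) ^ 2) π :=
      int_of_zero (hP.pow 2) (ρ := R) (fun y hy => by simp [hP0 y hy]) π
    have i3 : Integrable (genL f a (fun y : Fin d → ℝ => ct R (VV y ^ (m + 1)) ^ 3)) π :=
      int_of_zero (genL_cont hα h hη2) (ρ := R) (fun y hy => by rw [hform, hP0 y hy]; norm_num) π
    refine ⟨i1, ?_⟩
    have hpt : ∀ y, ct R (VV y ^ (m + 1)) ^ 2 * VV y ^ m - C * ct R (VV y ^ (m + 1)) ^ 2 ≤
        R / 3 * genL f a (fun y => ct R (VV y ^ (m + 1)) ^ 3) y := by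
      intro y
      rw [hform]
      have q1 := (hly α lm f a h).2 y
      have q2 := h.ell.2.2 y (pd1 (fun y => VV y ^ (m + 1)) y)
      have q3 : 0 ≤ lm * ∑ i, pd1 (fun y => VV y ^ (m + 1)) y i ^ 2 :=
        mul_nonneg h.ell.1.le (Finset.sum_nonneg fun i _ => sq_nonneg _)
      set Q := ∑ i, ∑ j, pd1 (fun y => VV y ^ (m + 1)) y i * a y i j * pd1 (fun y => VV y ^ (m + 1)) y j
      have q4 : 0 ≤ Q := by linarith
      have q5 := ct_nonneg R (VV y ^ (m + 1))
      have q6 : 0 ≤ R / 3 * (6 / R ^ 2 * ct R (VV y ^ (m + 1)) * Q) := by positivity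
      have q7 := mul_le_mul_of_nonneg_left q1 (sq_nonneg (ct R (VV y ^ (m + 1))))
      have q8 : R / 3 * (-(3 / R) * ct R (VV y ^ (m + 1)) ^ 2 * genL f a (fun y => VV y ^ (m + 1)) y) =
        -(ct R (VV y ^ (m + 1)) ^ 2 * genL f a (fun y => VV y ^ (m + 1)) y) := by field_simp
      rw [mul_add, q8]
      linarith
    have hIntg := integral_mono (i1.sub (i2.const_mul C)) (i3.const_mul (R / 3)) hpt
    rw [integral_const_mul, h0, mul_zero] at hIntg
    simp only [Pi.sub_apply] at hIntg
    rw [integral_sub i1 (i2.const_mul C), integral_const_mul] at hIntg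
    have hle : ∫ y, ct R (VV y ^ (m + 1)) ^ 2 ∂π ≤ 1 := by
      have := integral_mono i2 (integrable_const (1:ℝ)) (fun y => by
        have q5 := ct_nonneg R (VV y ^ (m + 1))
        exact pow_le_one₀ q5 (ct_le hR (pow_pos (VV_pos y) _).le))
      simpa using this
    nlinarith
  have hfat : ∫⁻ y, ENNReal.ofReal (VV y ^ m) ∂π ≤ ENNReal.ofReal C := by
    have h1 : ∀ y : Fin d → ℝ, ENNReal.ofReal (VV y ^ m) = liminf (fun n : ℕ =>
        ENNReal.ofReal (ct ((n:ℝ) + 1) (VV y ^ (m + 1)) ^ 2 * VV y ^ m)) atTop := by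
      intro y
      refine (Tendsto.liminf_eq ?_).symm
      refine (ENNReal.continuous_ofReal.tendsto _).comp ?_
      simpa using ((ct_tendsto (VV y ^ (m + 1))).pow 2).mul_const (VV y ^ m)
    calc ∫⁻ y, ENNReal.ofReal (VV y ^ m) ∂π = ∫⁻ y, liminf (fun n : ℕ =>
        ENNReal.ofReal (ct ((n:ℝ) + 1) (VV y ^ (m + 1)) ^ 2 * VV y ^ m)) atTop ∂π := by simp_rw [← h1]
      _ ≤ liminf (fun n : ℕ => ∫⁻ y, ENNReal.ofReal (ct ((n:ℝ) + 1) (VV y ^ (m + 1)) ^ 2 * VV y ^ m) ∂π) atTop := by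
          refine lintegral_liminf_le fun n => ?_
          refine ENNReal.measurable_ofReal.comp (Continuous.measurable ?_)
          exact (((ct_cont _).comp (hVc (m + 1))).pow 2).mul (hVc m)
      _ ≤ ENNReal.ofReal C := by
          refine liminf_le_of_le (by isBoundedDefault) fun b hb => ?_
          obtain ⟨n, hn⟩ := hb.exists
          refine hn.trans ?_
          rw [← ofReal_integral_eq_lintegral_ofReal (key n).1
            (Eventually.of_forall fun y => mul_nonneg (sq_nonneg _) (pow_pos (VV_pos y) m).le)]
          exact ENNReal.ofReal_le_ofReal (key n).2
  have hi : Integrable (fun y : Fin d → ℝ => VV y ^ m) π := by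
    refine ⟨(hVc m).aestronglyMeasurable, ?_⟩
    rw [hasFiniteIntegral_iff_ofReal (Eventually.of_forall fun y => (pow_pos (VV_pos y) m).le)]
    exact hfat.trans_lt ENNReal.ofReal_lt_top
  refine ⟨hi, ?_⟩
  rw [← ofReal_integral_eq_lintegral_ofReal hi (Eventually.of_forall fun y => (pow_pos (VV_pos y) m).le)] at hfat
  exact (ENNReal.ofReal_le_ofReal_iff hC).1 hfat

lemma Or_Cl' {α lm Λ β : ℝ} (hΛ : 0 ≤ Λ) (hβ : 0 < β) {f : (Fin d → ℝ) → Fin d → ℝ}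
    {a : (Fin d → ℝ) → Fin d → Fin d → ℝ} (h : OrC α lm Λ β f a) : Cl α lm (2 * Λ + β) β f a := by
  refine ⟨h.ell, fun y i j => (h.ab y i j).trans (by linarith), fun y i => (h.fb y i).trans ?_,
    fun y y' hy i j => (h.ah y y' hy i j).trans ?_, fun y y' hy i => (h.fh y y' hy i).trans ?_, fun y => ?_⟩
  · have := norm_nonneg y
    gcongr; linarith
  · have := Real.rpow_nonneg (norm_nonneg (y - y')) α
    gcongr; linarith
  · have := Real.rpow_nonneg (norm_nonneg (y - y')) α
    have := norm_nonneg y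
    gcongr; linarith
  · have := h.dis y
    nlinarith [sq_nonneg (‖y‖ - 1)]

lemma genL_abs {α lm Λ β : ℝ} (hΛ : 0 ≤ Λ) {f : (Fin d → ℝ) → Fin d → ℝ}
    {a : (Fin d → ℝ) → Fin d → Fin d → ℝ} (h : Cl α lm Λ β f a) {w : (Fin d → ℝ) → ℝ} {y : Fin d → ℝ} {P : ℝ}
    (hP : 0 ≤ P) (h1 : ∀ i, |pd1 w y i| ≤ P) (h2 : ∀ i j, |pd2 w y i j| ≤ P) :
    |genL f a w y| ≤ (2 * d + d ^ 2) * Λ * VV y * P := by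
  have hV := VV_ge_one y
  have hV2 : 1 + ‖y‖ ≤ 2 * VV y := by nlinarith [VV_ge y, sq_nonneg (‖y‖ - 1)]
  have e1 : |∑ i, f y i * pd1 w y i| ≤ d * (Λ * (2 * VV y) * P) := abs_sum_le_card fun i => by
    rw [abs_mul]
    have := h.fb y i
    exact mul_le_mul (this.trans (by gcongr)) (h1 i) (abs_nonneg _) (by positivity)
  have e2 : |∑ i, ∑ j, a y i j * pd2 w y i j| ≤ d * (d * (Λ * P)) := abs_sum_le_card fun i => abs_sum_le_card fun j => by
    rw [abs_mul]
    exact mul_le_mul (h.ab y i j) (h2 i j) (abs_nonneg _) hΛ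
  have e3 : (d:ℝ) * (d * (Λ * P)) ≤ d * (d * (Λ * P)) * VV y := le_mul_of_one_le_right (by positivity) hV
  unfold genL
  refine (abs_add_le _ _).trans ?_
  calc _ ≤ d * (Λ * (2 * VV y) * P) + d * (d * (Λ * P)) * VV y := by linarith
    _ = _ := by ring

lemma pd1_VV (y : Fin d → ℝ) (i : Fin d) : pd1 VV y i = 2 * y i := by
  have e : (VV : (Fin d → ℝ) → ℝ) = fun y => 1 + esq 0 y := rfl
  rw [e, pd1_add (differentiable_const 1) ((esq_contDiff (n := 1) 0).differentiable (by norm_num)), pd1_const, pd1_esq]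
  simp

lemma abs_pd1_VV (y : Fin d → ℝ) (i : Fin d) : |pd1 VV y i| ≤ VV y := by
  rw [pd1_VV, abs_mul, abs_two]
  have : |y i| ≤ ‖y‖ := norm_le_pi_norm y i
  nlinarith [VV_ge y, sq_nonneg (‖y‖ - 1)]

lemma abs_pd2_VV (y : Fin d → ℝ) (i j : Fin d) : |pd2 VV y i j| ≤ 2 := by
  rw [pd2_eq]
  simp_rw [pd1_VV]
  rw [pd1_cmul (u := fun z : Fin d → ℝ => z j) (by fun_prop), abs_mul, abs_two]
  have h1 : |pd1 (fun z : Fin d → ℝ => z j) y i| ≤ 1 := by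
    have e : fderiv ℝ (fun z : Fin d → ℝ => z j) y = ContinuousLinearMap.proj j :=
      (ContinuousLinearMap.proj (R := ℝ) (φ := fun _ : Fin d => ℝ) j).fderiv
    unfold pd1
    rw [e]
    have := norm_le_pi_norm (Pi.single i (1:ℝ) : Fin d → ℝ) j
    exact this.trans (norm_single_one_le i)
  linarith

lemma VV_C2 : ContDiff ℝ 2 (VV : (Fin d → ℝ) → ℝ) := contDiff_const.add (esq_contDiff 0)

lemma cut_pd1 {R : ℝ} (hR : 1 ≤ R) (y : Fin d → ℝ) (i : Fin d) :
    |pd1 (fun y => ct R (VV y) ^ 3) y i| ≤ 12 * VV y ^ 2 / R := by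
  have e := pd1_comp (C2_diff VV_C2 y) (ct3_deriv R (VV y)) i
  rw [e]
  have hR0 : 0 < R := by linarith
  have hV := VV_ge_one y
  have c0 := ct_nonneg R (VV y)
  have c1 := ct_le hR0 (VV_pos y).le
  have hv := abs_pd1_VV y i
  have hc2 : ct R (VV y) ^ 2 ≤ 1 := pow_le_one₀ c0 c1
  rw [abs_mul, abs_mul, abs_neg, abs_of_nonneg (show 0 ≤ 3 / R by positivity), abs_of_nonneg (sq_nonneg (ct R (VV y)))]
  calc 3 / R * ct R (VV y) ^ 2 * |pd1 VV y i| ≤ 3 / R * 1 * VV y := by gcongr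
    _ = 3 * VV y / R := by ring
    _ ≤ _ := div_le_div_of_nonneg_right (by nlinarith) hR0.le

lemma cut_pd2 {R : ℝ} (hR : 1 ≤ R) (y : Fin d → ℝ) (i j : Fin d) :
    |pd2 (fun y => ct R (VV y) ^ 3) y i j| ≤ 12 * VV y ^ 2 / R := by
  have e := pd2_comp (ct3_deriv R) (ct2_deriv R) VV_C2 y i j
  rw [e]
  have hR0 : 0 < R := by linarith
  have hV := VV_ge_one y
  have c0 := ct_nonneg R (VV y)
  have c1 := ct_le hR0 (VV_pos y).le
  have hc2 : ct R (VV y) ^ 2 ≤ 1 := pow_le_one₀ c0 c1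
  have q1 : |(-(3 / R) * ct R (VV y) ^ 2) * pd2 VV y i j| ≤ 3 / R * 1 * 2 := by
    rw [abs_mul, abs_mul, abs_neg, abs_of_nonneg (show 0 ≤ 3 / R by positivity), abs_of_nonneg (sq_nonneg (ct R (VV y)))]
    have := abs_pd2_VV y i j
    gcongr
  have q2 : |(6 / R ^ 2 * ct R (VV y)) * (pd1 VV y i * pd1 VV y j)| ≤ 6 / R * 1 * (VV y * VV y) := by
    rw [abs_mul, abs_mul, abs_of_nonneg (show 0 ≤ 6 / R ^ 2 by positivity), abs_of_nonneg c0, abs_mul]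
    have := abs_pd1_VV y i
    have := abs_pd1_VV y j
    have : R ≤ R ^ 2 := by nlinarith
    gcongr
  refine (abs_add_le _ _).trans ((add_le_add q1 q2).trans ?_)
  have : 3 / R * 1 * 2 + 6 / R * 1 * (VV y * VV y) = (6 + 6 * VV y ^ 2) / R := by ring
  rw [this]
  gcongr
  nlinarith

lemma cut_prod {α K R : ℝ} {p : ℕ} {w : (Fin d → ℝ) → ℝ} (hw : ContDiff ℝ 2 w) (hWB : WB α p K w) (hR : 1 ≤ R)
    (y : Fin d → ℝ) :
    (∀ i, |pd1 (fun y => ct R (VV y) ^ 3 * w y) y i - ct R (VV y) ^ 3 * pd1 w y i| ≤ 36 * K * VV y ^ (p + 2) / R) ∧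
    ∀ i j, |pd2 (fun y => ct R (VV y) ^ 3 * w y) y i j - ct R (VV y) ^ 3 * pd2 w y i j| ≤ 36 * K * VV y ^ (p + 2) / R := by
  have hη : ContDiff ℝ 2 (fun y : Fin d → ℝ => ct R (VV y) ^ 3) := (ct3_contDiff R).comp VV_C2
  have hK := WB_nonneg hWB
  have hR0 : 0 < R := by linarith
  have hV := VV_pos y
  obtain ⟨w0, w1, w2, -⟩ := hWB y
  have hm : ∀ s t : ℝ, |s| ≤ K * VV y ^ p → |t| ≤ 12 * VV y ^ 2 / R → |s * t| ≤ 12 * K * VV y ^ (p + 2) / R := by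
    intro s t hs ht
    rw [abs_mul]
    calc _ ≤ K * VV y ^ p * (12 * VV y ^ 2 / R) := mul_le_mul hs ht (abs_nonneg _) (by positivity)
      _ = _ := by ring
  have hpos : 0 ≤ 12 * K * VV y ^ (p + 2) / R := by positivity
  have e36 : 36 * K * VV y ^ (p + 2) / R = 3 * (12 * K * VV y ^ (p + 2) / R) := by ring
  rw [e36]
  refine ⟨fun i => ?_, fun i j => ?_⟩
  · rw [pd1_mul (C2_diff hη) (C2_diff hw), add_sub_cancel_left]
    have := hm _ _ w0 (cut_pd1 hR y i)
    linarith
  · rw [pd2_mul hη hw]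
    have h1 := abs_le.1 (hm _ _ w0 (cut_pd2 hR y i j))
    have h2 := abs_le.1 (hm _ _ (w1 j) (cut_pd1 hR y i))
    have h3 := abs_le.1 (hm _ _ (w1 i) (cut_pd1 hR y j))
    rw [abs_le]
    constructor <;> nlinarith

lemma zero_mean {α lm Λ β : ℝ} (hα : 0 < α) (hΛ : 0 ≤ Λ) (hβ : 0 < β) {f : (Fin d → ℝ) → Fin d → ℝ}
    {a : (Fin d → ℝ) → Fin d → Fin d → ℝ} {π : Measure (Fin d → ℝ)} (h : Cl α lm Λ β f a)
    (hπ : IsInvariantMeasure f a π) {K : ℝ} {p : ℕ} {w : (Fin d → ℝ) → ℝ} (hw : ContDiff ℝ 2 w) (hWB : WB α p K w) :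
    ∫ y, genL f a w y ∂π = 0 := by
  have hpr := hπ.1
  obtain ⟨M, hM, hmom⟩ := moments (d := d) hΛ hβ (p + 3)
  have hIntg := (hmom α lm hα f a π h hπ).1
  have hK := WB_nonneg hWB
  set g : ℕ → (Fin d → ℝ) → ℝ := fun n y => ct ((n:ℝ) + 1) (VV y) ^ 3 * w y with hg
  have hR : ∀ n : ℕ, (1:ℝ) ≤ (n:ℝ) + 1 := fun n => by have : (0:ℝ) ≤ n := Nat.cast_nonneg n
                                                      linarith
  have hg2 : ∀ n, ContDiff ℝ 2 (g n) := fun n => ((ct3_contDiff _).comp VV_C2).mul hw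
  have hz : ∀ n, ∫ y, genL f a (g n) y ∂π = 0 := fun n => by
    refine hπ.2 _ (cbTwo_of_zero (hg2 n) (ρ := (n:ℝ) + 1) fun y hy => ?_)
    have := VV_far (by linarith [hR n]) hy 0
    simp only [hg]
    rw [ct_zero (by linarith [hR n]) (by simpa using this)]
    norm_num
  have hlim : Tendsto (fun n => ∫ y, genL f a (g n) y ∂π) atTop (𝓝 (∫ y, genL f a w y ∂π)) := by
    refine tendsto_integral_of_dominated_convergence
      (fun y => (2 * d + d ^ 2) * Λ * (37 * K) * VV y ^ (p + 3))
      (fun n => (genL_cont hα h (hg2 n)).aestronglyMeasurable) (hIntg.const_mul _) (fun n => ?_) ?_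
    · refine Eventually.of_forall fun y => ?_
      have hV := VV_ge_one y
      have hV0 := VV_pos y
      obtain ⟨q1, q2⟩ := cut_prod hw hWB (hR n) y
      obtain ⟨w0, w1, w2, -⟩ := hWB y
      have c0 := ct_nonneg ((n:ℝ) + 1) (VV y)
      have c3 : ct ((n:ℝ) + 1) (VV y) ^ 3 ≤ 1 := pow_le_one₀ c0 (ct_le (by linarith [hR n]) hV0.le)
      have c30 : 0 ≤ ct ((n:ℝ) + 1) (VV y) ^ 3 := pow_nonneg c0 3
      have hd1 : 36 * K * VV y ^ (p + 2) / ((n:ℝ) + 1) ≤ 36 * K * VV y ^ (p + 2) := div_le_self (by positivity) (hR n)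
      have hp : VV y ^ p ≤ VV y ^ (p + 2) := pow_le_pow_right₀ hV (by omega)
      have hKp : K * VV y ^ p ≤ K * VV y ^ (p + 2) := by gcongr
      have gen : ∀ s t : ℝ, |t| ≤ K * VV y ^ p → |s - ct ((n:ℝ) + 1) (VV y) ^ 3 * t| ≤ 36 * K * VV y ^ (p + 2) / ((n:ℝ) + 1) →
          |s| ≤ 37 * K * VV y ^ (p + 2) := by
        intro s t ht hs
        have h1 : |ct ((n:ℝ) + 1) (VV y) ^ 3 * t| ≤ |t| := by
          rw [abs_mul, abs_of_nonneg c30]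
          exact mul_le_of_le_one_left (abs_nonneg _) c3
        have h2 := abs_add_le (s - ct ((n:ℝ) + 1) (VV y) ^ 3 * t) (ct ((n:ℝ) + 1) (VV y) ^ 3 * t)
        rw [sub_add_cancel] at h2
        linarith
      have := genL_abs hΛ h (w := g n) (y := y) (P := 37 * K * VV y ^ (p + 2)) (by positivity)
        (fun i => gen _ _ (w1 i) (q1 i)) (fun i j => gen _ _ (w2 i j) (q2 i j))
      rw [Real.norm_eq_abs]
      refine this.trans (le_of_eq ?_)
      ring
    · refine Eventually.of_forall fun y => ?_
      have hc : Tendsto (fun n : ℕ => ct ((n:ℝ) + 1) (VV y) ^ 3) atTop (𝓝 1) := by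
        simpa using (ct_tendsto (VV y)).pow 3
      have hr : Tendsto (fun n : ℕ => 36 * K * VV y ^ (p + 2) / ((n:ℝ) + 1)) atTop (𝓝 0) := by
        have := (tendsto_one_div_add_atTop_nhds_zero_nat (𝕜 := ℝ)).const_mul (36 * K * VV y ^ (p + 2))
        simp only [mul_zero] at this
        refine this.congr fun n => ?_
        ring
      have gen : ∀ (s : ℕ → ℝ) (t : ℝ), (∀ n : ℕ, |s n - ct ((n:ℝ) + 1) (VV y) ^ 3 * t| ≤ 36 * K * VV y ^ (p + 2) / ((n:ℝ) + 1)) →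
          Tendsto s atTop (𝓝 t) := by
        intro s t hs
        have h1 : Tendsto (fun n : ℕ => s n - ct ((n:ℝ) + 1) (VV y) ^ 3 * t) atTop (𝓝 0) :=
          squeeze_zero_norm hs hr
        have h2 := h1.add (hc.mul_const t)
        simpa using h2
      exact genL_tendsto (f := f) (a := a) (y := y) (un := g) (fun i => tendsto_const_nhds (x := f y i))
        (fun i j => tendsto_const_nhds (x := a y i j))
        (fun i => gen _ _ fun n => (cut_prod hw hWB (hR n) y).1 i)
        (fun i j => gen _ _ fun n => (cut_prod hw hWB (hR n) y).2 i j)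
  simp_rw [hz] at hlim
  exact (tendsto_nhds_unique tendsto_const_nhds hlim).symm

lemma exist1 {α : ℝ} (hα : 0 < α) (hα1 : α < 1) {lm Λ β : ℝ} (hlm : 0 < lm) (hΛ : 0 ≤ Λ) (hβ : 0 < β) (p : ℕ) :
    ∃ C, 1 ≤ C ∧ ∀ f a (π : Measure (Fin d → ℝ)), OrC α lm Λ β f a → IsInvariantMeasure f a π →
      ∀ B : (Fin d → ℝ) → ℝ, ∀ N, 0 < N → (∀ y, |B y| ≤ N * VV y ^ p) →
      (∀ y y', ‖y - y'‖ ≤ 1 → |B y - B y'| ≤ N * VV y ^ p * ‖y - y'‖ ^ α) → ∫ y, B y ∂π = 0 →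
      ∃ u, ContDiff ℝ 2 u ∧ WB α (p + 3) (C * N) u ∧ (∀ y, genL f a u y = B y) ∧ Integrable u π ∧ ∫ y, u y ∂π = 0 := by
  obtain ⟨C, hC, hex⟩ := exist0 (d := d) hα hα1 hlm hΛ hβ p
  have hΛ' : 0 ≤ 2 * Λ + β := by positivity
  obtain ⟨M, hM, hmom⟩ := moments (d := d) hΛ' hβ (p + 3)
  refine ⟨C * (1 + M), by nlinarith, fun f a π h hπ B N hN hB hBh hB0 => ?_⟩
  have hpr := hπ.1
  have hcl := Or_Cl' hΛ hβ h
  obtain ⟨w, c, hw, hWB, hL⟩ := hex f a h B N hN hB hBh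
  obtain ⟨hm1, hm2⟩ := hmom α lm hα f a π hcl hπ
  have hzm := zero_mean hα hΛ' hβ hcl hπ hw hWB
  have hBc : Continuous B := near_cont hα (c := fun y => N * VV y ^ p) hBh
  have hBi : Integrable B π := by
    refine (hm1.const_mul N).mono' hBc.aestronglyMeasurable (Eventually.of_forall fun y => ?_)
    refine (hB y).trans ?_
    have := pow_le_pow_right₀ (VV_ge_one y) (show p ≤ p + 3 by omega)
    gcongr
  have hc : c = 0 := by
    simp_rw [hL] at hzm
    rw [integral_add hBi (integrable_const c), hB0] at hzm
    simpa using hzm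
  have hwi : Integrable w π := (hm1.const_mul (C * N)).mono' hw.continuous.aestronglyMeasurable
    (Eventually.of_forall fun y => (hWB y).1)
  set m := ∫ y, w y ∂π with hmdef
  have hCN : 0 ≤ C * N := by positivity
  have hmb : |m| ≤ C * N * M := by
    have : ‖∫ y, w y ∂π‖ ≤ ∫ y, C * N * VV y ^ (p + 3) ∂π :=
      norm_integral_le_of_norm_le (hm1.const_mul (C * N)) (Eventually.of_forall fun y => (hWB y).1)
    rw [integral_const_mul] at this
    exact this.trans (by gcongr)
  have e1 : ∀ y i, pd1 (fun z => w z - m) y i = pd1 w y i := fun y i => by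
    rw [pd1_sub (C2_diff hw) (differentiable_const m), pd1_const, sub_zero]
  have e2 : ∀ y i j, pd2 (fun z => w z - m) y i j = pd2 w y i j := fun y i j => by
    rw [pd2_sub hw contDiff_const, pd2_const, sub_zero]
  refine ⟨fun y => w y - m, hw.sub contDiff_const, fun y => ?_, fun y => ?_, hwi.sub (integrable_const m), ?_⟩
  · obtain ⟨w0, w1, w2, w3⟩ := hWB y
    have hV := one_le_pow₀ (VV_ge_one y) (n := p + 3)
    have hle : C * N * VV y ^ (p + 3) ≤ C * (1 + M) * N * VV y ^ (p + 3) := by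
      have : C * N ≤ C * (1 + M) * N := by nlinarith [mul_nonneg hCN hM]
      gcongr
    refine ⟨?_, fun i => ?_, fun i j => ?_, fun y' hy i j => ?_⟩
    · refine (abs_sub _ _).trans ?_
      have : C * N * M ≤ C * N * M * VV y ^ (p + 3) := le_mul_of_one_le_right (by positivity) hV
      nlinarith
    · rw [e1]; exact (w1 i).trans hle
    · rw [e2]; exact (w2 i j).trans hle
    · rw [e2, e2]
      refine (w3 y' hy i j).trans ?_
      have := Real.rpow_nonneg (norm_nonneg (y - y')) α
      gcongr
  · rw [genL_congr_pd f a (e1 y) (e2 y), hL, hc, add_zero]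
  · rw [integral_sub hwi (integrable_const m)]
    simp [hmdef]

end PI

section FIN
open Filter Topology
variable {d : ℕ}

lemma it1_bound {T : ContinuousMultilinearMap ℝ (fun _ : Fin 1 => Fin d → ℝ) ℝ} {c : Fin d → ℝ} {S : ℝ} (hS : 0 ≤ S)
    (hT : ∀ v, T v = ∑ i, v 0 i * c i) (hc : ∀ i, |c i| ≤ S) : ‖T‖ ≤ d * S := by
  refine ContinuousMultilinearMap.opNorm_le_bound (by positivity) fun v => ?_
  rw [hT, Real.norm_eq_abs]
  have : |∑ i, v 0 i * c i| ≤ d * (‖v 0‖ * S) := abs_sum_le_card fun i => by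
    rw [abs_mul]
    exact mul_le_mul (norm_le_pi_norm (v 0) i) (hc i) (abs_nonneg _) (norm_nonneg _)
  refine this.trans (le_of_eq ?_)
  simp; ring

lemma it2_bound {T : ContinuousMultilinearMap ℝ (fun _ : Fin 2 => Fin d → ℝ) ℝ} {c : Fin d → Fin d → ℝ} {S : ℝ}
    (hS : 0 ≤ S) (hT : ∀ v, T v = ∑ i, ∑ j, v 0 i * v 1 j * c i j) (hc : ∀ i j, |c i j| ≤ S) : ‖T‖ ≤ d ^ 2 * S := by
  refine ContinuousMultilinearMap.opNorm_le_bound (by positivity) fun v => ?_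
  rw [hT, Real.norm_eq_abs]
  have : |∑ i, ∑ j, v 0 i * v 1 j * c i j| ≤ d * (d * (‖v 0‖ * ‖v 1‖ * S)) :=
    abs_sum_le_card fun i => abs_sum_le_card fun j => by
    rw [abs_mul, abs_mul]
    exact mul_le_mul (mul_le_mul (norm_le_pi_norm (v 0) i) (norm_le_pi_norm (v 1) j) (abs_nonneg _) (norm_nonneg _))
      (hc i j) (abs_nonneg _) (by positivity)
  refine this.trans (le_of_eq ?_)
  rw [Fin.prod_univ_two]; ring

lemma it1_apply (u : (Fin d → ℝ) → ℝ) (y : Fin d → ℝ) (v : Fin 1 → Fin d → ℝ) :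
    iteratedFDeriv ℝ 1 u y v = ∑ i, v 0 i * pd1 u y i := by
  rw [iteratedFDeriv_one_apply, fderiv_eq_sum_pd1]

lemma it2_apply {u : (Fin d → ℝ) → ℝ} (hu : ContDiff ℝ 2 u) (y : Fin d → ℝ) (v : Fin 2 → Fin d → ℝ) :
    iteratedFDeriv ℝ 2 u y v = ∑ i, ∑ j, v 0 i * v 1 j * pd2 u y i j := by
  rw [iteratedFDeriv_two_apply]
  have hd : DifferentiableAt ℝ (fderiv ℝ u) y :=
    (hu.fderiv_right (m := 1) (by norm_num [one_add_one_eq_two])).differentiable (by norm_num) y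
  have h1 : fderiv ℝ (fderiv ℝ u) y (v 0) (v 1) = fderiv ℝ (fun z => fderiv ℝ u z (v 1)) y (v 0) := by
    rw [fderiv_clm_apply hd (differentiableAt_const _)]
    simp
  rw [h1]
  have e : (fun z => fderiv ℝ u z (v 1)) = fun z => ∑ j, v 1 j * pd1 u z j :=
    funext fun z => fderiv_eq_sum_pd1 u z (v 1)
  rw [e, fderiv_eq_sum_pd1]
  refine Finset.sum_congr rfl fun i _ => ?_
  rw [pd1_sum _ (fun j => (C2_pd1_diff hu j).const_mul (v 1 j)), Finset.mul_sum]
  refine Finset.sum_congr rfl fun j _ => ?_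
  rw [pd1_cmul (C2_pd1_diff hu j), pd2_eq]
  ring

lemma norm_le_VV (y : Fin d → ℝ) : ‖y‖ ≤ VV y := by
  nlinarith [VV_ge y, sq_nonneg (‖y‖ - 1)]

lemma poly_le_VV (y : Fin d → ℝ) (m : ℕ) : 1 + ‖y‖ ^ m ≤ 2 * VV y ^ m := by
  have h1 := one_le_pow₀ (VV_ge_one y) (n := m)
  have h2 := pow_le_pow_left₀ (norm_nonneg y) (norm_le_VV y) m
  linarith

lemma VV_le_poly (y : Fin d → ℝ) (q : ℕ) : VV y ^ q ≤ (2 * (1 + d)) ^ q * (1 + ‖y‖ ^ (2 * q)) := by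
  have h0 : VV y ≤ 2 * (1 + d) * max 1 (‖y‖ ^ 2) := by
    have h1 := VV_le y
    have h2 := le_max_left 1 (‖y‖ ^ 2)
    have h3 := le_max_right 1 (‖y‖ ^ 2)
    have hd0 : (0:ℝ) ≤ d := Nat.cast_nonneg d
    nlinarith [mul_nonneg hd0 (sub_nonneg.2 h3), mul_nonneg hd0 (sub_nonneg.2 h2)]
  refine (pow_le_pow_left₀ (VV_pos y).le h0 q).trans ?_
  rw [mul_pow]
  have h4 : max 1 (‖y‖ ^ 2) ^ q ≤ 1 + ‖y‖ ^ (2 * q) := by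
    rw [pow_mul]
    rcases le_total 1 (‖y‖ ^ 2) with h | h
    · rw [max_eq_right h]; linarith
    · rw [max_eq_left h, one_pow]
      have := pow_nonneg (sq_nonneg ‖y‖) q
      linarith
  gcongr

lemma rpow_near {t α θ : ℝ} (ht : 0 ≤ t) (ht1 : t ≤ 1) (hα : 0 ≤ α) (h : α ≤ θ) : t ^ θ ≤ t ^ α :=
  Real.rpow_le_rpow_of_exponent_ge' ht ht1 hα h

lemma WB_near {α K : ℝ} (hα : 0 < α) (hα1 : α ≤ 1) {q : ℕ} {u : (Fin d → ℝ) → ℝ} (hu : ContDiff ℝ 2 u) (h : WB α q K u)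
    {y y' : Fin d → ℝ} (hy : ‖y - y'‖ ≤ 1) :
    |u y - u y'| ≤ d * (K * (1 + 2 * d) ^ q) * VV y ^ q * ‖y - y'‖ ^ α ∧
    ∀ i, |pd1 u y i - pd1 u y' i| ≤ d * (K * (1 + 2 * d) ^ q) * VV y ^ q * ‖y - y'‖ ^ α := by
  have hK := WB_nonneg h
  have hV := VV_pos y
  have hz : ∀ z ∈ Metric.closedBall y 1, K * VV z ^ q ≤ K * (1 + 2 * d) ^ q * VV y ^ q := fun z hz => by
    rw [Metric.mem_closedBall, dist_eq_norm] at hz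
    have := VV_near hz
    have := pow_le_pow_left₀ (VV_pos z).le this q
    rw [mul_pow] at this
    rw [mul_assoc]
    gcongr
  have hc : Convex ℝ (Metric.closedBall y 1) := convex_closedBall y 1
  have m1 : y ∈ Metric.closedBall y 1 := Metric.mem_closedBall_self zero_le_one
  have m2 : y' ∈ Metric.closedBall y 1 := by rw [Metric.mem_closedBall, dist_eq_norm, norm_sub_rev]; exact hy
  have ht : ‖y - y'‖ ≤ ‖y - y'‖ ^ α := by
    have := rpow_near (norm_nonneg (y - y')) hy hα.le hα1
    rwa [Real.rpow_one] at this
  have hS : 0 ≤ K * (1 + 2 * d) ^ q * VV y ^ q := by positivity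
  have fin : ∀ φ : (Fin d → ℝ) → ℝ, Differentiable ℝ φ → (∀ z ∈ Metric.closedBall y 1, ∀ i, |pd1 φ z i| ≤ K * VV z ^ q) →
      |φ y - φ y'| ≤ d * (K * (1 + 2 * d) ^ q) * VV y ^ q * ‖y - y'‖ ^ α := by
    intro φ hφ hb
    have := mvt_pd1 hφ hc hS (fun z hz' i => (hb z hz' i).trans (hz z hz')) m1 m2
    refine this.trans ?_
    calc _ ≤ d * (K * (1 + 2 * d) ^ q * VV y ^ q) * ‖y - y'‖ ^ α := by gcongr
      _ = _ := by ring
  exact ⟨fin u (C2_diff hu) fun z _ i => (h z).2.1 i,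
    fun j => fin (fun z => pd1 u z j) (C2_pd1_diff hu j) fun z _ i => (h z).2.2.1 i j⟩

/-- from near Hölder bounds with weights to the global form -/
lemma hold_form {α K L : ℝ} (hα : 0 < α) (hK : 0 ≤ K) (hL : 0 ≤ L) {q : ℕ} {φ : (Fin d → ℝ) → ℝ}
    (hb : ∀ y, |φ y| ≤ K * VV y ^ q)
    (hn : ∀ y y', ‖y - y'‖ ≤ 1 → |φ y - φ y'| ≤ L * VV y ^ q * ‖y - y'‖ ^ α) (y y' : Fin d → ℝ) :
    |φ y - φ y'| ≤ (2 * K + L) * (2 * (1 + d)) ^ q * (min 1 (‖y - y'‖ ^ α) * (1 + ‖y‖ ^ (2 * q) + ‖y'‖ ^ (2 * q))) := by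
  have v1 := VV_le_poly y q
  have v2 := VV_le_poly y' q
  have n1 : 0 ≤ ‖y‖ ^ (2 * q) := by positivity
  have n2 : 0 ≤ ‖y'‖ ^ (2 * q) := by positivity
  set D : ℝ := (2 * (1 + d)) ^ q with hD
  have hD0 : 0 ≤ D := by positivity
  set W := 1 + ‖y‖ ^ (2 * q) + ‖y'‖ ^ (2 * q) with hW
  have w1 : VV y ^ q ≤ D * W := v1.trans (by gcongr; linarith)
  have w2 : VV y' ^ q ≤ D * W := v2.trans (by gcongr; linarith)
  have hW0 : 0 ≤ W := by positivity
  have hDW : 0 ≤ D * W := by positivity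
  rcases le_total ‖y - y'‖ 1 with h | h
  · have ht : ‖y - y'‖ ^ α ≤ 1 := Real.rpow_le_one (norm_nonneg _) h hα.le
    have ht0 : 0 ≤ ‖y - y'‖ ^ α := Real.rpow_nonneg (norm_nonneg _) _
    rw [min_eq_right ht]
    refine (hn y y' h).trans ?_
    have hv0 := VV_pos y
    calc L * VV y ^ q * ‖y - y'‖ ^ α ≤ (2 * K + L) * (D * W) * ‖y - y'‖ ^ α := by gcongr; linarith
      _ = _ := by ring
  · have ht : 1 ≤ ‖y - y'‖ ^ α := Real.one_le_rpow h hα.le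
    rw [min_eq_left ht]
    have h1 := abs_sub (φ y) (φ y')
    have h2 := hb y
    have h3 := hb y'
    have h4 := mul_le_mul_of_nonneg_left w1 hK
    have h5 := mul_le_mul_of_nonneg_left w2 hK
    have h6 : 0 ≤ L * (D * W) := by positivity
    have : (2 * K + L) * D * (1 * W) = 2 * (K * (D * W)) + L * (D * W) := by ring
    linarith

/-- conversion of the weighted bounds to the form in the theorem -/
lemma WB_final {α K : ℝ} (hα : 0 < α) (hα1 : α ≤ 1) (q : ℕ) (hK : 0 ≤ K) :
    ∃ C, 0 ≤ C ∧ ∀ u : (Fin d → ℝ) → ℝ, ContDiff ℝ 2 u → WB α q K u → ∀ y,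
      (|u y| ≤ C * (1 + ‖y‖ ^ (2 * q)) ∧ ‖iteratedFDeriv ℝ 1 u y‖ ≤ C * (1 + ‖y‖ ^ (2 * q)) ∧
        ‖iteratedFDeriv ℝ 2 u y‖ ≤ C * (1 + ‖y‖ ^ (2 * q))) ∧
      ∀ y', |u y - u y'| ≤ C * min 1 (‖y - y'‖ ^ α) * (1 + ‖y‖ ^ (2 * q) + ‖y'‖ ^ (2 * q)) ∧
        ‖iteratedFDeriv ℝ 1 u y - iteratedFDeriv ℝ 1 u y'‖ ≤ C * min 1 (‖y - y'‖ ^ α) * (1 + ‖y‖ ^ (2 * q) + ‖y'‖ ^ (2 * q)) ∧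
        ‖iteratedFDeriv ℝ 2 u y - iteratedFDeriv ℝ 2 u y'‖ ≤ C * min 1 (‖y - y'‖ ^ α) * (1 + ‖y‖ ^ (2 * q) + ‖y'‖ ^ (2 * q)) := by
  set L : ℝ := K + d * (K * (1 + 2 * d) ^ q) with hL
  have hdK : 0 ≤ d * (K * (1 + 2 * d) ^ q) := by positivity
  have hL0 : 0 ≤ L := by positivity
  set E : ℝ := (2 * K + L) * (2 * (1 + d)) ^ q with hE
  have hE0 : 0 ≤ E := by positivity
  set C : ℝ := (1 + d + d ^ 2) * E with hC
  have hd0 : (0:ℝ) ≤ d := Nat.cast_nonneg d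
  have hC0 : 0 ≤ C := by positivity
  have c0 : E ≤ C := by rw [hC]; nlinarith [mul_nonneg hd0 hE0, mul_nonneg (sq_nonneg (d:ℝ)) hE0]
  have c1 : d * E ≤ C := by rw [hC]; nlinarith [mul_nonneg hd0 hE0, mul_nonneg (sq_nonneg (d:ℝ)) hE0]
  have c2 : d ^ 2 * E ≤ C := by rw [hC]; nlinarith [mul_nonneg hd0 hE0, mul_nonneg (sq_nonneg (d:ℝ)) hE0]
  refine ⟨C, hC0, fun u hu h y => ?_⟩
  have hv : K * VV y ^ q ≤ E * (1 + ‖y‖ ^ (2 * q)) := by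
    have := VV_le_poly y q
    have hv0 := VV_pos y
    calc K * VV y ^ q ≤ (2 * K + L) * ((2 * (1 + d)) ^ q * (1 + ‖y‖ ^ (2 * q))) := by gcongr; linarith
      _ = _ := by rw [hE]; ring
  have hP : 0 ≤ 1 + ‖y‖ ^ (2 * q) := by positivity
  obtain ⟨b0, b1, b2, -⟩ := h y
  refine ⟨⟨?_, ?_, ?_⟩, fun y' => ?_⟩
  · exact (b0.trans hv).trans (by gcongr)
  · refine (it1_bound (by positivity) (it1_apply u y) fun i => (b1 i).trans hv).trans ?_
    rw [← mul_assoc]; gcongr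
  · refine (it2_bound (by positivity) (it2_apply hu y) fun i j => (b2 i j).trans hv).trans ?_
    rw [← mul_assoc]; gcongr
  · set W := min 1 (‖y - y'‖ ^ α) * (1 + ‖y‖ ^ (2 * q) + ‖y'‖ ^ (2 * q)) with hW
    have hW0 : 0 ≤ W := by
      have : 0 ≤ min 1 (‖y - y'‖ ^ α) := le_min zero_le_one (Real.rpow_nonneg (norm_nonneg _) _)
      positivity
    rw [mul_assoc, ← hW]
    have up : ∀ y y' : Fin d → ℝ, d * (K * (1 + 2 * d) ^ q) * VV y ^ q * ‖y - y'‖ ^ α ≤ L * VV y ^ q * ‖y - y'‖ ^ α := by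
      intro y y'
      have := Real.rpow_nonneg (norm_nonneg (y - y')) α
      have := VV_pos y
      gcongr; linarith
    have up2 : ∀ y y' : Fin d → ℝ, K * VV y ^ q * ‖y - y'‖ ^ α ≤ L * VV y ^ q * ‖y - y'‖ ^ α := by
      intro y y'
      have := Real.rpow_nonneg (norm_nonneg (y - y')) α
      have := VV_pos y
      gcongr; linarith
    have g0 := hold_form hα hK hL0 (φ := u) (fun y => (h y).1) (fun y y' hy => ((WB_near hα hα1 hu h hy).1).trans (up y y')) y y'
    have g1 := fun i => hold_form hα hK hL0 (φ := fun z => pd1 u z i) (fun y => (h y).2.1 i)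
      (fun y y' hy => ((WB_near hα hα1 hu h hy).2 i).trans (up y y')) y y'
    have g2 := fun i j => hold_form hα hK hL0 (φ := fun z => pd2 u z i j) (fun y => (h y).2.2.1 i j)
      (fun y y' hy => ((h y).2.2.2 y' hy i j).trans (up2 y y')) y y'
    refine ⟨g0.trans (by gcongr), ?_, ?_⟩
    · refine (it1_bound (c := fun i => pd1 u y i - pd1 u y' i) (S := E * W) (by positivity) (fun v => ?_) g1).trans ?_
      · rw [sub_apply, it1_apply, it1_apply, ← Finset.sum_sub_distrib]
        exact Finset.sum_congr rfl fun i _ => by ring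
      · rw [← mul_assoc]; gcongr
    · refine (it2_bound (c := fun i j => pd2 u y i j - pd2 u y' i j) (S := E * W) (by positivity) (fun v => ?_) g2).trans ?_
      · rw [sub_apply, it2_apply hu, it2_apply hu, ← Finset.sum_sub_distrib]
        refine Finset.sum_congr rfl fun i _ => ?_
        rw [← Finset.sum_sub_distrib]
        exact Finset.sum_congr rfl fun j _ => by ring
      · rw [← mul_assoc]; gcongr

lemma OrC_of_A {I : Type*} {f : I → (Fin d → ℝ) → Fin d → ℝ} {a : I → (Fin d → ℝ) → Fin d → Fin d → ℝ}
    (h1 : AssumptionA1 a) (h2 : AssumptionA2 f) {θ : ℝ} (hθ : 0 < θ) : ∃ α lm Λ β, 0 < α ∧ α < 1 ∧ α ≤ θ ∧ 0 < lm ∧ 0 ≤ Λ ∧ 0 < β ∧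
      ∀ p, OrC α lm Λ β (f p) (a p) := by
  obtain ⟨sy, ⟨lm, lp, hlm, -, hell⟩, ⟨K1, hK1⟩, -, -, ⟨K2, θ2, hθ2, -, hh2⟩⟩ := h1
  obtain ⟨⟨β, C1, hβ, hC1, hdis⟩, ⟨C2, hC2⟩, -, -, ⟨K3, θ3, hθ3, -, hh3⟩⟩ := h2
  set α := min θ (min θ2 (min θ3 (1/2))) with hαd
  have hα : 0 < α := lt_min hθ (lt_min hθ2 (lt_min hθ3 (by norm_num)))
  have a1 : α ≤ θ := min_le_left _ _
  have a2 : α ≤ θ2 := (min_le_right _ _).trans (min_le_left _ _)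
  have a3 : α ≤ θ3 := (min_le_right _ _).trans ((min_le_right _ _).trans (min_le_left _ _))
  have a4 : α ≤ 1/2 := (min_le_right _ _).trans ((min_le_right _ _).trans (min_le_right _ _))
  set Λ := |K1| + |K2| + |K3| + |C2| + C1 with hΛ
  have p1 := abs_nonneg K1
  have p2 := abs_nonneg K2
  have p3 := abs_nonneg K3
  have p4 := abs_nonneg C2
  have r1 := le_abs_self K1
  have r2 := le_abs_self K2
  have r3 := le_abs_self K3
  have r4 := le_abs_self C2
  have hΛ0 : 0 ≤ Λ := by positivity
  refine ⟨α, lm, Λ, β, hα, by linarith, a1, hlm, hΛ0, hβ, fun p => ⟨⟨hlm, sy p, fun y ξ => (hell p y ξ).1⟩,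
    fun y i j => (hK1 p y i j).trans (by linarith), fun y i => ?_, fun y y' hy i j => ?_, fun y y' hy i => ?_, fun y => ?_⟩⟩
  · have q1 : |f p y i| ≤ ‖f p y‖ := norm_le_pi_norm (f p y) i
    refine (q1.trans (hC2 p y)).trans ?_
    have := norm_nonneg y
    gcongr; linarith
  · have t0 := Real.rpow_nonneg (norm_nonneg (y - y')) θ2
    refine (hh2 p y y' i j).1.trans ?_
    exact mul_le_mul (by linarith) (rpow_near (norm_nonneg _) hy hα.le a2) t0 hΛ0
  · have t0 := Real.rpow_nonneg (norm_nonneg (y - y')) θ3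
    refine (hh3 p y y' i).1.trans ?_
    have q := norm_nonneg y
    have : K3 ≤ Λ * (1 + ‖y‖) := by nlinarith [mul_nonneg hΛ0 q]
    exact mul_le_mul this (rpow_near (norm_nonneg _) hy hα.le a3) t0 (by positivity)
  · have q1 := hdis p y
    have q2 := norm_sq_le_sum y
    nlinarith

lemma poly_int {α lm Λ β : ℝ} (hα : 0 < α) (hΛ : 0 ≤ Λ) (hβ : 0 < β) {f : (Fin d → ℝ) → Fin d → ℝ}
    {a : (Fin d → ℝ) → Fin d → Fin d → ℝ} {π : Measure (Fin d → ℝ)} (h : Cl α lm Λ β f a)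
    (hπ : IsInvariantMeasure f a π) {g : (Fin d → ℝ) → ℝ} (hg : Continuous g) {K : ℝ} {m : ℕ}
    (hb : ∀ y, |g y| ≤ K * VV y ^ m) : Integrable g π := by
  obtain ⟨M, hM, hmom⟩ := moments (d := d) hΛ hβ m
  exact ((hmom α lm hα f a π h hπ).1.const_mul K).mono' hg.aestronglyMeasurable (Eventually.of_forall hb)

lemma poly_VV {g : (Fin d → ℝ) → ℝ} {K : ℝ} {m : ℕ} (h : ∀ y, |g y| ≤ K * (1 + ‖y‖ ^ m)) (y : Fin d → ℝ) :
    |g y| ≤ 2 * |K| * VV y ^ m := by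
  refine (h y).trans ?_
  have h1 := poly_le_VV y m
  have h2 : 0 ≤ 1 + ‖y‖ ^ m := by positivity
  calc K * (1 + ‖y‖ ^ m) ≤ |K| * (2 * VV y ^ m) := mul_le_mul (le_abs_self K) h1 h2 (abs_nonneg _)
    _ = _ := by ring

lemma uniq {α lm Λ β : ℝ} (hα : 0 < α) (hΛ : 0 ≤ Λ) (hβ : 0 < β) {f : (Fin d → ℝ) → Fin d → ℝ}
    {a : (Fin d → ℝ) → Fin d → Fin d → ℝ} {π : Measure (Fin d → ℝ)} (h : Cl α lm Λ β f a)
    (hπ : IsInvariantMeasure f a π) {u v : (Fin d → ℝ) → ℝ} (hu : ContDiff ℝ 2 u) (hv : ContDiff ℝ 2 v)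
    (he : ∀ y, genL f a u y = genL f a v y) {K K' : ℝ} {m m' : ℕ}
    (hub : ∀ y, |u y| ≤ K * VV y ^ m) (hvb : ∀ y, |v y| ≤ K' * VV y ^ m') (hu0 : ∫ y, u y ∂π = 0)
    (hv0 : ∫ y, v y ∂π = 0) (y : Fin d → ℝ) : u y = v y := by
  have hpr := hπ.1
  have iu := poly_int hα hΛ hβ h hπ hu.continuous hub
  have iv := poly_int hα hΛ hβ h hπ hv.continuous hvb
  set c := u 0 - v 0 with hc
  have huv : ContDiff ℝ 2 (fun y => u y - v y) := hu.sub hv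
  have key : ∀ y, u y - v y - c = 0 := by
    refine liouvilleL hΛ hβ h le_rfl (w := fun y => u y - v y - c) (huv.sub contDiff_const) (fun y => ?_)
      (K := |K| + |K'| + |c|) (p := m + m') (fun y => ?_) (by simp [hc])
    · rw [genL_sub f a huv contDiff_const, genL_sub f a hu hv, genL_const, he]
      ring
    · have hV := VV_ge_one y
      have q1 : VV y ^ m ≤ VV y ^ (m + m') := pow_le_pow_right₀ hV (by omega)
      have q2 : VV y ^ m' ≤ VV y ^ (m + m') := pow_le_pow_right₀ hV (by omega)
      have q3 : 1 ≤ VV y ^ (m + m') := one_le_pow₀ hV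
      have q4 : 0 ≤ VV y ^ m := pow_nonneg (VV_pos y).le m
      have q5 : 0 ≤ VV y ^ m' := pow_nonneg (VV_pos y).le m'
      have s1 : |u y| ≤ |K| * VV y ^ (m + m') := (hub y).trans (mul_le_mul (le_abs_self K) q1 q4 (abs_nonneg _))
      have s2 : |v y| ≤ |K'| * VV y ^ (m + m') := (hvb y).trans (mul_le_mul (le_abs_self K') q2 q5 (abs_nonneg _))
      have s3 : |c| ≤ |c| * VV y ^ (m + m') := le_mul_of_one_le_right (abs_nonneg _) q3
      have s4 := abs_sub (u y - v y) c
      have s5 := abs_sub (u y) (v y)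
      rw [add_mul, add_mul]
      linarith
  have hc0 : c = 0 := by
    have e : u = fun y => v y + c := funext fun y => by linarith [key y]
    have : ∫ y, u y ∂π = ∫ y, (v y + c) ∂π := by rw [← e]
    rw [hu0, integral_add iv (integrable_const c), hv0] at this
    simpa using this.symm
  linarith [key y]

end FIN

/-- existence, regularity and uniqueness for the Poisson equation
`L_{x,μ} u = B` with centered, polynomially growing, locally Hölder data. -/
theorem poisson_equation_exists_unique
    (d k : ℕ) (hd : 0 < d) (hk : 0 < k)
    (f : (Fin d → ℝ) → (Fin d → ℝ) → ProbMeas2 d → Fin d → ℝ)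
    (a : (Fin d → ℝ) → (Fin d → ℝ) → ProbMeas2 d → Fin d → Fin d → ℝ)
    (π : (Fin d → ℝ) → ProbMeas2 d → Measure (Fin d → ℝ))
    (hA1 : AssumptionA1 (fun p : (Fin d → ℝ) × ProbMeas2 d => fun y => a p.1 y p.2))
    (hA2 : AssumptionA2 (fun p : (Fin d → ℝ) × ProbMeas2 d => fun y => f p.1 y p.2))
    (hπ : ∀ x μ, IsInvariantMeasure (fun y => f x y μ) (fun y => a x y μ) (π x μ))
    (B : (Fin d → ℝ) → (Fin d → ℝ) → ProbMeas2 d → Fin k → ℝ)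
    (hBcont : ∀ μ, Continuous fun p : (Fin d → ℝ) × (Fin d → ℝ) => B p.1 p.2 μ)
    (hBcent : ∀ x μ, (∫ y, B x y μ ∂(π x μ)) = 0)
    (hBpoly : ∃ K : ℝ, ∃ m : ℕ, ∀ x y μ, ‖B x y μ‖ ≤ K * (1 + ‖y‖ ^ m))
    (hBhold : ∃ K θ : ℝ, ∃ m : ℕ, 0 < θ ∧ θ ≤ 1 ∧ ∀ x y y' μ,
        ‖B x y μ - B x y' μ‖ ≤
          K * min 1 (‖y - y'‖ ^ θ) * (1 + ‖y‖ ^ m + ‖y'‖ ^ m)) :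
    ∃! u : (Fin d → ℝ) → (Fin d → ℝ) → ProbMeas2 d → Fin k → ℝ,
      (∀ x μ, ContDiff ℝ 2 (fun y => u x y μ)) ∧
      (∀ x y μ (l : Fin k),
          genL (fun z => f x z μ) (fun z => a x z μ) (fun z => u x z μ l) y = B x y μ l) ∧
      (∀ x μ, (∫ y, u x y μ ∂(π x μ)) = 0) ∧
      (∃ K : ℝ, ∃ m : ℕ, ∀ x y μ (l : Fin k),
          |u x y μ l| ≤ K * (1 + ‖y‖ ^ m) ∧
          ‖iteratedFDeriv ℝ 1 (fun z => u x z μ l) y‖ ≤ K * (1 + ‖y‖ ^ m) ∧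
          ‖iteratedFDeriv ℝ 2 (fun z => u x z μ l) y‖ ≤ K * (1 + ‖y‖ ^ m)) ∧
      (∃ K θ : ℝ, ∃ m : ℕ, 0 < θ ∧ θ ≤ 1 ∧ ∀ x y y' μ (l : Fin k),
          |u x y μ l - u x y' μ l| ≤
            K * min 1 (‖y - y'‖ ^ θ) * (1 + ‖y‖ ^ m + ‖y'‖ ^ m) ∧
          ‖iteratedFDeriv ℝ 1 (fun z => u x z μ l) y -
              iteratedFDeriv ℝ 1 (fun z => u x z μ l) y'‖ ≤
            K * min 1 (‖y - y'‖ ^ θ) * (1 + ‖y‖ ^ m + ‖y'‖ ^ m) ∧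
          ‖iteratedFDeriv ℝ 2 (fun z => u x z μ l) y -
              iteratedFDeriv ℝ 2 (fun z => u x z μ l) y'‖ ≤
            K * min 1 (‖y - y'‖ ^ θ) * (1 + ‖y‖ ^ m + ‖y'‖ ^ m)) := by
  obtain ⟨KB, mB, hKB⟩ := hBpoly
  obtain ⟨KH, θ, mH, hθ, hθ1, hKH⟩ := hBhold
  obtain ⟨α, lm, Λ, β, hα, hα1, hαθ, hlm, hΛ, hβ, hOr⟩ := OrC_of_A hA1 hA2 hθ
  have hΛ' : 0 ≤ 2 * Λ + β := by positivity
  set p := mB + mH with hp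
  set N : ℝ := 2 * |KB| + |KH| * (2 + (1 + 2 * d) ^ mH) + 1 with hN
  have hN0 : 0 < N := by positivity
  have hBb : ∀ x μ l y, |B x y μ l| ≤ N * VV y ^ p := by
    intro x μ l y
    have h1 : |B x y μ l| ≤ 2 * |KB| * VV y ^ mB :=
      poly_VV (g := fun y => B x y μ l) (fun y => (norm_le_pi_norm (B x y μ) l).trans (hKB x y μ)) y
    have h2 : VV y ^ mB ≤ VV y ^ p := pow_le_pow_right₀ (VV_ge_one y) (by omega)
    have h3 : 2 * |KB| ≤ N := by
      have : 0 ≤ |KH| * (2 + (1 + 2 * (d:ℝ)) ^ mH) := by positivity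
      rw [hN]; linarith
    have h4 := VV_pos y
    exact h1.trans (mul_le_mul h3 h2 (by positivity) hN0.le)
  have hBn : ∀ x μ l y y', ‖y - y'‖ ≤ 1 → |B x y μ l - B x y' μ l| ≤ N * VV y ^ p * ‖y - y'‖ ^ α := by
    intro x μ l y y' hy
    have h1 : |B x y μ l - B x y' μ l| ≤ ‖B x y μ - B x y' μ‖ := norm_le_pi_norm (B x y μ - B x y' μ) l
    have h2 := hKH x y y' μ
    have h4 := VV_pos y
    have t0 : 0 ≤ ‖y - y'‖ ^ θ := Real.rpow_nonneg (norm_nonneg _) _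
    have t2 : min 1 (‖y - y'‖ ^ θ) ≤ ‖y - y'‖ ^ α :=
      (min_le_right _ _).trans (rpow_near (norm_nonneg _) hy hα.le hαθ)
    have t3 : 0 ≤ min 1 (‖y - y'‖ ^ θ) := le_min zero_le_one t0
    have t4 : 0 ≤ ‖y - y'‖ ^ α := Real.rpow_nonneg (norm_nonneg _) _
    have v1 := poly_le_VV y mH
    have v2 : ‖y'‖ ^ mH ≤ (1 + 2 * d) ^ mH * VV y ^ mH := by
      rw [← mul_pow]
      refine pow_le_pow_left₀ (norm_nonneg _) ((norm_le_VV y').trans (VV_near ?_)) mH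
      rw [norm_sub_rev]; exact hy
    have v3 : VV y ^ mH ≤ VV y ^ p := pow_le_pow_right₀ (VV_ge_one y) (by omega)
    have v4 : 1 + ‖y‖ ^ mH + ‖y'‖ ^ mH ≤ (2 + (1 + 2 * d) ^ mH) * VV y ^ mH := by rw [add_mul]; linarith
    have v5 : 0 ≤ 1 + ‖y‖ ^ mH + ‖y'‖ ^ mH := by positivity
    have v6 : |KH| * (2 + (1 + 2 * (d:ℝ)) ^ mH) ≤ N := by
      have := abs_nonneg KB
      rw [hN]; linarith
    refine (h1.trans h2).trans ?_
    calc KH * min 1 (‖y - y'‖ ^ θ) * (1 + ‖y‖ ^ mH + ‖y'‖ ^ mH)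
        ≤ |KH| * ‖y - y'‖ ^ α * ((2 + (1 + 2 * d) ^ mH) * VV y ^ mH) := by
          refine mul_le_mul (mul_le_mul (le_abs_self KH) t2 t3 (abs_nonneg _)) v4 v5 (by positivity)
      _ = |KH| * (2 + (1 + 2 * d) ^ mH) * VV y ^ mH * ‖y - y'‖ ^ α := by ring
      _ ≤ _ := by gcongr
  have hCl : ∀ x μ, Cl α lm (2 * Λ + β) β (fun y => f x y μ) (fun y => a x y μ) := fun x μ => Or_Cl' hΛ hβ (hOr (x, μ))
  have hBc : ∀ x μ l, Continuous fun y => B x y μ l := fun x μ l =>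
    near_cont hα (c := fun y => N * VV y ^ p) (hBn x μ l)
  have hBi : ∀ x μ l, Integrable (fun y => B x y μ l) (π x μ) := fun x μ l =>
    poly_int hα hΛ' hβ (hCl x μ) (hπ x μ) (hBc x μ l) (hBb x μ l)
  have hB0 : ∀ x μ l, ∫ y, B x y μ l ∂(π x μ) = 0 := fun x μ l => by
    have := congrFun (hBcent x μ) l
    rwa [eval_integral (hBi x μ)] at this
  obtain ⟨C, hC, hex⟩ := exist1 (d := d) hα hα1 hlm hΛ hβ p
  have hCN : 0 ≤ C * N := by positivity
  choose u hu2 huW huL hui hu0 using fun x μ l => hex (fun y => f x y μ) (fun y => a x y μ) (π x μ) (hOr (x, μ)) (hπ x μ)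
    (fun y => B x y μ l) N hN0 (hBb x μ l) (hBn x μ l) (hB0 x μ l)
  obtain ⟨D, hD, hfin⟩ := WB_final (d := d) hα hα1.le (p + 3) hCN
  refine ⟨fun x y μ l => u x μ l y, ⟨fun x μ => contDiff_pi.2 fun l => hu2 x μ l, fun x y μ l => huL x μ l y, fun x μ => ?_,
    ⟨D, 2 * (p + 3), fun x y μ l => (hfin _ (hu2 x μ l) (huW x μ l) y).1⟩,
    ⟨D, α, 2 * (p + 3), hα, hα1.le, fun x y y' μ l => (hfin _ (hu2 x μ l) (huW x μ l) y).2 y'⟩⟩, ?_⟩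
  · funext l
    rw [eval_integral (hui x μ)]
    exact hu0 x μ l
  · rintro v ⟨hv2, hvL, hv0, ⟨Kv, mv, hvb⟩, -⟩
    funext x y μ l
    have hvc : ∀ l, ContDiff ℝ 2 (fun y => v x y μ l) := fun l => contDiff_pi.1 (hv2 x μ) l
    have hvV : ∀ l y, |v x y μ l| ≤ 2 * |Kv| * VV y ^ mv := fun l =>
      poly_VV (g := fun y => v x y μ l) fun y => (hvb x y μ l).1
    have hvi : ∀ l, Integrable (fun y => v x y μ l) (π x μ) := fun l =>
      poly_int hα hΛ' hβ (hCl x μ) (hπ x μ) (hvc l).continuous (hvV l)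
    have hv00 : ∫ y, v x y μ l ∂(π x μ) = 0 := by
      have := congrFun (hv0 x μ) l
      rwa [eval_integral hvi] at this
    exact uniq hα hΛ' hβ (hCl x μ) (hπ x μ) (hvc l) (hu2 x μ l) (fun y => (hvL x y μ l).trans (huL x μ l y).symm)
      (hvV l) (fun y => (huW x μ l y).1) hv00 (hu0 x μ l) y

end
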